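/- There is an absolute constant M₀ such that for every real M ≥ M₀ the following holds. Let n ≥ s + t + 110, let f : F_q^n → F_q, and suppose 0 < μ(S_t) ≤ q^{−M}. Then there exist a ∈ supp(H) and b ∈ F_q^n such that the density of S_t in the zoom-in C_{a,b} is at least 1 − 1/(q−1)² − 1/q⁶ − 2000·t·q^{200}·q^{−M/4}. -/

import Mathlib

noncomputable section

open Finset

/-- Affine maps `F^ℓ → F^n`, given as a pair (linear part matrix, translation). -/
abbrev Aff (F : Type) (n ℓ : ℕ) := Matrix (Fin n) (Fin ℓ) F × (Fin n → F)

/-- Application of an affine map `T = (M, c)`: `x ↦ Mx + c`. -/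
def affApp {F : Type} [Field F] {n ℓ : ℕ} (T : Aff F n ℓ) (x : Fin ℓ → F) : Fin n → F :=
  T.1.mulVec x + T.2

/-- Inner product of two functions `F^m → F`. -/
def ip {F : Type} [Field F] [Fintype F] {m : ℕ} (u v : (Fin m → F) → F) : F :=
  ∑ z : Fin m → F, u z * v z

/-- `g` has degree at most `d` as a function. -/
def fDegLE {F : Type} [Field F] {m : ℕ} (g : (Fin m → F) → F) (d : ℕ) : Prop :=
  ∃ Q : MvPolynomial (Fin m) F, Q.totalDegree ≤ d ∧ ∀ x, MvPolynomial.eval x Q = g x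

/-- The defining equation of the polynomial `P`:
`x_1 ⋯ x_{p-1} · P = ∑_{I ⊆ [p-1]} (-1)^{|I|+1} (x_I + x_p)^{q-1}`. -/
def Pdef {F : Type} [Field F] (p q : ℕ) (hp : 0 < p) (P : MvPolynomial (Fin p) F) : Prop :=
  (∏ i : Fin (p - 1), MvPolynomial.X (Fin.castLE (Nat.sub_le p 1) i)) * P =
    ∑ I : Finset (Fin (p - 1)),
      MvPolynomial.C ((-1 : F) ^ (I.card + 1)) *
        ((∑ i ∈ I, MvPolynomial.X (Fin.castLE (Nat.sub_le p 1) i)) +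
          MvPolynomial.X (⟨p - 1, Nat.sub_lt hp one_pos⟩ : Fin p)) ^ (q - 1)

/-- The test polynomial `H_e` as a function on `F^{s+t}`. -/
def Hfun {F : Type} [Field F] {p : ℕ} (P : MvPolynomial (Fin p) F)
    (s t : ℕ) (e : Fin t → ℕ) (x : Fin (s + t) → F) : F :=
  (∏ i ∈ Finset.range (s / p),
    MvPolynomial.eval (fun l : Fin p =>
      if h : p * i + (l : ℕ) < s + t then x ⟨p * i + (l : ℕ), h⟩ else 0) P) *
  ∏ j : Fin t, x (Fin.natAdd s j) ^ e j

/-- A degree sequence `e ∈ {0, …, q-1}^t` is valid if `∑ e_j ≤ t(q-1) - r`. -/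
def validE (q r t : ℕ) (e : Fin t → ℕ) : Prop :=
  (∀ j, e j ≤ q - 1) ∧ ∑ j, e j ≤ t * (q - 1) - r

/-- `T` rejects `f` in the sparse `(s+t)`-flat test. -/
def rejects {F : Type} [Field F] [Fintype F] {p : ℕ} (P : MvPolynomial (Fin p) F)
    (q s r t n : ℕ) (f : (Fin n → F) → F) (T : Aff F n (s + t)) : Prop :=
  ∃ e : Fin t → ℕ, validE q r t e ∧ ip (fun x => f (affApp T x)) (Hfun P s t e) ≠ 0

/-- Density of `A` inside `C`. -/
def dens {α : Type} (A C : Set α) : ℝ :=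
  (Nat.card ↥(A ∩ C) : ℝ) / (Nat.card ↥C : ℝ)

/-- Fractional measure of a set in a (finite) type. -/
def mu {α : Type} (A : Set α) : ℝ :=
  (Nat.card ↥A : ℝ) / (Nat.card α : ℝ)

/-- The union of the supports of the test polynomials `H_e`. -/
def suppH {F : Type} [Field F] [Fintype F] {p : ℕ} (P : MvPolynomial (Fin p) F)
    (q s t : ℕ) : Set (Fin (s + t) → F) :=
  {x | ∃ e : Fin t → ℕ, (∀ j, e j ≤ q - 1) ∧ Hfun P s t e x ≠ 0}

/-- Edge expansion of a set `S` in the (regular) graph with adjacency `adj`: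
the probability that a uniformly random step started in `S` escapes `S`. -/
def expans {α : Type} (adj : α → α → Prop) (S : Set α) : ℝ :=
  (Nat.card {x : α × α // x.1 ∈ S ∧ adj x.1 x.2 ∧ x.2 ∉ S} : ℝ) /
  (Nat.card {x : α × α // x.1 ∈ S ∧ adj x.1 x.2} : ℝ)

/-- Adjacency in the affine bi-linear scheme graph: two distinct affine maps are adjacent
iff their agreement set is an affine subspace of dimension `ℓ - 1`. -/
def adjBilin {F : Type} [Field F] {n ℓ : ℕ} (T₁ T₂ : Aff F n ℓ) : Prop :=
  T₁ ≠ T₂ ∧ ∃ W : AffineSubspace F (Fin ℓ → F),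
    (W : Set (Fin ℓ → F)).Nonempty ∧
    (W : Set (Fin ℓ → F)) = {x | affApp T₁ x = affApp T₂ x} ∧
    Module.finrank F W.direction = ℓ - 1

/-- `W` is an `ℓ`-flat: a nonempty affine subspace of dimension `ℓ`. -/
def IsFlat {F : Type} [Field F] {N : ℕ} (ℓ : ℕ) (W : AffineSubspace F (Fin N → F)) : Prop :=
  (W : Set (Fin N → F)).Nonempty ∧ Module.finrank F W.direction = ℓ

/-- Adjacency in the affine Grassmann graph `AffGras(N, ℓ)`: two distinct `ℓ`-flats are
adjacent iff their intersection is an `(ℓ-1)`-flat. -/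
def adjGras {F : Type} [Field F] {N : ℕ} (ℓ : ℕ) (U V : AffineSubspace F (Fin N → F)) : Prop :=
  U ≠ V ∧ IsFlat ℓ U ∧ IsFlat ℓ V ∧ IsFlat (ℓ - 1) (U ⊓ V)

/-- The minimal fractional Hamming distance from `f` to a function of degree at most `d`. -/
def deltaDist {F : Type} [Field F] [Fintype F] {n : ℕ} (f : (Fin n → F) → F) (d : ℕ) : ℝ :=
  sInf {x : ℝ | ∃ g : (Fin n → F) → F, fDegLE g d ∧
    x = (Nat.card {y : Fin n → F // f y ≠ g y} : ℝ) / (Fintype.card (Fin n → F) : ℝ)}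

section Spectral

/-- Counting steps inside a set from a bound on the nontrivial Fourier coefficients of the steps. -/
theorem card_steps_le {V Ω : Type*} [AddCommGroup V] [Fintype V] [DecidableEq V] [Fintype Ω] (z : Ω → V) (θ : ℝ)
    (h : ∀ ψ : AddChar V ℂ, ψ ≠ 1 → ‖∑ ω, ψ (z ω)‖ ≤ θ * Fintype.card Ω) (D : Finset V) :
    (∑ ω, #{T ∈ D | T + z ω ∈ D} : ℝ) ≤
      Fintype.card Ω * (θ * #D + (1 - θ) * ((#D : ℝ) ^ 2 / Fintype.card V)) := by
  have hV : (0 : ℝ) < Fintype.card V := by exact_mod_cast Fintype.card_pos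
  have hind : ∀ a : V, (∑ ψ : AddChar V ℂ, ψ a) = if a = 0 then (Fintype.card V : ℂ) else 0 := by
    intro a
    exact_mod_cast AddChar.sum_apply_eq_ite a
  set g : AddChar V ℂ → ℂ := fun ψ => ∑ T ∈ D, ψ T with hg
  have hnorm : ∀ ψ : AddChar V ℂ, (‖g ψ‖ ^ 2 : ℂ) = ∑ T ∈ D, ∑ T' ∈ D, ψ (T - T') := by
    intro ψ
    rw [← Complex.mul_conj', hg, map_sum, Finset.sum_mul_sum]
    refine Finset.sum_congr rfl fun T _ => Finset.sum_congr rfl fun T' _ => ?_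
    rw [sub_eq_add_neg, AddChar.map_add_eq_mul, AddChar.map_neg_eq_conj]
  have hpars : ∑ ψ, ‖g ψ‖ ^ 2 = Fintype.card V * #D := by
    have : ((∑ ψ, ‖g ψ‖ ^ 2 : ℝ) : ℂ) = Fintype.card V * #D := by
      push_cast
      simp_rw [hnorm]
      rw [Finset.sum_comm]
      simp_rw [Finset.sum_comm (s := univ), hind, sub_eq_zero]
      rw [Finset.sum_congr rfl (g := fun _ => (Fintype.card V : ℂ))]
      · simp [mul_comm]
      · intro T hT
        simp [hT]
    exact_mod_cast this
  have hcount : (Fintype.card V * (∑ ω, #{T ∈ D | T + z ω ∈ D} : ℝ) : ℂ) =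
      ∑ ψ, (‖g ψ‖ ^ 2 : ℂ) * ∑ ω, ψ (z ω) := by
    have : ∀ ψ : AddChar V ℂ, (‖g ψ‖ ^ 2 : ℂ) * ∑ ω, ψ (z ω) =
        ∑ ω, ∑ T ∈ D, ∑ T' ∈ D, ψ (T + z ω - T') := by
      intro ψ
      rw [hnorm, Finset.mul_sum]
      refine Finset.sum_congr rfl fun ω _ => ?_
      rw [Finset.sum_mul]
      refine Finset.sum_congr rfl fun T _ => ?_
      rw [Finset.sum_mul]
      refine Finset.sum_congr rfl fun T' _ => ?_
      rw [← AddChar.map_add_eq_mul]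
      congr 1; abel
    simp_rw [this]
    rw [Finset.sum_comm]
    push_cast
    rw [Finset.mul_sum]
    refine Finset.sum_congr rfl fun ω _ => ?_
    rw [Finset.sum_comm]
    simp_rw [Finset.sum_comm (s := univ), hind, sub_eq_zero]
    rw [Finset.card_filter]
    push_cast
    rw [Finset.mul_sum]
    refine Finset.sum_congr rfl fun T _ => ?_
    simp
  have hg1 : ‖g 1‖ ^ 2 = (#D : ℝ) ^ 2 := by simp [hg]
  have key : Fintype.card V * (∑ ω, #{T ∈ D | T + z ω ∈ D} : ℝ) ≤
      (#D : ℝ) ^ 2 * Fintype.card Ω +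
        (Fintype.card V * #D - (#D : ℝ) ^ 2) * (θ * Fintype.card Ω) := by
    have h1 : (Fintype.card V * (∑ ω, #{T ∈ D | T + z ω ∈ D} : ℝ)) =
        ‖∑ ψ, (‖g ψ‖ ^ 2 : ℂ) * ∑ ω, ψ (z ω)‖ := by
      rw [← hcount]
      norm_cast
    rw [h1]
    refine (norm_sum_le _ _).trans ?_
    rw [← Finset.add_sum_erase _ _ (Finset.mem_univ (1 : AddChar V ℂ))]
    refine add_le_add ?_ ?_
    · simp [hg]
    · have h2 : (Fintype.card V * #D - (#D : ℝ) ^ 2) =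
          ∑ ψ ∈ univ.erase (1 : AddChar V ℂ), ‖g ψ‖ ^ 2 := by
        rw [← hpars, ← hg1, ← Finset.add_sum_erase _ _ (Finset.mem_univ (1 : AddChar V ℂ))]
        ring
      rw [h2, Finset.sum_mul]
      refine Finset.sum_le_sum fun ψ hψ => ?_
      rw [norm_mul]
      have : ‖((‖g ψ‖ : ℂ) ^ 2)‖ = ‖g ψ‖ ^ 2 := by simp
      rw [this]
      exact mul_le_mul_of_nonneg_left (h ψ (Finset.ne_of_mem_erase hψ)) (by positivity)
  have e1 : Fintype.card Ω * (θ * #D + (1 - θ) * ((#D : ℝ) ^ 2 / Fintype.card V)) =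
      ((#D : ℝ) ^ 2 * Fintype.card Ω +
        (Fintype.card V * #D - (#D : ℝ) ^ 2) * (θ * Fintype.card Ω)) / Fintype.card V := by
    field_simp
    ring
  rw [e1, le_div_iff₀ hV]
  linarith

theorem addChar_map_sum {V ι : Type*} [AddCommGroup V] (ψ : AddChar V ℂ) (s : Finset ι)
    (g : ι → V) : ψ (∑ i ∈ s, g i) = ∏ i ∈ s, ψ (g i) := by
  classical
  induction s using Finset.induction_on with
  | empty => simp
  | insert a s ha ih => rw [Finset.sum_insert ha, Finset.prod_insert ha, AddChar.map_add_eq_mul, ih]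

section Rk

variable {F : Type*} [Field F] {n : ℕ} {X : Type*} [AddCommGroup X] [Module F X]

/-- The rank-one tensor `u ⊗ x`. -/
def rk (u : Fin n → F) (x : X) : Fin n → X := fun i => u i • x

theorem rk_add (u : Fin n → F) (x y : X) : rk u (x + y) = rk u x + rk u y := by
  ext i; simp [rk]

theorem rk_add_left (u v : Fin n → F) (x : X) : rk (u + v) x = rk u x + rk v x := by
  ext i; simp [rk, add_smul]

theorem rk_zero (u : Fin n → F) : rk u (0 : X) = 0 := by
  ext i; simp [rk]

theorem rk_zero_left (x : X) : rk (0 : Fin n → F) x = 0 := by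
  ext i; simp [rk]

theorem rk_smul (c : F) (u : Fin n → F) (x : X) : rk u (c • x) = rk (c • u) x := by
  ext i; simp [rk, smul_smul, mul_comm]

end Rk

variable {F : Type*} [Field F] [Fintype F] {n : ℕ} {X : Type*} [AddCommGroup X] [Module F X]

theorem card_submodule_mul_le [Fintype X] (N : Submodule F X) (hN : N ≠ ⊤) :
    Nat.card N * Fintype.card F ≤ Fintype.card X := by
  have h1 : Nat.card X = Nat.card N * Nat.card (X ⧸ N) :=
    Submodule.card_eq_card_quotient_mul_card N
  rw [← Nat.card_eq_fintype_card, ← Nat.card_eq_fintype_card, h1]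
  refine Nat.mul_le_mul_left _ ?_
  obtain ⟨x, hx⟩ : ∃ x : X, x ∉ N := by
    by_contra! h
    exact hN (eq_top_iff.2 fun x _ => h x)
  refine Nat.card_le_card_of_injective (fun c : F => (Submodule.Quotient.mk (c • x) : X ⧸ N)) ?_
  intro c c' hcc
  by_contra hne
  have : (c - c') • x ∈ N := by
    have := (Submodule.Quotient.eq N).1 hcc
    rwa [← sub_smul] at this
  exact hx ((N.smul_mem_iff (sub_ne_zero.2 hne)).1 this)

theorem norm_sum_char_rk_le [Fintype X] (ψ : AddChar (Fin n → X) ℂ) (hψ : ψ ≠ 1) :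
    ‖∑ ω : (Fin n → F) × X, ψ (rk ω.1 ω.2)‖ ≤
      (Fintype.card F : ℝ)⁻¹ * Fintype.card ((Fin n → F) × X) := by
  classical
  let N : Submodule F X :=
    { carrier := {x | ∀ u : Fin n → F, ψ (rk u x) = 1}
      add_mem' := by
        intro x y hx hy u
        rw [rk_add, AddChar.map_add_eq_mul, hx, hy, one_mul]
      zero_mem' := by intro u; rw [rk_zero]; simp
      smul_mem' := by
        intro c x hx u
        rw [rk_smul]; exact hx _ }
  have hN : N ≠ ⊤ := by
    intro h
    apply hψ
    ext T
    have hT : T = ∑ i, rk (Pi.single i (1 : F)) (T i) := by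
      ext j
      rw [Finset.sum_apply, Finset.sum_eq_single j]
      · simp [rk]
      · intro b _ hb
        simp [rk, hb.symm]
      · simp
    rw [hT, addChar_map_sum]
    simp only [AddChar.one_apply]
    refine Finset.prod_eq_one fun i _ => ?_
    have : T i ∈ N := h ▸ Submodule.mem_top
    exact this _
  have hin : ∀ x : X, ∑ u : Fin n → F, ψ (rk u x) =
      if x ∈ N then (Fintype.card (Fin n → F) : ℂ) else 0 := by
    intro x
    let χ : AddChar (Fin n → F) ℂ :=
      { toFun := fun u => ψ (rk u x)
        map_zero_eq_one' := by simp [rk_zero_left]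
        map_add_eq_mul' := by intro u v; rw [rk_add_left, AddChar.map_add_eq_mul] }
    have := AddChar.sum_eq_ite χ
    have hχ : χ = 0 ↔ x ∈ N := by
      rw [DFunLike.ext_iff]
      rfl
    simp only [hχ] at this
    exact this
  rw [Fintype.sum_prod_type_right]
  simp only [hin]
  rw [Finset.sum_ite, Finset.sum_const_zero, add_zero, Finset.sum_const, nsmul_eq_mul]
  have hc := card_submodule_mul_le N hN
  have hNc : #{x : X | x ∈ N} = Nat.card N := by
    rw [Nat.card_eq_fintype_card]
    exact (Fintype.card_subtype _).symm
  rw [hNc, norm_mul]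
  have hq : (0 : ℝ) < Fintype.card F := by exact_mod_cast Fintype.card_pos
  rw [Complex.norm_natCast, Complex.norm_natCast, inv_mul_eq_div, le_div_iff₀ hq,
    Fintype.card_prod]
  push_cast
  have hc' : (Nat.card N : ℝ) * Fintype.card F ≤ Fintype.card X := by exact_mod_cast hc
  have hY : (0 : ℝ) ≤ Fintype.card (Fin n → F) := by positivity
  nlinarith

theorem card_one_step_le [Fintype X] [DecidableEq X] (D : Finset (Fin n → X)) :
    (∑ ω : (Fin n → F) × X, #{T ∈ D | T + rk ω.1 ω.2 ∈ D} : ℝ) ≤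
      Fintype.card ((Fin n → F) × X) * ((Fintype.card F : ℝ)⁻¹ * #D +
        (1 - (Fintype.card F : ℝ)⁻¹) * ((#D : ℝ) ^ 2 / Fintype.card (Fin n → X))) :=
  card_steps_le (fun ω : (Fin n → F) × X => rk ω.1 ω.2) _ norm_sum_char_rk_le D

theorem card_two_step_le [Fintype X] [DecidableEq X] (D : Finset (Fin n → X)) :
    (∑ ω : ((Fin n → F) × X) × ((Fin n → F) × X),
        #{T ∈ D | T + (rk ω.1.1 ω.1.2 + rk ω.2.1 ω.2.2) ∈ D} : ℝ) ≤
      (Fintype.card ((Fin n → F) × X) : ℝ) ^ 2 * (((Fintype.card F : ℝ)⁻¹) ^ 2 * #D +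
        (#D : ℝ) ^ 2 / Fintype.card (Fin n → X)) := by
  have h := card_steps_le (fun ω : ((Fin n → F) × X) × ((Fin n → F) × X) =>
    rk ω.1.1 ω.1.2 + rk ω.2.1 ω.2.2) (((Fintype.card F : ℝ)⁻¹) ^ 2) ?_ D
  · refine h.trans ?_
    rw [Fintype.card_prod, Nat.cast_mul, ← sq]
    gcongr
    refine mul_le_of_le_one_left (by positivity) ?_
    have : (0 : ℝ) ≤ ((Fintype.card F : ℝ)⁻¹) ^ 2 := by positivity
    linarith
  · intro ψ hψ
    simp only [AddChar.map_add_eq_mul]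
    rw [Fintype.sum_prod_type]
    simp only
    rw [← Finset.sum_mul_sum, norm_mul, Fintype.card_prod, Nat.cast_mul]
    have := norm_sum_char_rk_le (F := F) ψ hψ
    calc _ ≤ ((Fintype.card F : ℝ)⁻¹ * Fintype.card ((Fin n → F) × X)) *
          ((Fintype.card F : ℝ)⁻¹ * Fintype.card ((Fin n → F) × X)) := by gcongr
      _ = _ := by ring

end Spectral

section LowDegree

open MvPolynomial

theorem totalDegree_bind₁_le {F σ τ : Type*} [Field F] (g : σ → MvPolynomial τ F)
    (hg : ∀ i, (g i).totalDegree ≤ 1) (Q : MvPolynomial σ F) :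
    (bind₁ g Q).totalDegree ≤ Q.totalDegree := by
  classical
  rw [← aeval_eq_bind₁, aeval_def, eval₂_eq]
  refine totalDegree_finsetSum_le fun d hd => ?_
  refine (totalDegree_mul _ _).trans ?_
  have h1 : (algebraMap F (MvPolynomial τ F) (coeff d Q)).totalDegree = 0 := totalDegree_C _
  rw [h1, zero_add]
  refine (totalDegree_finsetProd _ _).trans ?_
  refine le_trans ?_ (le_totalDegree hd)
  refine Finset.sum_le_sum fun i _ => ?_
  refine (totalDegree_pow _ _).trans ?_
  exact mul_le_of_le_one_right (Nat.zero_le _) (hg i)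

variable {F : Type} [Field F]

theorem fDegLE.mono {m d d' : ℕ} {g : (Fin m → F) → F} (hg : fDegLE g d) (h : d ≤ d') :
    fDegLE g d' := by
  obtain ⟨Q, hQ, h'⟩ := hg
  exact ⟨Q, hQ.trans h, h'⟩

theorem fDegLE.comp {m m' d : ℕ} {g : (Fin m → F) → F} (hg : fDegLE g d)
    (φ : (Fin m' → F) → (Fin m → F)) (hφ : ∀ i, fDegLE (fun x => φ x i) 1) :
    fDegLE (fun x => g (φ x)) d := by
  obtain ⟨Q, hQ, h⟩ := hg
  choose R hR hR' using hφ
  refine ⟨bind₁ R Q, (totalDegree_bind₁_le R hR Q).trans hQ, fun x => ?_⟩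
  simp only [← h]
  have : eval x (bind₁ R Q) = eval (fun i => eval x (R i)) Q := by
    rw [← coe_aeval_eq_eval, ← coe_aeval_eq_eval]
    simp only [RingHom.coe_coe]
    rw [aeval_bind₁]
  rw [this, show (fun i => eval x (R i)) = φ x from funext fun i => hR' i x]

theorem fDegLE_affine {m : ℕ} (c : F) (φ : (Fin m → F) →ₗ[F] F) :
    fDegLE (fun x => c + φ x) 1 := by
  classical
  refine ⟨C c + ∑ j, C (φ fun i => if j = i then 1 else 0) * X j, ?_, fun x => ?_⟩
  · refine (totalDegree_add _ _).trans (max_le (by simp) ?_)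
    refine totalDegree_finsetSum_le fun j _ => ?_
    refine (totalDegree_mul _ _).trans ?_
    simp [totalDegree_X]
  · simp only [map_add, eval_C, map_sum, map_mul, eval_X]
    congr 1
    rw [LinearMap.pi_apply_eq_sum_univ φ x]
    exact Finset.sum_congr rfl fun j _ => mul_comm _ _

theorem fDegLE.comp_affine {m m' d : ℕ} {g : (Fin m → F) → F} (hg : fDegLE g d)
    (y : Fin m → F) (φ : (Fin m' → F) →ₗ[F] (Fin m → F)) :
    fDegLE (fun x => g (y + φ x)) d :=
  hg.comp _ fun i => fDegLE_affine (y i) ((LinearMap.proj i).comp φ)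

theorem exists_linearEquiv_fin {m : ℕ} (W : Submodule F (Fin m → F)) :
    ∃ d : ℕ, Nonempty ((Fin d → F) ≃ₗ[F] W) :=
  ⟨Module.finrank F W, ⟨(Module.finBasis F W).equivFun.symm⟩⟩

theorem totalDegree_X_sub_C {m : ℕ} (c : F) :
    (X 0 - C c : MvPolynomial (Fin (m + 1)) F).totalDegree = 1 := by
  apply le_antisymm
  · refine (totalDegree_sub _ _).trans (by simp [totalDegree_X])
  · have : (Finsupp.single (0 : Fin (m + 1)) 1) ∈
        (X 0 - C c : MvPolynomial (Fin (m + 1)) F).support := by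
      rw [mem_support_iff, coeff_sub, coeff_C, if_neg, coeff_X]
      · simp
      · intro h
        have := DFunLike.congr_fun h 0
        simp at this
    simpa using le_totalDegree this

theorem X_sub_C_ne_zero {m : ℕ} (c : F) :
    (X 0 - C c : MvPolynomial (Fin (m + 1)) F) ≠ 0 := by
  intro h
  have := totalDegree_X_sub_C (m := m) c
  rw [h] at this
  simp at this

section Fin

variable [Fintype F] [DecidableEq F]

/-- Schwartz–Zippel for functions of degree `d`: a nonzero one has many nonzero values. -/
theorem fDegLE.card_support_ge {m d : ℕ} {g : (Fin m → F) → F} (hg : fDegLE g d)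
    (x : Fin m → F) (hx : g x ≠ 0) :
    (Fintype.card F - d) * Fintype.card F ^ m ≤ Fintype.card F * #{x | g x ≠ 0} := by
  obtain ⟨Q, hQ, h⟩ := hg
  have hQ0 : Q ≠ 0 := by
    rintro rfl
    exact hx (by simpa using (h x).symm)
  have sz := schwartz_zippel_totalDegree hQ0 (univ : Finset F)
  simp only [h, Fintype.piFinset_univ, Finset.card_univ] at sz
  have hq : (0 : ℚ≥0) < Fintype.card F := by exact_mod_cast Fintype.card_pos
  rw [div_le_div_iff₀ (by positivity) hq] at sz
  have sz' : #{x | g x = 0} * Fintype.card F ≤ Q.totalDegree * Fintype.card F ^ m := by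
    exact_mod_cast sz
  have hsum : #{x | g x = 0} + #{x | g x ≠ 0} = Fintype.card F ^ m := by
    rw [Finset.card_filter_add_card_filter_not]
    simp
  have h3 : Q.totalDegree * Fintype.card F ^ m ≤ d * Fintype.card F ^ m :=
    Nat.mul_le_mul_right _ hQ
  rw [Nat.sub_mul]
  have : Fintype.card F * Fintype.card F ^ m =
      #{x | g x = 0} * Fintype.card F + Fintype.card F * #{x | g x ≠ 0} := by
    rw [← hsum]; ring
  omega

theorem fDegLE.card_support_coset_ge {m : ℕ} {g : (Fin m → F) → F}
    (hg : fDegLE g (Fintype.card F - 1)) (W : Submodule F (Fin m → F)) (y x : Fin m → F)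
    (hxy : x - y ∈ W) (hx : g x ≠ 0) [DecidablePred (· ∈ W)] :
    Nat.card W ≤ Fintype.card F * #{x | g x ≠ 0 ∧ x - y ∈ W} := by
  obtain ⟨d, ⟨E⟩⟩ := exists_linearEquiv_fin W
  have h1 := (hg.comp_affine y (W.subtype.comp E.toLinearMap)).card_support_ge
    (E.symm ⟨x - y, hxy⟩) (by simpa using hx)
  have hq : Fintype.card F - (Fintype.card F - 1) = 1 := by
    have : 0 < Fintype.card F := Fintype.card_pos
    omega
  rw [hq, one_mul] at h1
  have hW : Nat.card W = Fintype.card F ^ d := by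
    rw [← Nat.card_congr E.toEquiv]
    simp
  rw [hW]
  refine h1.trans (Nat.mul_le_mul_left _ ?_)
  refine Finset.card_le_card_of_injOn (fun z => y + (E z : Fin m → F)) ?_ ?_
  · intro z hz
    simp only [Finset.coe_filter, Finset.mem_univ, true_and, Set.mem_ofPred_eq] at hz ⊢
    exact ⟨hz, by simp⟩
  · intro z _ z' _ hzz
    simpa using hzz

theorem fDegLE.eq_zero_of_eval {m : ℕ} (Q : MvPolynomial (Fin m) F)
    (hQ : Q.totalDegree < Fintype.card F) (h : ∀ x, eval x Q = 0) : Q = 0 := by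
  by_contra hQ0
  have sz := schwartz_zippel_totalDegree hQ0 (univ : Finset F)
  simp only [h, Fintype.piFinset_univ, Finset.card_univ, Finset.filter_true] at sz
  have hq : (0 : ℚ≥0) < Fintype.card F := by exact_mod_cast Fintype.card_pos
  rw [div_le_div_iff₀ (by positivity) hq] at sz
  have sz' : Fintype.card F ^ m * Fintype.card F ≤ Q.totalDegree * Fintype.card F ^ m := by
    simpa using (by exact_mod_cast sz :
      Fintype.card (Fin m → F) * Fintype.card F ≤ Q.totalDegree * Fintype.card F ^ m)
  have : 0 < Fintype.card F ^ m := pow_pos Fintype.card_pos _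
  nlinarith

theorem X_sub_C_dvd {m : ℕ} (Q : MvPolynomial (Fin (m + 1)) F)
    (hQ : Q.totalDegree < Fintype.card F) (c : F) (h : ∀ w, eval (Fin.cons c w) Q = 0) :
    X 0 - C c ∣ Q := by
  have e1 : ∀ R : MvPolynomial (Fin (m + 1)) F, Polynomial.eval (C c) (finSuccEquiv F m R) =
      bind₁ (Fin.cons (C c) X : Fin (m + 1) → MvPolynomial (Fin m) F) R := by
    intro R
    have : ((Polynomial.aeval (C c : MvPolynomial (Fin m) F)).restrictScalars F).comp
        (finSuccEquiv F m).toAlgHom =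
        bind₁ (Fin.cons (C c) X : Fin (m + 1) → MvPolynomial (Fin m) F) := by
      apply MvPolynomial.algHom_ext
      intro i
      refine Fin.cases ?_ (fun j => ?_) i
      · simp [finSuccEquiv_X_zero]
      · simp [finSuccEquiv_X_succ]
    have := DFunLike.congr_fun this R
    simpa [Polynomial.aeval_def] using this
  have h0 : Polynomial.eval (C c) (finSuccEquiv F m Q) = 0 := by
    rw [e1]
    apply fDegLE.eq_zero_of_eval
    · refine (totalDegree_bind₁_le _ ?_ Q).trans_lt hQ
      intro i
      refine Fin.cases ?_ (fun j => ?_) i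
      · simp
      · simp [totalDegree_X]
    · intro w
      rw [← h w, ← coe_aeval_eq_eval, ← coe_aeval_eq_eval]
      simp only [RingHom.coe_coe]
      rw [aeval_bind₁]
      congr 1
      congr 1
      ext i
      refine Fin.cases ?_ (fun j => ?_) i
      · simp
      · simp
  obtain ⟨R, hR⟩ := Polynomial.dvd_iff_isRoot.2 h0
  refine ⟨(finSuccEquiv F m).symm R, ?_⟩
  apply (finSuccEquiv F m).injective
  rw [hR, map_mul, map_sub, finSuccEquiv_X_zero, AlgEquiv.apply_symm_apply, finSuccEquiv_apply]
  simp

theorem exists_eq_prod_mul {m : ℕ} (Q : MvPolynomial (Fin (m + 1)) F)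
    (hQ : Q.totalDegree < Fintype.card F) (hQ0 : Q ≠ 0) (S : Finset F)
    (h : ∀ c ∈ S, ∀ w, eval (Fin.cons c w) Q = 0) :
    ∃ R : MvPolynomial (Fin (m + 1)) F, Q = (∏ c ∈ S, (X 0 - C c)) * R ∧
      R.totalDegree + #S = Q.totalDegree := by
  induction S using Finset.induction_on with
  | empty => exact ⟨Q, by simp, by simp⟩
  | insert a S ha ih =>
    obtain ⟨R, hR, hdeg⟩ := ih fun c hc => h c (Finset.mem_insert_of_mem hc)
    have hR0 : R ≠ 0 := by
      rintro rfl
      exact hQ0 (by simpa using hR)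
    obtain ⟨R', hR'⟩ := X_sub_C_dvd R (by omega) a fun w => by
      have h1 := h a (Finset.mem_insert_self _ _) w
      rw [hR, map_mul, map_prod] at h1
      refine (mul_eq_zero.1 h1).resolve_left ?_
      refine Finset.prod_ne_zero_iff.2 ?_
      intro c hc
      simp only [map_sub, eval_X, eval_C, Fin.cons_zero]
      intro h2
      exact ha (sub_eq_zero.1 h2 ▸ hc)
    have hR'0 : R' ≠ 0 := by
      rintro rfl
      exact hR0 (by simpa using hR')
    refine ⟨R', ?_, ?_⟩
    · rw [hR, hR', Finset.prod_insert ha]; ring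
    · rw [Finset.card_insert_of_notMem ha, ← hdeg, hR',
        totalDegree_mul_of_isDomain (X_sub_C_ne_zero a) hR'0, totalDegree_X_sub_C]
      ring

end Fin

end LowDegree

section Hyperplane

open MvPolynomial

theorem card_filter_fin_succ {F : Type} [Fintype F] {m : ℕ} (A : (Fin (m + 1) → F) → Prop) [DecidablePred A] :
    #{z | A z} = ∑ c : F, #{w : Fin m → F | A (Fin.cons c w)} := by
  simp_rw [Finset.card_filter]
  rw [← Fintype.sum_prod_type' (f := fun (c : F) (w : Fin m → F) =>
    if A (Fin.cons c w : Fin (m + 1) → F) then 1 else 0)]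
  exact (Equiv.sum_comp (Fin.consEquiv fun _ : Fin (m + 1) => F) (fun z => if A z then 1 else 0)).symm

section Perp

variable {F : Type} [Field F]

/-- The hyperplane orthogonal to `a`. -/
def perp {m : ℕ} (a : Fin m → F) : Submodule F (Fin m → F) where
  carrier := {α | α ⬝ᵥ a = 0}
  add_mem' := by
    intro x y hx hy
    simp only [Set.mem_ofPred_eq] at *
    rw [add_dotProduct, hx, hy, add_zero]
  zero_mem' := by simp
  smul_mem' := by
    intro c x hx
    simp only [Set.mem_ofPred_eq] at *
    rw [smul_dotProduct, hx, smul_zero]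

theorem mem_perp {m : ℕ} {a α : Fin m → F} : α ∈ perp a ↔ α ⬝ᵥ a = 0 := Iff.rfl

theorem exists_dotProduct_eq {m : ℕ} {a : Fin m → F} (ha : a ≠ 0) (c : F) :
    ∃ v : Fin m → F, v ⬝ᵥ a = c := by
  obtain ⟨i, hi⟩ := Function.ne_iff.1 ha
  exact ⟨Pi.single i (c / a i), by rw [single_dotProduct]; exact div_mul_cancel₀ _ hi⟩

/-- Coordinates on `F^m` in which `α ↦ α ⬝ a` is the first coordinate. -/
theorem exists_coordinates {m : ℕ} {a : Fin m → F} (ha : a ≠ 0) :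
    ∃ (d : ℕ) (φ : (Fin (d + 1) → F) ≃ₗ[F] (Fin m → F)), d + 1 = m ∧ ∀ z, φ z ⬝ᵥ a = z 0 := by
  obtain ⟨v, hv⟩ := exists_dotProduct_eq ha 1
  obtain ⟨d, ⟨E⟩⟩ := exists_linearEquiv_fin (perp a)
  have hE : ∀ w, (E w : Fin m → F) ⬝ᵥ a = 0 := fun w => mem_perp.1 (E w).2
  let φ₀ : (Fin (d + 1) → F) →ₗ[F] (Fin m → F) :=
    { toFun := fun z => z 0 • v + (E (Fin.tail z) : Fin m → F)
      map_add' := by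
        intro x y
        have : Fin.tail (x + y) = Fin.tail x + Fin.tail y := rfl
        rw [this, map_add]
        simp only [Pi.add_apply, add_smul, Submodule.coe_add]
        abel
      map_smul' := by
        intro c x
        have : Fin.tail (c • x) = c • Fin.tail x := rfl
        rw [this, map_smul]
        simp [smul_smul] }
  have hφ₀ : ∀ z, φ₀ z ⬝ᵥ a = z 0 := by
    intro z
    change (z 0 • v + (E (Fin.tail z) : Fin m → F)) ⬝ᵥ a = z 0
    rw [add_dotProduct, smul_dotProduct, hv, hE]
    simp
  have hbij : Function.Bijective φ₀ := by
    constructor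
    · rw [← LinearMap.ker_eq_bot, LinearMap.ker_eq_bot']
      intro z hz
      have h0 : z 0 = 0 := by rw [← hφ₀ z, hz, zero_dotProduct]
      have h1 : (E (Fin.tail z) : Fin m → F) = 0 := by
        have : z 0 • v + (E (Fin.tail z) : Fin m → F) = 0 := hz
        rwa [h0, zero_smul, zero_add] at this
      have h2 : Fin.tail z = 0 := by
        apply E.injective
        rw [map_zero]
        exact Subtype.ext h1
      rw [← Fin.cons_self_tail z, h0, h2]
      ext i
      refine Fin.cases ?_ (fun j => ?_) i <;> simp
    · intro α
      have hmem : α - (α ⬝ᵥ a) • v ∈ perp a := by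
        rw [mem_perp, sub_dotProduct, smul_dotProduct, hv]
        simp
      refine ⟨Fin.cons (α ⬝ᵥ a) (E.symm ⟨_, hmem⟩), ?_⟩
      change (Fin.cons (α ⬝ᵥ a) (E.symm ⟨_, hmem⟩) : Fin (d + 1) → F) 0 • v +
        (E (Fin.tail (Fin.cons (α ⬝ᵥ a) (E.symm ⟨_, hmem⟩) : Fin (d + 1) → F)) : Fin m → F) = α
      simp
  refine ⟨d, LinearEquiv.ofBijective φ₀ hbij, ?_, hφ₀⟩
  have := (LinearEquiv.ofBijective φ₀ hbij).finrank_eq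
  simpa using this

end Perp

variable {F : Type} [Field F] [Fintype F]

theorem card_mul_le_of_lt {X : Type*} [AddCommGroup X] [Module F X] [Fintype X]
    {N N' : Submodule F X} (h : N < N') : Nat.card N * Fintype.card F ≤ Nat.card N' := by
  classical
  have h1 := card_submodule_mul_le (N.submoduleOf N') (by
    intro h'
    rw [Submodule.submoduleOf_eq_top] at h'
    exact absurd h (not_lt_of_ge h'))
  have h2 : Nat.card (N.submoduleOf N') = Nat.card N :=
    Nat.card_congr (Submodule.submoduleOfEquivOfLe h.le).toEquiv
  rw [h2, ← Nat.card_eq_fintype_card (α := N')] at h1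
  exact h1

theorem card_sup_span {X : Type*} [AddCommGroup X] [Module F X] [Fintype X]
    (N : Submodule F X) (v : X) (hv : v ∉ N) :
    Nat.card N * Fintype.card F ≤ Nat.card (N ⊔ Submodule.span F {v} : Submodule F X) := by
  refine card_mul_le_of_lt (lt_of_le_of_ne le_sup_left ?_)
  intro h
  apply hv
  rw [h]
  exact Submodule.mem_sup_right (Submodule.mem_span_singleton_self v)

variable [DecidableEq F]

theorem fDegLE.eq_indicator_of_vanish {m : ℕ} {g : (Fin (m + 1) → F) → F}
    (hq : 3 ≤ Fintype.card F) (hg : fDegLE g (Fintype.card F - 1)) (x : Fin (m + 1) → F)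
    (hx : g x ≠ 0)
    (hsmall : #{x | g x ≠ 0} * Fintype.card F ^ 2 < (Fintype.card F + 1) * Fintype.card F ^ (m + 1))
    (κ₀ : F) (hκ₀ : ∀ w, g (Fin.cons κ₀ w) = 0) :
    ∃ κ c : F, c ≠ 0 ∧ ∀ z, g z = if z 0 = κ then c else 0 := by
  obtain ⟨Q, hQ, h⟩ := hg
  have hQ0 : Q ≠ 0 := by
    rintro rfl
    exact hx (by simpa using (h x).symm)
  set q := Fintype.card F with hqdef
  let S : Finset F := {c | ∀ w, g (Fin.cons c w) = 0}
  have hκS : κ₀ ∈ S := by simpa [S] using hκ₀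
  obtain ⟨R, hR, hdeg⟩ := exists_eq_prod_mul Q (by omega) hQ0 S (by
    intro c hc w
    rw [h]
    exact (Finset.mem_filter.1 hc).2 w)
  have hprod : ∀ c w, g (Fin.cons c w) = (∏ a ∈ S, (c - a)) * eval (Fin.cons c w) R := by
    intro c w
    rw [← h, hR]
    simp [map_prod]
  have hS1 : 1 ≤ #S := Finset.card_pos.2 ⟨κ₀, hκS⟩
  have hk : ∀ c, c ∉ S → (#S + 1) * q ^ m ≤ q * #{w : Fin m → F | g (Fin.cons c w) ≠ 0} := by
    intro c hc
    obtain ⟨w, hw⟩ : ∃ w, g (Fin.cons c w) ≠ 0 := by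
      by_contra! h'
      exact hc (Finset.mem_filter.2 ⟨Finset.mem_univ _, h'⟩)
    have hl : fDegLE (fun w : Fin m → F => g (Fin.cons c w)) R.totalDegree := by
      have h1 : fDegLE (fun z => (∏ a ∈ S, (c - a)) * eval z R) R.totalDegree := by
        refine ⟨C (∏ a ∈ S, (c - a)) * R, ?_, by simp⟩
        refine (totalDegree_mul _ _).trans ?_
        rw [totalDegree_C, zero_add]
      simp only [hprod]
      refine h1.comp (fun w : Fin m → F => Fin.cons c w) fun i => ?_
      refine Fin.cases ?_ (fun j => ?_) i
      · exact ⟨C c, by simp, by simp⟩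
      · exact ⟨X j, by simp [totalDegree_X], by simp⟩
    have h2 := hl.card_support_ge w hw
    refine le_trans (Nat.mul_le_mul_right _ ?_) h2
    omega
  have htot : (q - #S) * ((#S + 1) * q ^ m) ≤ q * #{x | g x ≠ 0} := by
    rw [card_filter_fin_succ, Finset.mul_sum]
    calc (q - #S) * ((#S + 1) * q ^ m) = ∑ c ∈ Sᶜ, (#S + 1) * q ^ m := by
          rw [Finset.sum_const, Finset.card_compl, smul_eq_mul]
      _ ≤ ∑ c ∈ Sᶜ, q * #{w : Fin m → F | g (Fin.cons c w) ≠ 0} :=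
          Finset.sum_le_sum fun c hc => hk c (Finset.mem_compl.1 hc)
      _ ≤ _ := Finset.sum_le_sum_of_subset (Finset.subset_univ _)
  have hSq : #S ≤ q - 1 := by omega
  have hSeq : #S = q - 1 := by
    by_contra hne
    have hle : q + 1 ≤ (q - #S) * (#S + 1) := by
      obtain ⟨u, hu⟩ : ∃ u, q = #S + 2 + u := ⟨q - #S - 2, by omega⟩
      obtain ⟨v, hv⟩ : ∃ v, #S = v + 1 := ⟨#S - 1, by omega⟩
      have h1 : q - #S = u + 2 := by omega
      rw [h1, hu, hv]
      nlinarith [Nat.zero_le (u * v)]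
    have hqpos : 0 < q := by omega
    have h1 : (q + 1) * q ^ (m + 1) ≤ #{x | g x ≠ 0} * q ^ 2 := by
      calc (q + 1) * q ^ (m + 1) ≤ ((q - #S) * (#S + 1)) * q ^ (m + 1) :=
            Nat.mul_le_mul_right _ hle
        _ = q * ((q - #S) * ((#S + 1) * q ^ m)) := by ring
        _ ≤ q * (q * #{x | g x ≠ 0}) := Nat.mul_le_mul_left _ htot
        _ = _ := by ring
    omega
  have hR0 : R.totalDegree = 0 := by omega
  have hRc := (totalDegree_eq_zero_iff_eq_C).1 hR0
  have hcompl : #Sᶜ = 1 := by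
    rw [Finset.card_compl]; omega
  obtain ⟨κ, hκ⟩ := Finset.card_eq_one.1 hcompl
  have hmem : ∀ c, c ∉ S ↔ c = κ := by
    intro c
    rw [← Finset.mem_compl, hκ, Finset.mem_singleton]
  have hgz : ∀ z, g z = if z 0 = κ then (∏ a ∈ S, (κ - a)) * coeff 0 R else 0 := by
    intro z
    rw [← Fin.cons_self_tail z]
    split_ifs with hz
    · rw [hprod, hRc]
      simp only [Fin.cons_zero] at hz
      simp [hz]
    · have : z 0 ∈ S := by
        by_contra h'
        exact hz (by simpa using (hmem _).1 h')
      exact (Finset.mem_filter.1 this).2 _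
  refine ⟨κ, _, ?_, hgz⟩
  intro h0
  apply hx
  rw [hgz, h0]
  simp

theorem fDegLE.eq_indicator_of_vanish_on {m : ℕ} {g : (Fin m → F) → F}
    (hq : 3 ≤ Fintype.card F) (hg : fDegLE g (Fintype.card F - 1)) (x : Fin m → F) (hx : g x ≠ 0)
    (hsmall : #{x | g x ≠ 0} * Fintype.card F ^ 2 < (Fintype.card F + 1) * Fintype.card F ^ m)
    (a : Fin m → F) (ha : a ≠ 0) (κ₀ : F) (hκ₀ : ∀ α, α ⬝ᵥ a = κ₀ → g α = 0) :
    ∃ κ c : F, c ≠ 0 ∧ ∀ α, g α = if α ⬝ᵥ a = κ then c else 0 := by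
  obtain ⟨d, φ, rfl, hφ⟩ := exists_coordinates ha
  have hcard : #{z | g (φ z) ≠ 0} = #{x | g x ≠ 0} := by
    refine Finset.card_equiv φ.toEquiv fun z => ?_
    simp
  obtain ⟨κ, c, hc, h⟩ := fDegLE.eq_indicator_of_vanish (g := fun z => g (φ z)) hq
    (by simpa using hg.comp_affine 0 φ.toLinearMap) (φ.symm x) (by simpa using hx)
    (by rw [hcard]; exact hsmall) κ₀ (fun w => hκ₀ _ (by rw [hφ]; simp))
  refine ⟨κ, c, hc, fun α => ?_⟩
  have := h (φ.symm α)
  rwa [φ.apply_symm_apply, ← hφ (φ.symm α), φ.apply_symm_apply] at this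

theorem fDegLE.exists_vanish_hyperplane {m : ℕ} {g : (Fin m → F) → F}
    (hq : 3 ≤ Fintype.card F) (hg : fDegLE g (Fintype.card F - 1)) (x₀ : Fin m → F) (hx₀ : g x₀ ≠ 0)
    (hsmall : #{x | g x ≠ 0} * Fintype.card F ^ 2 < (Fintype.card F + 1) * Fintype.card F ^ m) :
    ∃ a : Fin m → F, a ≠ 0 ∧ ∃ κ₀ : F, ∀ α, α ⬝ᵥ a = κ₀ → g α = 0 := by
  classical
  set q := Fintype.card F with hqdef
  obtain ⟨W, ⟨y, hy⟩, hmax⟩ : ∃ W : Submodule F (Fin m → F), (∃ y, ∀ x, x - y ∈ W → g x = 0) ∧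
      ∀ W' : Submodule F (Fin m → F), W < W' → ¬ ∃ y, ∀ x, x - y ∈ W' → g x = 0 := by
    have hne : {W : Submodule F (Fin m → F) | ∃ y, ∀ x, x - y ∈ W → g x = 0}.Nonempty := by
      refine ⟨⊥, ?_⟩
      by_contra hcon
      have hall : ∀ y, g y ≠ 0 := by
        intro y hy
        refine hcon ⟨y, fun x hx => ?_⟩
        rw [Submodule.mem_bot, sub_eq_zero] at hx
        rw [hx, hy]
      have : #{x | g x ≠ 0} = q ^ m := by
        rw [Finset.filter_true_of_mem fun x _ => hall x]
        simp [hqdef]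
      rw [this] at hsmall
      have h2 : q + 1 ≤ q ^ 2 := by nlinarith
      have h3 := Nat.mul_le_mul_right (q ^ m) h2
      rw [mul_comm (q ^ 2)] at h3
      omega
    obtain ⟨W, hW, hWm⟩ := wellFounded_gt.has_min _ hne
    exact ⟨W, hW, fun W' hlt h' => hWm W' h' hlt⟩
  have hWtop : W ≠ ⊤ := by
    rintro rfl
    exact hx₀ (hy x₀ trivial)
  obtain ⟨φ, hφ, hφW⟩ := Submodule.exists_le_ker_of_lt_top W (lt_top_iff_ne_top.2 hWtop)
  let a : Fin m → F := fun i => φ (fun j => if i = j then 1 else 0)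
  have ha : ∀ α, φ α = α ⬝ᵥ a := by
    intro α
    rw [LinearMap.pi_apply_eq_sum_univ φ α]
    rfl
  have ha0 : a ≠ 0 := by
    intro h
    apply hφ
    ext α
    simp [ha, h]
  have hWperp : W ≤ perp a := fun α hα => by
    rw [mem_perp, ← ha]
    exact hφW hα
  have hcardV : Fintype.card (Fin m → F) = q ^ m := by simp [hqdef]
  by_cases hWeq : W = perp a
  · refine ⟨a, ha0, y ⬝ᵥ a, fun α hα => hy α ?_⟩
    rw [hWeq, mem_perp, sub_dotProduct, hα, sub_self]
  exfalso
  have hperp : perp a ≠ ⊤ := by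
    intro h
    obtain ⟨v, hv⟩ := exists_dotProduct_eq ha0 1
    have : v ∈ perp a := h ▸ Submodule.mem_top
    rw [mem_perp, hv] at this
    exact one_ne_zero this
  have hW2 : Nat.card W * q ^ 2 ≤ q ^ m := by
    have h1 := card_mul_le_of_lt (lt_of_le_of_ne hWperp hWeq)
    have h2 := card_submodule_mul_le (perp a) hperp
    rw [hcardV] at h2
    calc Nat.card W * q ^ 2 = (Nat.card W * q) * q := by ring
      _ ≤ Nat.card (perp a) * q := Nat.mul_le_mul_right _ h1
      _ ≤ _ := h2
  have hWpos : 0 < Nat.card W := Nat.card_pos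
  -- double counting of pairs `(v, x)` with `x - y ∈ W ⊔ ⟨v⟩`
  have hlow : ∀ v, v ∉ W → Nat.card W ≤
      #{x | g x ≠ 0 ∧ x - y ∈ W ⊔ Submodule.span F {v}} := by
    intro v hv
    have hlt : W < W ⊔ Submodule.span F {v} := by
      refine lt_of_le_of_ne le_sup_left fun h => hv ?_
      rw [h]
      exact Submodule.mem_sup_right (Submodule.mem_span_singleton_self v)
    have := hmax _ hlt
    push Not at this
    obtain ⟨x, hx, hgx⟩ := this y
    have h1 := hg.card_support_coset_ge _ y x hx hgx
    have h2 := card_sup_span W v hv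
    have hqpos : 0 < Fintype.card F := Fintype.card_pos
    refine Nat.le_of_mul_le_mul_left ?_ hqpos
    rw [mul_comm]
    exact h2.trans h1
  have hup : ∀ x, g x ≠ 0 → #{v | v ∉ W ∧ x - y ∈ W ⊔ Submodule.span F {v}} ≤
      (q - 1) * Nat.card W := by
    intro x hx
    have hxW : x - y ∉ W := fun h => hx (hy x h)
    have : #{v | v ∉ W ∧ x - y ∈ W ⊔ Submodule.span F {v}} ≤
        #((univ.erase (0 : F)) ×ˢ (univ.filter fun w => w ∈ W)) := by
      refine Finset.card_le_card_of_surjOn (fun cw : F × (Fin m → F) => cw.1 • (x - y) + cw.2) ?_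
      intro v hv
      simp only [Finset.coe_filter, Finset.mem_univ, true_and, Set.mem_ofPred_eq] at hv
      obtain ⟨hvW, hv2⟩ := hv
      obtain ⟨w, hw, z, hz, hwz⟩ := Submodule.mem_sup.1 hv2
      obtain ⟨c, rfl⟩ := Submodule.mem_span_singleton.1 hz
      have hc : c ≠ 0 := by
        rintro rfl
        apply hxW
        rw [← hwz]
        simpa using hw
      refine ⟨(c⁻¹, -(c⁻¹ • w)), ?_, ?_⟩
      · simp [hc, W.smul_mem c⁻¹ hw]
      · simp only [← hwz]
        rw [smul_add, smul_smul, inv_mul_cancel₀ hc, one_smul]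
        abel
    refine this.trans ?_
    rw [Finset.card_product, Finset.card_erase_of_mem (Finset.mem_univ _), Finset.card_univ,
      Nat.card_eq_fintype_card, Fintype.card_subtype]
  have hdc := Finset.sum_card_bipartiteAbove_eq_sum_card_bipartiteBelow
    (s := univ.filter fun v => v ∉ W) (t := univ.filter fun x => g x ≠ 0)
    (fun v x => x - y ∈ W ⊔ Submodule.span F {v})
  have h1 : #(univ.filter fun v => v ∉ W) * Nat.card W ≤
      #{x | g x ≠ 0} * ((q - 1) * Nat.card W) := by
    calc #(univ.filter fun v => v ∉ W) * Nat.card W = ∑ v ∈ univ.filter fun v => v ∉ W,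
          Nat.card W := by rw [Finset.sum_const, smul_eq_mul]
      _ ≤ _ := Finset.sum_le_sum fun v hv => by
          have := hlow v (Finset.mem_filter.1 hv).2
          rw [← Finset.filter_filter] at this
          exact this
      _ = _ := hdc
      _ ≤ ∑ x ∈ univ.filter fun x => g x ≠ 0, (q - 1) * Nat.card W :=
          Finset.sum_le_sum fun x hx => by
          have := hup x (Finset.mem_filter.1 hx).2
          rw [← Finset.filter_filter] at this
          exact this
      _ = _ := by rw [Finset.sum_const, smul_eq_mul]
  have h2 : #(univ.filter fun v => v ∉ W) ≤ #{x | g x ≠ 0} * (q - 1) := by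
    refine Nat.le_of_mul_le_mul_right ?_ hWpos
    rw [mul_assoc]
    exact h1
  have h3 : Nat.card W + #(univ.filter fun v => v ∉ W) = q ^ m := by
    rw [Nat.card_eq_fintype_card, Fintype.card_subtype, Finset.card_filter_add_card_filter_not,
      Finset.card_univ, hcardV]
  obtain ⟨u, hu⟩ : ∃ u, q = u + 1 := ⟨q - 1, by omega⟩
  set w := Nat.card W
  set A := #{x | g x ≠ 0}
  set B := #(univ.filter fun v => v ∉ W)
  have hu1 : q - 1 = u := by omega
  rw [hu1] at h2
  have h4 : A * q ^ 2 * u < (q + 1) * q ^ m * u := by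
    refine Nat.mul_lt_mul_of_pos_right hsmall ?_
    omega
  have h5 : B * q ^ 2 ≤ A * u * q ^ 2 := Nat.mul_le_mul_right _ h2
  have h6 : q ^ m * q ^ 2 = w * q ^ 2 + B * q ^ 2 := by rw [← h3]; ring
  have h7 : (q + 1) * u + 1 = q ^ 2 := by rw [hu]; ring
  nlinarith

/-- A function of degree `q - 1` with small support is a multiple of the indicator of an affine
hyperplane. -/
theorem fDegLE.eq_indicator {m : ℕ} {g : (Fin m → F) → F}
    (hq : 3 ≤ Fintype.card F) (hg : fDegLE g (Fintype.card F - 1)) (x₀ : Fin m → F) (hx₀ : g x₀ ≠ 0)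
    (hsmall : #{x | g x ≠ 0} * Fintype.card F ^ 2 < (Fintype.card F + 1) * Fintype.card F ^ m) :
    ∃ a : Fin m → F, a ≠ 0 ∧ ∃ κ c : F, c ≠ 0 ∧ ∀ α, g α = if α ⬝ᵥ a = κ then c else 0 := by
  obtain ⟨a, ha, κ₀, h⟩ := hg.exists_vanish_hyperplane hq x₀ hx₀ hsmall
  exact ⟨a, ha, hg.eq_indicator_of_vanish_on hq x₀ hx₀ hsmall a ha κ₀ h⟩

end Hyperplane

section Model

variable {F : Type} [Field F] {n m : ℕ}

/-- The value of a matrix at a vector. -/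
def app (T : Fin n → Fin m → F) (a : Fin m → F) : Fin n → F := fun i => T i ⬝ᵥ a

theorem app_add (T T' : Fin n → Fin m → F) (a : Fin m → F) :
    app (T + T') a = app T a + app T' a := by
  ext i; simp [app, add_dotProduct]

theorem app_rk (u : Fin n → F) (α a : Fin m → F) : app (rk u α) a = (α ⬝ᵥ a) • u := by
  ext i; simp [app, rk, mul_comm]

theorem app_add_rk (T : Fin n → Fin m → F) (u : Fin n → F) (α a : Fin m → F) :
    app (T + rk u α) a = app T a + (α ⬝ᵥ a) • u := by
  rw [app_add, app_rk]

theorem exists_app_eq {a : Fin m → F} (ha : a ≠ 0) (b : Fin n → F) :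
    ∃ T : Fin n → Fin m → F, app T a = b := by
  obtain ⟨v, hv⟩ := exists_dotProduct_eq ha 1
  exact ⟨rk b v, by rw [app_rk, hv, one_smul]⟩

variable [Fintype F]
open scoped Classical

/-- The zoom-in `{T : T a = b}`. -/
def zoom (a : Fin m → F) (b : Fin n → F) : Finset (Fin n → Fin m → F) := {T | app T a = b}

theorem mem_zoom {a : Fin m → F} {b : Fin n → F} {T : Fin n → Fin m → F} :
    T ∈ zoom a b ↔ app T a = b := by simp [zoom]

theorem card_perp_mul {a : Fin m → F} (ha : a ≠ 0) :
    Fintype.card (perp a) * Fintype.card F = Fintype.card F ^ m := by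
  obtain ⟨d, φ, rfl, hφ⟩ := exists_coordinates ha
  have h : Fintype.card (perp a) = Fintype.card F ^ d := by
    have : Fintype.card (Fin d → F) = Fintype.card F ^ d := by simp
    rw [← this]
    refine (Fintype.card_of_bijective (f := fun w : Fin d → F =>
      (⟨φ (Fin.cons 0 w), by rw [mem_perp, hφ]; simp⟩ : perp a)) ⟨?_, ?_⟩).symm
    · intro w w' h
      have := φ.injective (Subtype.ext_iff.1 h)
      exact Fin.cons_right_injective _ this
    · intro α
      refine ⟨Fin.tail (φ.symm α), ?_⟩
      ext1
      have h0 : φ.symm α 0 = 0 := by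
        rw [← hφ (φ.symm α), φ.apply_symm_apply]
        exact α.2
      have : (Fin.cons 0 (Fin.tail (φ.symm α)) : Fin (d + 1) → F) = φ.symm α := by
        rw [← h0]; exact Fin.cons_self_tail _
      simp [this]
  rw [h, pow_succ]

theorem card_perp {a : Fin m → F} (ha : a ≠ 0) :
    Fintype.card (perp a) = Fintype.card F ^ (m - 1) := by
  have hm : m ≠ 0 := by
    rintro rfl
    exact ha (Subsingleton.elim _ _)
  obtain ⟨d, rfl⟩ := Nat.exists_eq_succ_of_ne_zero hm
  have := card_perp_mul ha
  rw [pow_succ] at this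
  exact Nat.eq_of_mul_eq_mul_right Fintype.card_pos this

theorem card_zoom {a : Fin m → F} (ha : a ≠ 0) (b : Fin n → F) :
    #(zoom a b) = Fintype.card (Fin n → perp a) := by
  obtain ⟨T₀, hT₀⟩ := exists_app_eq ha b
  rw [← Finset.card_univ]
  symm
  refine Finset.card_bij (fun T _ => T₀ + fun i => (T i : Fin m → F)) ?_ ?_ ?_
  · intro T _
    rw [mem_zoom, app_add, hT₀]
    ext i
    have := mem_perp.1 (T i).2
    simp [app, this]
  · intro T _ T' _ h
    ext i : 2
    exact congrFun (add_left_cancel h) i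
  · intro T hT
    rw [mem_zoom] at hT
    refine ⟨fun i => ⟨T i - T₀ i, ?_⟩, Finset.mem_univ _, ?_⟩
    · rw [mem_perp, sub_dotProduct, sub_eq_zero]
      exact congrFun (hT.trans hT₀.symm) i
    · ext i : 1
      simp

theorem card_zoom_mul {a : Fin m → F} (ha : a ≠ 0) (b : Fin n → F) :
    #(zoom a b) * Fintype.card F ^ n = Fintype.card (Fin n → Fin m → F) := by
  rw [card_zoom ha, Fintype.card_fun, Fintype.card_fun (β := Fin m → F), Fintype.card_fin,
    ← mul_pow, card_perp_mul ha]
  simp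

theorem card_zoom_step_le {a : Fin m → F} (ha : a ≠ 0) (b : Fin n → F)
    (D : Finset (Fin n → Fin m → F)) (hD : D ⊆ zoom a b) (ρ : ℝ) (hρ : (#D : ℝ) ≤ ρ * #(zoom a b)) :
    (∑ ω : (Fin n → F) × perp a, #{T ∈ D | T + rk ω.1 (ω.2 : Fin m → F) ∈ D} : ℝ) ≤
      Fintype.card ((Fin n → F) × perp a) *
        (#D * ((Fintype.card F : ℝ)⁻¹ + (1 - (Fintype.card F : ℝ)⁻¹) * ρ)) := by
  rcases D.eq_empty_or_nonempty with rfl | ⟨T₀, hT₀⟩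
  · simp
  let j : (Fin n → perp a) → (Fin n → Fin m → F) := fun T => T₀ + fun i => (T i : Fin m → F)
  have hj : Function.Injective j := by
    intro T T' h
    ext i : 2
    exact congrFun (add_left_cancel h) i
  let D' : Finset (Fin n → perp a) := {T | j T ∈ D}
  have hmem : ∀ T, T ∈ D' ↔ j T ∈ D := by simp [D']
  have hsurj : ∀ T ∈ D, ∃ T', j T' = T := by
    intro T hT
    have h1 := mem_zoom.1 (hD hT)
    have h2 := mem_zoom.1 (hD hT₀)
    refine ⟨fun i => ⟨T i - T₀ i, ?_⟩, ?_⟩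
    · rw [mem_perp, sub_dotProduct, sub_eq_zero]
      exact congrFun (h1.trans h2.symm) i
    · ext i : 1
      simp [j]
  have hcount : ∀ A : Finset (Fin n → Fin m → F), A ⊆ D → #{T | j T ∈ A} = #A := by
    intro A hA
    refine Finset.card_bij (fun T _ => j T) ?_ ?_ ?_
    · intro T hT; simpa using hT
    · intro T _ T' _ h; exact hj h
    · intro T hT
      obtain ⟨T', rfl⟩ := hsurj T (hA hT)
      exact ⟨T', by simpa using hT, rfl⟩
  have hD' : #D' = #D := hcount D Finset.Subset.rfl
  have hstep := card_one_step_le (F := F) D'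
  have hjrk : ∀ T (ω : (Fin n → F) × perp a), j (T + rk ω.1 ω.2) = j T + rk ω.1 (ω.2 : Fin m → F) := by
    intro T ω
    ext i k
    simp [j, rk, add_assoc]
  have heq : ∀ ω : (Fin n → F) × perp a, #{T ∈ D' | T + rk ω.1 ω.2 ∈ D'} =
      #{T ∈ D | T + rk ω.1 (ω.2 : Fin m → F) ∈ D} := by
    intro ω
    rw [← hcount _ (Finset.filter_subset _ _)]
    congr 1
    ext T
    simp [hmem, hjrk]
  simp only [heq, hD', ← card_zoom ha b] at hstep
  refine hstep.trans ?_
  have hz : (0 : ℝ) < #(zoom a b) := by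
    exact_mod_cast Finset.card_pos.2 ⟨T₀, hD hT₀⟩
  have hq : (Fintype.card F : ℝ)⁻¹ ≤ 1 := by
    apply inv_le_one_of_one_le₀
    exact_mod_cast Fintype.card_pos
  have h3 : (#D : ℝ) ^ 2 / #(zoom a b) ≤ #D * ρ := by
    rw [div_le_iff₀ hz]
    calc (#D : ℝ) ^ 2 = #D * #D := by ring
      _ ≤ #D * (ρ * #(zoom a b)) := by gcongr
      _ = _ := by ring
  have h4 := mul_le_mul_of_nonneg_left h3 (sub_nonneg.2 hq)
  refine mul_le_mul_of_nonneg_left ?_ (by positivity)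
  linarith

theorem card_zoom_step_le' {a : Fin m → F} (ha : a ≠ 0) (b : Fin n → F)
    (D : Finset (Fin n → Fin m → F)) (hD : D ⊆ zoom a b) (ρ : ℝ) (hρ : (#D : ℝ) ≤ ρ * #(zoom a b)) :
    (∑ T ∈ D, #{ω : (Fin n → F) × (Fin m → F) | ω.2 ∈ perp a ∧ T + rk ω.1 ω.2 ∈ D} : ℝ) ≤
      (Fintype.card F : ℝ) ^ n * (Fintype.card F : ℝ) ^ (m - 1) *
        (#D * ((Fintype.card F : ℝ)⁻¹ + (1 - (Fintype.card F : ℝ)⁻¹) * ρ)) := by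
  have h := card_zoom_step_le ha b D hD ρ hρ
  rw [Fintype.card_prod, card_perp ha] at h
  simp only [Fintype.card_fun, Fintype.card_fin, Nat.cast_mul, Nat.cast_pow] at h
  refine le_trans (le_of_eq ?_) h
  norm_cast
  have h1 : ∀ T, #{ω : (Fin n → F) × (Fin m → F) | ω.2 ∈ perp a ∧ T + rk ω.1 ω.2 ∈ D} =
      #{ω : (Fin n → F) × perp a | T + rk ω.1 (ω.2 : Fin m → F) ∈ D} := by
    intro T
    symm
    refine Finset.card_bij (fun ω _ => (ω.1, (ω.2 : Fin m → F))) ?_ ?_ ?_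
    · intro ω hω
      simp only [Finset.mem_filter, Finset.mem_univ, true_and] at hω ⊢
      exact ⟨ω.2.2, hω⟩
    · intro ω _ ω' _ h
      simp only [Prod.mk.injEq] at h
      exact Prod.ext h.1 (Subtype.ext h.2)
    · intro ω hω
      simp only [Finset.mem_filter, Finset.mem_univ, true_and] at hω
      exact ⟨(ω.1, ⟨ω.2, hω.1⟩), by simpa using hω.2, rfl⟩
  simp only [h1]
  exact Finset.sum_card_bipartiteAbove_eq_sum_card_bipartiteBelow
    (fun (T : Fin n → Fin m → F) (ω : (Fin n → F) × perp a) => T + rk ω.1 (ω.2 : Fin m → F) ∈ D)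

/-- A partition of `D` into subsets of zoom-ins of density at most `ρ` is destroyed by many steps
parallel to the zoom-ins. -/
theorem card_class_step_le {κ : Type*} (D : Finset (Fin n → Fin m → F))
    (idx : (Fin n → Fin m → F) → κ) (A : κ → Fin m → F) (B : κ → Fin n → F)
    (hA : ∀ T ∈ D, A (idx T) ≠ 0) (hB : ∀ T ∈ D, app T (A (idx T)) = B (idx T)) (ρ : ℝ)
    (hρ : ∀ T ∈ D, (#{T' ∈ D | idx T' = idx T} : ℝ) ≤ ρ * #(zoom (A (idx T)) (B (idx T)))) :
    (∑ T ∈ D, #{ω : (Fin n → F) × (Fin m → F) | ω.2 ∈ perp (A (idx T)) ∧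
        T + rk ω.1 ω.2 ∈ D ∧ idx (T + rk ω.1 ω.2) = idx T} : ℝ) ≤
      (Fintype.card F : ℝ) ^ n * (Fintype.card F : ℝ) ^ (m - 1) *
        (#D * ((Fintype.card F : ℝ)⁻¹ + (1 - (Fintype.card F : ℝ)⁻¹) * ρ)) := by
  rw [← Finset.sum_fiberwise_of_maps_to (g := idx) (t := D.image idx)
    fun T hT => Finset.mem_image_of_mem _ hT]
  have hcard : (#D : ℝ) = ∑ i ∈ D.image idx, (#{T ∈ D | idx T = i} : ℝ) := by
    exact_mod_cast Finset.card_eq_sum_card_image idx D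
  rw [hcard, Finset.sum_mul, Finset.mul_sum]
  refine Finset.sum_le_sum fun i hi => ?_
  obtain ⟨T₀, hT₀, rfl⟩ := Finset.mem_image.1 hi
  have := card_zoom_step_le' (hA T₀ hT₀) (B (idx T₀)) {T ∈ D | idx T = idx T₀} (by
    intro T hT
    obtain ⟨hT, hTi⟩ := Finset.mem_filter.1 hT
    rw [mem_zoom, ← hTi, hB T hT]) ρ (hρ T₀ hT₀)
  refine le_trans (le_of_eq (Finset.sum_congr rfl fun T hT => ?_)) this
  rw [(Finset.mem_filter.1 hT).2]
  simp only [Finset.mem_filter]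

end Model

section Localize

variable {F : Type} [Field F] [Fintype F] {n m : ℕ} {ι : Type*}
open scoped Classical

/-- Each `Φ e` has degree at most `q - 1` along every rank-one direction. -/
def LineDeg (Φ : ι → (Fin n → Fin m → F) → F) : Prop :=
  ∀ (e : ι) (T : Fin n → Fin m → F) (u : Fin n → F), fDegLE (fun α => Φ e (T + rk u α)) (Fintype.card F - 1)

/-- The matrices at which some `Φ e` is nonzero. -/
def rej (Φ : ι → (Fin n → Fin m → F) → F) : Finset (Fin n → Fin m → F) := {T | ∃ e, Φ e T ≠ 0}

theorem mem_rej {Φ : ι → (Fin n → Fin m → F) → F} {T : Fin n → Fin m → F} :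
    T ∈ rej Φ ↔ ∃ e, Φ e T ≠ 0 := by simp [rej]

/-- The `α` for which `T + u ⊗ α` is rejecting. -/
def rset (Φ : ι → (Fin n → Fin m → F) → F) (T : Fin n → Fin m → F) (u : Fin n → F) :
    Finset (Fin m → F) := {α | T + rk u α ∈ rej Φ}

theorem mem_rset {Φ : ι → (Fin n → Fin m → F) → F} {T : Fin n → Fin m → F} {u : Fin n → F}
    {α : Fin m → F} : α ∈ rset Φ T u ↔ T + rk u α ∈ rej Φ := by simp [rset]

variable {Φ : ι → (Fin n → Fin m → F) → F}

theorem support_subset_rset (e : ι) (T : Fin n → Fin m → F) (u : Fin n → F) :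
    ({α | Φ e (T + rk u α) ≠ 0} : Finset (Fin m → F)) ⊆ rset Φ T u := by
  intro α hα
  rw [mem_rset, mem_rej]
  exact ⟨e, by simpa using hα⟩

theorem LineDeg.card_rset_ge (hΦ : LineDeg Φ) {T : Fin n → Fin m → F} {u : Fin n → F}
    {α : Fin m → F} (h : T + rk u α ∈ rej Φ) :
    Fintype.card F ^ m ≤ Fintype.card F * #(rset Φ T u) := by
  obtain ⟨e, he⟩ := mem_rej.1 h
  have h1 := (hΦ e T u).card_support_ge α he
  have hq : Fintype.card F - (Fintype.card F - 1) = 1 := by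
    have : 0 < Fintype.card F := Fintype.card_pos
    omega
  rw [hq, one_mul] at h1
  exact h1.trans (Nat.mul_le_mul_left _ (Finset.card_le_card (support_subset_rset e T u)))

theorem mem_rset_shift {T : Fin n → Fin m → F} {u : Fin n → F} {α β : Fin m → F} :
    β ∈ rset Φ (T + rk u α) u ↔ α + β ∈ rset Φ T u := by
  rw [mem_rset, mem_rset, rk_add, add_assoc]

theorem card_rset_shift (T : Fin n → Fin m → F) (u : Fin n → F) (α : Fin m → F) :
    #(rset Φ (T + rk u α) u) = #(rset Φ T u) :=
  Finset.card_equiv (Equiv.addLeft α) fun β => by rw [mem_rset_shift]; simp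

theorem LineDeg.card_two_ge (hΦ : LineDeg Φ) (T : Fin n → Fin m → F) (u v : Fin n → F) :
    #(rset Φ T v ∪ rset Φ T (u + v)) * Fintype.card F ^ m ≤
      Fintype.card F *
        #{x : (Fin m → F) × (Fin m → F) | T + (rk u x.1 + rk v x.2) ∈ rej Φ} := by
  have h1 : #{x : (Fin m → F) × (Fin m → F) | T + (rk u x.1 + rk v x.2) ∈ rej Φ} =
      ∑ β, #(rset Φ (T + rk v β) u) := by
    simp only [rset, Finset.card_filter]
    rw [Fintype.sum_prod_type_right]
    refine Finset.sum_congr rfl fun β _ => Finset.sum_congr rfl fun α _ => ?_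
    rw [add_comm (rk u α), add_assoc]
  rw [h1, Finset.mul_sum]
  calc _ = ∑ β ∈ rset Φ T v ∪ rset Φ T (u + v), Fintype.card F ^ m := by
        rw [Finset.sum_const, smul_eq_mul]
    _ ≤ ∑ β ∈ rset Φ T v ∪ rset Φ T (u + v), Fintype.card F * #(rset Φ (T + rk v β) u) := by
        refine Finset.sum_le_sum fun β hβ => ?_
        rcases Finset.mem_union.1 hβ with h | h
        · refine hΦ.card_rset_ge (α := 0) ?_
          rw [rk_zero, add_zero]
          exact mem_rset.1 h
        · refine hΦ.card_rset_ge (α := β) ?_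
          rw [mem_rset, rk_add_left, add_comm (rk u β), ← add_assoc] at h
          exact h
    _ ≤ _ := Finset.sum_le_sum_of_subset (Finset.subset_univ _)

/-- Most pairs of directions at a rejecting matrix see few rejecting matrices. -/
theorem LineDeg.card_bad_two (hΦ : LineDeg Φ) :
    (#{x : (Fin n → Fin m → F) × ((Fin n → F) × (Fin n → F)) | x.1 ∈ rej Φ ∧
        (Fintype.card F + 1) * Fintype.card F ^ m ≤
          #(rset Φ x.1 x.2.2 ∪ rset Φ x.1 (x.2.1 + x.2.2)) * Fintype.card F ^ 2} : ℝ) ≤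
      (Fintype.card F : ℝ) ^ 3 * (#(rej Φ) : ℝ) ^ 2 / Fintype.card (Fin n → Fin m → F) *
        ((Fintype.card F : ℝ) ^ n) ^ 2 := by
  set q := Fintype.card F with hq
  have hqpos : 0 < q := Fintype.card_pos
  set R2 : (Fin n → Fin m → F) → (Fin n → F) × (Fin n → F) → ℕ := fun T u =>
    #{x : (Fin m → F) × (Fin m → F) | T + (rk u.1 x.1 + rk u.2 x.2) ∈ rej Φ} with hR2
  set Bad : Finset ((Fin n → Fin m → F) × ((Fin n → F) × (Fin n → F))) :=
    {x | x.1 ∈ rej Φ ∧ (q + 1) * q ^ m ≤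
          #(rset Φ x.1 x.2.2 ∪ rset Φ x.1 (x.2.1 + x.2.2)) * q ^ 2} with hBad
  have hlow : ∀ T ∈ rej Φ, ∀ u, (q : ℝ) ^ (2 * m) +
      (if (T, u) ∈ Bad then (q : ℝ) ^ (2 * m) / q else 0) ≤ q ^ 2 * R2 T u := by
    intro T hT u
    have h1 := hΦ.card_two_ge T u.1 u.2
    rw [← hq] at h1
    change _ ≤ q * R2 T u at h1
    have hR1 : q ^ m ≤ q * #(rset Φ T u.2 ∪ rset Φ T (u.1 + u.2)) :=
      (hΦ.card_rset_ge (α := 0) (by rwa [rk_zero, add_zero])).trans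
        (Nat.mul_le_mul_left _ (Finset.card_le_card Finset.subset_union_left))
    split_ifs with hb
    · have h2 := (Finset.mem_filter.1 hb).2.2
      simp only at h2
      have h3 : (q + 1) * q ^ m * q ^ m ≤ q ^ 3 * R2 T u := by
        calc (q + 1) * q ^ m * q ^ m ≤
            (#(rset Φ T u.2 ∪ rset Φ T (u.1 + u.2)) * q ^ 2) * q ^ m := Nat.mul_le_mul_right _ h2
          _ = q ^ 2 * (#(rset Φ T u.2 ∪ rset Φ T (u.1 + u.2)) * q ^ m) := by ring
          _ ≤ q ^ 2 * (q * R2 T u) := Nat.mul_le_mul_left _ h1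
          _ = _ := by ring
      have h4 : ((q : ℝ) + 1) * q ^ m * q ^ m ≤ q ^ 3 * R2 T u := by exact_mod_cast h3
      have hq0 : (0 : ℝ) < q := by exact_mod_cast hqpos
      refine le_of_mul_le_mul_left ?_ hq0
      have : (q : ℝ) * ((q : ℝ) ^ (2 * m) + (q : ℝ) ^ (2 * m) / q) =
          ((q : ℝ) + 1) * q ^ m * q ^ m := by
        field_simp
        ring
      rw [this]
      linarith
    · have h3 : q ^ (2 * m) ≤ q ^ 2 * R2 T u := by
        calc q ^ (2 * m) = q ^ m * q ^ m := by ring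
          _ ≤ (q * #(rset Φ T u.2 ∪ rset Φ T (u.1 + u.2))) * q ^ m := Nat.mul_le_mul_right _ hR1
          _ = q * (#(rset Φ T u.2 ∪ rset Φ T (u.1 + u.2)) * q ^ m) := by ring
          _ ≤ q * (q * R2 T u) := Nat.mul_le_mul_left _ h1
          _ = _ := by ring
      rw [add_zero]
      exact_mod_cast h3
  have hup : (∑ T ∈ rej Φ, ∑ u, (R2 T u : ℝ)) ≤ ((q : ℝ) ^ n) ^ 2 * (q : ℝ) ^ (2 * m) *
      (((q : ℝ)⁻¹) ^ 2 * #(rej Φ) + (#(rej Φ) : ℝ) ^ 2 / Fintype.card (Fin n → Fin m → F)) := by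
    have h := card_two_step_le (F := F) (rej Φ)
    rw [Fintype.card_prod, Fintype.card_fun (β := F), Fintype.card_fun (β := F), ← hq] at h
    simp only [Fintype.card_fin, Nat.cast_mul, Nat.cast_pow] at h
    have e : (∑ T ∈ rej Φ, ∑ u, (R2 T u : ℝ)) =
        ∑ ω : ((Fin n → F) × (Fin m → F)) × ((Fin n → F) × (Fin m → F)),
          (#{T ∈ rej Φ | T + (rk ω.1.1 ω.1.2 + rk ω.2.1 ω.2.2) ∈ rej Φ} : ℝ) := by
      norm_cast
      refine Eq.trans ?_ (Finset.sum_card_bipartiteAbove_eq_sum_card_bipartiteBelow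
        (fun (T : Fin n → Fin m → F)
          (ω : ((Fin n → F) × (Fin m → F)) × ((Fin n → F) × (Fin m → F))) =>
          T + (rk ω.1.1 ω.1.2 + rk ω.2.1 ω.2.2) ∈ rej Φ))
      refine Finset.sum_congr rfl fun T _ => ?_
      simp only [hR2, Finset.bipartiteAbove, Finset.card_filter]
      rw [← Fintype.sum_prod_type' (f := fun (u : (Fin n → F) × (Fin n → F))
        (x : (Fin m → F) × (Fin m → F)) =>
          if T + (rk u.1 x.1 + rk u.2 x.2) ∈ rej Φ then 1 else 0)]
      exact (Equiv.sum_comp (Equiv.prodProdProdComm (Fin n → F) (Fin m → F) (Fin n → F) (Fin m → F))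
        (fun y : ((Fin n → F) × (Fin n → F)) × ((Fin m → F) × (Fin m → F)) =>
          if T + (rk y.1.1 y.2.1 + rk y.1.2 y.2.2) ∈ rej Φ then 1 else 0)).symm
    rw [e]
    refine h.trans (le_of_eq ?_)
    simp only [Fintype.card_fun, Fintype.card_fin, Nat.cast_pow]
    rw [← hq]
    ring
  have hlow2 : (#(rej Φ) : ℝ) * ((q : ℝ) ^ n) ^ 2 * (q : ℝ) ^ (2 * m) +
      #Bad * ((q : ℝ) ^ (2 * m) / q) ≤ q ^ 2 * ∑ T ∈ rej Φ, ∑ u, (R2 T u : ℝ) := by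
    rw [Finset.mul_sum]
    simp_rw [Finset.mul_sum]
    refine le_trans (le_of_eq ?_)
      (Finset.sum_le_sum fun T hT => Finset.sum_le_sum fun u _ => hlow T hT u)
    simp_rw [Finset.sum_add_distrib, Finset.sum_const, Finset.card_univ, nsmul_eq_mul]
    congr 1
    · rw [Fintype.card_prod, Fintype.card_fun, ← hq]
      simp only [Fintype.card_fin]
      push_cast
      ring
    · rw [← Finset.sum_product' (f := fun T u => if (T, u) ∈ Bad then (q : ℝ) ^ (2 * m) / q else 0)]
      simp only [Prod.mk.eta]
      rw [← Finset.sum_filter, Finset.sum_const, nsmul_eq_mul]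
      congr 3
      ext x
      simp only [Finset.mem_filter, Finset.mem_product, Finset.mem_univ, and_true]
      constructor
      · intro hx; exact ⟨(Finset.mem_filter.1 hx).2.1, hx⟩
      · exact fun hx => hx.2
  have hq0 : (0 : ℝ) < q := by exact_mod_cast hqpos
  have hfin := hlow2.trans (mul_le_mul_of_nonneg_left hup (by positivity : (0 : ℝ) ≤ (q : ℝ) ^ 2))
  set S := (#(rej Φ) : ℝ)
  set N := (Fintype.card (Fin n → Fin m → F) : ℝ)
  have hz : (0 : ℝ) < (q : ℝ) ^ (2 * m) / q := by positivity
  refine le_of_mul_le_mul_right ?_ hz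
  have e2 : (q : ℝ) ^ 2 * (((q : ℝ) ^ n) ^ 2 * (q : ℝ) ^ (2 * m) *
      (((q : ℝ)⁻¹) ^ 2 * S + S ^ 2 / N)) = S * ((q : ℝ) ^ n) ^ 2 * (q : ℝ) ^ (2 * m) +
      (q : ℝ) ^ 3 * S ^ 2 / N * ((q : ℝ) ^ n) ^ 2 * ((q : ℝ) ^ (2 * m) / q) := by
    field_simp
  rw [e2] at hfin
  linarith

end Localize

section Localize

variable {F : Type} [Field F] [Fintype F] {n m : ℕ} {ι : Type*}
open scoped Classical

/-- A normal vector of a hyperplane, depending only on the hyperplane. -/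
def hrep (A : Submodule F (Fin m → F)) : Fin m → F :=
  if h : ∃ a : Fin m → F, a ≠ 0 ∧ perp a = A then h.choose else 0

/-- `a` is the chosen normal vector of its hyperplane. -/
def Canon (a : Fin m → F) : Prop := a ≠ 0 ∧ hrep (perp a) = a

theorem Canon.eq {a a' : Fin m → F} (ha : Canon a) (ha' : Canon a') (h : perp a = perp a') :
    a = a' := by
  rw [← ha.2, ← ha'.2, h]

theorem exists_canon {a : Fin m → F} (ha : a ≠ 0) : ∃ a', Canon a' ∧ perp a' = perp a := by
  have h : ∃ a' : Fin m → F, a' ≠ 0 ∧ perp a' = perp a := ⟨a, ha, rfl⟩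
  have h1 : hrep (perp a) = h.choose := dif_pos h
  refine ⟨hrep (perp a), ⟨?_, ?_⟩, ?_⟩
  · rw [h1]; exact h.choose_spec.1
  · rw [h1, h.choose_spec.2, ← h1]
  · rw [h1]; exact h.choose_spec.2

theorem perp_eq_of_subset {a a' : Fin m → F} (ha : a ≠ 0) (ha' : a' ≠ 0) (X : Finset (Fin m → F))
    (hX : ∀ α ∈ perp a, α ∈ X) (hX' : ∀ α ∈ perp a', α ∈ X)
    (hq : 2 ≤ Fintype.card F)
    (hcard : #X * Fintype.card F ^ 2 < (Fintype.card F + 1) * Fintype.card F ^ m) :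
    perp a = perp a' := by
  by_contra hne
  have hcP : ∀ W : Submodule F (Fin m → F), #({α | α ∈ W} : Finset (Fin m → F)) = Nat.card W := by
    intro W
    rw [Nat.card_eq_fintype_card, Fintype.card_subtype]
  have h1 : Nat.card (perp a) * Fintype.card F = Fintype.card F ^ m := by
    rw [Nat.card_eq_fintype_card]; exact card_perp_mul ha
  have h2 : Nat.card (perp a') = Nat.card (perp a) := by
    rw [Nat.card_eq_fintype_card, Nat.card_eq_fintype_card, card_perp ha, card_perp ha']
  have hlt : perp a ⊓ perp a' < perp a := by
    refine lt_of_le_of_ne inf_le_left fun h => hne ?_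
    have hle : perp a ≤ perp a' := inf_eq_left.1 h
    exact SetLike.coe_injective (Set.eq_of_subset_of_ncard_le hle (le_of_eq h2) (Set.toFinite _))
  have h3 := card_mul_le_of_lt hlt
  have h4 := Finset.card_union_add_card_inter ({α | α ∈ perp a} : Finset (Fin m → F))
    ({α | α ∈ perp a'} : Finset (Fin m → F))
  have h5 : ({α | α ∈ perp a} : Finset (Fin m → F)) ∩ ({α | α ∈ perp a'} : Finset (Fin m → F)) =
      ({α | α ∈ perp a ⊓ perp a'} : Finset (Fin m → F)) := by
    ext α; simp
  have h6 : #(({α | α ∈ perp a} : Finset (Fin m → F)) ∪ ({α | α ∈ perp a'} : Finset (Fin m → F))) ≤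
      #X := by
    refine Finset.card_le_card fun α hα => ?_
    rcases Finset.mem_union.1 hα with h | h
    · exact hX α (Finset.mem_filter.1 h).2
    · exact hX' α (Finset.mem_filter.1 h).2
  rw [h5, hcP, hcP, hcP, h2] at h4
  set U := #(({α | α ∈ perp a} : Finset (Fin m → F)) ∪ ({α | α ∈ perp a'} : Finset (Fin m → F)))
  set q := Fintype.card F
  set A := Nat.card (perp a)
  set I := Nat.card (perp a ⊓ perp a' : Submodule F (Fin m → F))
  rw [← h1] at hcard
  have h7 : U * q ^ 2 < (q + 1) * (A * q) := (Nat.mul_le_mul_right _ h6).trans_lt hcard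
  have h8 : (U + I) * q ^ 2 = (A + A) * q ^ 2 := by rw [h4]
  have h9 : I * q * q ≤ A * q := Nat.mul_le_mul_right _ h3
  have h10 : A * q * 2 ≤ A * q * q := Nat.mul_le_mul_left _ hq
  nlinarith

/-- The rejecting `α` in direction `v` at `T` contain the hyperplane orthogonal to `a` and not much
more. -/
def GoodDir (Φ : ι → (Fin n → Fin m → F) → F) (T : Fin n → Fin m → F) (v : Fin n → F)
    (a : Fin m → F) : Prop :=
  Canon a ∧ (∀ α ∈ perp a, α ∈ rset Φ T v) ∧
    #(rset Φ T v) * Fintype.card F ^ 2 < (Fintype.card F + 1) * Fintype.card F ^ m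

variable {Φ : ι → (Fin n → Fin m → F) → F}

theorem GoodDir.eq {T : Fin n → Fin m → F} {v : Fin n → F} {a a' : Fin m → F}
    (h : GoodDir Φ T v a) (h' : GoodDir Φ T v a') : a = a' :=
  h.1.eq h'.1 (perp_eq_of_subset h.1.1 h'.1.1 _ h.2.1 h'.2.1 Fintype.one_lt_card h.2.2)

theorem GoodDir.shift {T : Fin n → Fin m → F} {v : Fin n → F} {a α : Fin m → F}
    (h : GoodDir Φ T v a) (hα : α ∈ perp a) : GoodDir Φ (T + rk v α) v a := by
  refine ⟨h.1, fun β hβ => ?_, ?_⟩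
  · rw [mem_rset_shift]
    exact h.2.1 _ (add_mem hα hβ)
  · rw [card_rset_shift]
    exact h.2.2

theorem LineDeg.exists_goodDir (hΦ : LineDeg Φ) (hq : 3 ≤ Fintype.card F)
    {T : Fin n → Fin m → F} (hT : T ∈ rej Φ) (v w : Fin n → F)
    (h : #(rset Φ T v ∪ rset Φ T w) * Fintype.card F ^ 2 <
      (Fintype.card F + 1) * Fintype.card F ^ m) :
    ∃ a, GoodDir Φ T v a ∧ GoodDir Φ T w a := by
  obtain ⟨e, he⟩ := mem_rej.1 hT
  have key : ∀ u, #(rset Φ T u) * Fintype.card F ^ 2 <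
      (Fintype.card F + 1) * Fintype.card F ^ m → ∃ a, GoodDir Φ T u a := by
    intro u hu
    have he' : Φ e (T + rk u 0) ≠ 0 := by rwa [rk_zero, add_zero]
    obtain ⟨a, ha, κ, c, hc, hG⟩ := (hΦ e T u).eq_indicator hq 0 he'
      ((Nat.mul_le_mul_right _ (Finset.card_le_card (support_subset_rset e T u))).trans_lt hu)
    have hκ : κ = 0 := by
      by_contra hκ
      apply he'
      rw [hG 0, if_neg]
      rw [zero_dotProduct]
      exact fun h => hκ h.symm
    obtain ⟨a', ha', haa'⟩ := exists_canon ha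
    refine ⟨a', ha', fun α hα => ?_, hu⟩
    rw [mem_rset, mem_rej]
    refine ⟨e, ?_⟩
    rw [hG α, if_pos]
    · exact hc
    · rw [haa'] at hα
      rw [hκ]
      exact hα
  have hv := (Nat.mul_le_mul_right (Fintype.card F ^ 2) (Finset.card_le_card
    (Finset.subset_union_left (s₁ := rset Φ T v) (s₂ := rset Φ T w)))).trans_lt h
  have hw := (Nat.mul_le_mul_right (Fintype.card F ^ 2) (Finset.card_le_card
    (Finset.subset_union_right (s₁ := rset Φ T v) (s₂ := rset Φ T w)))).trans_lt h
  obtain ⟨a, ha⟩ := key v hv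
  obtain ⟨a', ha'⟩ := key w hw
  have : a = a' := ha.1.eq ha'.1 (perp_eq_of_subset ha.1.1 ha'.1.1 _
    (fun α hα => Finset.mem_union_left _ (ha.2.1 α hα))
    (fun α hα => Finset.mem_union_right _ (ha'.2.1 α hα)) Fintype.one_lt_card h)
  subst this
  exact ⟨a, ha, ha'⟩

theorem LineDeg.exists_hyperplane_map (hΦ : LineDeg Φ) (hq : 3 ≤ Fintype.card F) :
    ∃ k : (Fin n → Fin m → F) → (Fin m → F),
      (#{x : (Fin n → Fin m → F) × (Fin n → F) | x.1 ∈ rej Φ ∧ ¬ GoodDir Φ x.1 x.2 (k x.1)} : ℝ) ≤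
      (Fintype.card F : ℝ) ^ 3 * (#(rej Φ) : ℝ) ^ 2 / Fintype.card (Fin n → Fin m → F) *
        (Fintype.card F : ℝ) ^ n := by
  have hbad := hΦ.card_bad_two (n := n) (m := m)
  have hbad2 : (#{x : (Fin n → Fin m → F) × ((Fin n → F) × (Fin n → F)) | x.1 ∈ rej Φ ∧
      ¬ ∃ a, GoodDir Φ x.1 x.2.1 a ∧ GoodDir Φ x.1 x.2.2 a} : ℝ) ≤
      (Fintype.card F : ℝ) ^ 3 * (#(rej Φ) : ℝ) ^ 2 / Fintype.card (Fin n → Fin m → F) *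
        ((Fintype.card F : ℝ) ^ n) ^ 2 := by
    refine le_trans ?_ hbad
    norm_cast
    refine Finset.card_le_card_of_injOn (fun x => (x.1, (x.2.2 - x.2.1, x.2.1))) ?_ ?_
    · intro x hx
      simp only [Finset.coe_filter, Finset.mem_univ, true_and, Set.mem_ofPred_eq] at hx ⊢
      refine ⟨hx.1, ?_⟩
      by_contra hlt
      refine hx.2 (hΦ.exists_goodDir hq hx.1 _ _ ?_)
      rw [sub_add_cancel] at hlt
      exact not_le.1 hlt
    · rintro ⟨T, v, w⟩ _ ⟨T', v', w'⟩ _ h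
      simp only [Prod.mk.injEq] at h
      obtain ⟨rfl, h1, rfl⟩ := h
      rw [sub_left_inj] at h1
      rw [h1]
  let cnt : (Fin n → Fin m → F) → (Fin n → F) → ℕ := fun T v =>
    #{w | ¬ ∃ a, GoodDir Φ T v a ∧ GoodDir Φ T w a}
  have hmin : ∀ T, ∃ v, ∀ v', cnt T v ≤ cnt T v' := by
    intro T
    obtain ⟨v, -, hv⟩ := Finset.exists_min_image univ (cnt T) Finset.univ_nonempty
    exact ⟨v, fun v' => hv v' (Finset.mem_univ _)⟩
  choose v₀ hv₀ using hmin
  let k : (Fin n → Fin m → F) → (Fin m → F) := fun T =>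
    if h : ∃ a, GoodDir Φ T (v₀ T) a then h.choose else 0
  refine ⟨k, ?_⟩
  have h1 : ∀ T, #{w | ¬ GoodDir Φ T w (k T)} ≤ cnt T (v₀ T) := by
    intro T
    refine Finset.card_le_card fun w hw => ?_
    simp only [Finset.mem_filter, Finset.mem_univ, true_and] at hw ⊢
    rintro ⟨a, ha, ha'⟩
    have hex : ∃ a, GoodDir Φ T (v₀ T) a := ⟨a, ha⟩
    have hk : k T = a := by
      have : k T = hex.choose := dif_pos hex
      rw [this]
      exact hex.choose_spec.eq ha
    exact hw (hk ▸ ha')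
  have hqn : (0 : ℝ) < (Fintype.card F : ℝ) ^ n :=
    pow_pos (by exact_mod_cast Fintype.card_pos) _
  refine le_of_mul_le_mul_right ?_ hqn
  refine le_trans ?_ (hbad2.trans (le_of_eq (by ring)))
  have e1 : #{x : (Fin n → Fin m → F) × (Fin n → F) | x.1 ∈ rej Φ ∧ ¬ GoodDir Φ x.1 x.2 (k x.1)} =
      ∑ T ∈ rej Φ, #{w | ¬ GoodDir Φ T w (k T)} := by
    simp only [Finset.card_filter]
    rw [Fintype.sum_prod_type, ← Finset.sum_filter_add_sum_filter_not univ (fun T => T ∈ rej Φ)]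
    rw [Finset.sum_eq_zero (s := univ.filter fun T => T ∉ rej Φ), add_zero]
    · rw [Finset.filter_univ_mem]
      refine Finset.sum_congr rfl fun T hT => ?_
      simp [hT]
    · intro T hT
      simp [(Finset.mem_filter.1 hT).2]
  have e2 : #{x : (Fin n → Fin m → F) × ((Fin n → F) × (Fin n → F)) | x.1 ∈ rej Φ ∧
      ¬ ∃ a, GoodDir Φ x.1 x.2.1 a ∧ GoodDir Φ x.1 x.2.2 a} = ∑ T ∈ rej Φ, ∑ v, cnt T v := by
    simp only [Finset.card_filter, cnt]
    rw [Fintype.sum_prod_type, ← Finset.sum_filter_add_sum_filter_not univ (fun T => T ∈ rej Φ)]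
    rw [Finset.sum_eq_zero (s := univ.filter fun T => T ∉ rej Φ), add_zero]
    · rw [Finset.filter_univ_mem]
      refine Finset.sum_congr rfl fun T hT => ?_
      rw [Fintype.sum_prod_type]
      simp only [hT, true_and]
    · intro T hT
      simp [(Finset.mem_filter.1 hT).2]
  rw [e1, e2]
  norm_cast
  rw [Finset.sum_mul]
  refine Finset.sum_le_sum fun T _ => ?_
  calc _ ≤ cnt T (v₀ T) * Fintype.card F ^ n := Nat.mul_le_mul_right _ (h1 T)
    _ = ∑ v : Fin n → F, cnt T (v₀ T) := by
        rw [Finset.sum_const, Finset.card_univ, Fintype.card_fun, Fintype.card_fin, smul_eq_mul,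
          mul_comm]
    _ ≤ _ := Finset.sum_le_sum fun v _ => hv₀ T v

end Localize

section Localize

variable {F : Type} [Field F] [Fintype F] {n m : ℕ} {ι : Type*}
open scoped Classical

theorem card_filter_fst_mem {α β : Type*} [Fintype α] [Fintype β] (D : Finset α)
    (r : α → β → Prop) [DecidablePred fun x : α × β => x.1 ∈ D ∧ r x.1 x.2]
    {hr : ∀ y, DecidablePred (r y)} :
    #{x : α × β | x.1 ∈ D ∧ r x.1 x.2} = ∑ y ∈ D, #{z | r y z} := by
  simp only [Finset.card_filter]
  rw [Fintype.sum_prod_type, ← Finset.sum_filter_add_sum_filter_not univ (fun y => y ∈ D)]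
  rw [Finset.sum_eq_zero (s := univ.filter fun y => y ∉ D), add_zero, Finset.filter_univ_mem]
  · refine Finset.sum_congr rfl fun y hy => ?_
    simp [hy]
  · intro y hy
    simp [(Finset.mem_filter.1 hy).2]

variable {Φ : ι → (Fin n → Fin m → F) → F}

/-- If the rejecting matrices are few, they are dense in some zoom-in. -/
theorem LineDeg.exists_dense_zoom (hΦ : LineDeg Φ) (hq : 3 ≤ Fintype.card F)
    (hne : (rej Φ).Nonempty)
    (hsmall : 6 * (Fintype.card F : ℝ) ^ 3 * #(rej Φ) < Fintype.card (Fin n → Fin m → F)) :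
    ∃ (a : Fin m → F) (b : Fin n → F), a ≠ 0 ∧ #(zoom a b) ≤ 2 * #(rej Φ ∩ zoom a b) := by
  by_contra! hcon
  obtain ⟨k, hk⟩ := hΦ.exists_hyperplane_map hq
  set q := Fintype.card F with hqdef
  set S := #(rej Φ) with hS
  set h := q ^ (m - 1) with hh
  have hq0 : (0 : ℝ) < q := by exact_mod_cast Fintype.card_pos
  have hS0 : (0 : ℝ) < S := by exact_mod_cast Finset.card_pos.2 hne
  have hN0 : (0 : ℝ) < Fintype.card (Fin n → Fin m → F) := by exact_mod_cast Fintype.card_pos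
  have hcardperp : ∀ {a : Fin m → F}, a ≠ 0 → #({α | α ∈ perp a} : Finset (Fin m → F)) = h := by
    intro a ha
    rw [← Fintype.card_subtype, hh, hqdef, ← card_perp ha]
  set Bad : Finset ((Fin n → Fin m → F) × (Fin n → F)) :=
    {x | x.1 ∈ rej Φ ∧ ¬ GoodDir Φ x.1 x.2 (k x.1)} with hBad
  set Good : Finset ((Fin n → Fin m → F) × (Fin n → F)) :=
    {x | x.1 ∈ rej Φ ∧ GoodDir Φ x.1 x.2 (k x.1)} with hGood
  have hGB : #Good + #Bad = S * q ^ n := by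
    have h1 := card_filter_fst_mem (β := Fin n → F) (rej Φ) (fun T w => GoodDir Φ T w (k T))
      (hr := inferInstance)
    have h2 := card_filter_fst_mem (β := Fin n → F) (rej Φ) (fun T w => ¬ GoodDir Φ T w (k T))
      (hr := inferInstance)
    rw [hGood, hBad, h1, h2, ← Finset.sum_add_distrib]
    simp_rw [Finset.card_filter_add_card_filter_not]
    rw [Finset.sum_const, Finset.card_univ, Fintype.card_fun, Fintype.card_fin, smul_eq_mul]
  set A1 : Finset (((Fin n → Fin m → F) × (Fin n → F)) × (Fin m → F)) :=
    {x | x.1 ∈ Good ∧ x.2 ∈ perp (k x.1.1)} with hA1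
  have hcA1 : #A1 = #Good * h := by
    rw [hA1, card_filter_fst_mem Good (fun y z => z ∈ perp (k y.1)) (hr := inferInstance), ← smul_eq_mul,
      ← Finset.sum_const]
    refine Finset.sum_congr rfl fun y hy => hcardperp ?_
    exact (Finset.mem_filter.1 hy).2.2.1.1
  have hA3 : #{x ∈ A1 | k (x.1.1 + rk x.1.2 x.2) ≠ k x.1.1} ≤ #Bad * h := by
    have h1 : #{x : ((Fin n → Fin m → F) × (Fin n → F)) × (Fin m → F) | x.1 ∈ Bad ∧
        ∃ a, GoodDir Φ x.1.1 x.1.2 a ∧ x.2 ∈ perp a} ≤ #Bad * h := by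
      rw [card_filter_fst_mem Bad (fun y z => ∃ a, GoodDir Φ y.1 y.2 a ∧ z ∈ perp a)
        (hr := inferInstance),
        ← smul_eq_mul, ← Finset.sum_const]
      refine Finset.sum_le_sum fun y _ => ?_
      by_cases hy : ∃ a, GoodDir Φ y.1 y.2 a
      · obtain ⟨a, ha⟩ := hy
        rw [← hcardperp ha.1.1]
        refine Finset.card_le_card fun z hz => ?_
        simp only [Finset.mem_filter, Finset.mem_univ, true_and] at hz ⊢
        obtain ⟨a', ha', hz'⟩ := hz
        rwa [ha.eq ha']
      · rw [Finset.filter_false_of_mem]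
        · simp
        · rintro z - ⟨a, ha, -⟩
          exact hy ⟨a, ha⟩
    refine le_trans (Finset.card_le_card_of_injOn
      (fun x => ((x.1.1 + rk x.1.2 x.2, x.1.2), -x.2)) ?_ ?_) h1
    · rintro ⟨⟨T, w⟩, α⟩ hx
      simp only [hA1, hGood, hBad, Finset.coe_filter, Finset.mem_filter, Finset.mem_univ, true_and,
        Set.mem_ofPred_eq] at hx ⊢
      obtain ⟨⟨⟨hT, hgd⟩, hα⟩, hne⟩ := hx
      have hsh := hgd.shift hα
      refine ⟨⟨mem_rset.1 (hgd.2.1 α hα), fun hgd' => hne (hgd'.eq hsh)⟩, k T, hsh, neg_mem hα⟩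
    · rintro ⟨⟨T, w⟩, α⟩ _ ⟨⟨T', w'⟩, α'⟩ _ he
      simp only [Prod.mk.injEq, neg_inj] at he
      obtain ⟨⟨h1, rfl⟩, rfl⟩ := he
      rw [add_left_inj] at h1
      rw [h1]
  set D : Finset (Fin n → Fin m → F) := {T ∈ rej Φ | k T ≠ 0} with hD
  have hcls := card_class_step_le (F := F) D (fun T => (k T, app T (k T))) Prod.fst Prod.snd
    (fun T hT => (Finset.mem_filter.1 hT).2) (fun T _ => rfl) (1 / 2) (by
      intro T hT
      have h1 := hcon (k T) (app T (k T)) (Finset.mem_filter.1 hT).2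
      have h3 : (#(rej Φ ∩ zoom (k T) (app T (k T))) : ℝ) ≤
          1 / 2 * #(zoom (k T) (app T (k T))) := by
        have : (2 : ℝ) * #(rej Φ ∩ zoom (k T) (app T (k T))) ≤ #(zoom (k T) (app T (k T))) := by
          exact_mod_cast h1.le
        linarith
      refine le_trans (Nat.cast_le.2 (Finset.card_le_card fun T' hT' => ?_)) h3
      obtain ⟨hT'1, hT'2⟩ := (@Finset.mem_filter _ _ (_) _ _).1 hT'
      rw [Prod.mk.injEq] at hT'2
      rw [Finset.mem_inter, mem_zoom, ← hT'2.2, hT'2.1]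
      exact ⟨(Finset.mem_filter.1 hT'1).1, rfl⟩)
  have hA2 : (#{x ∈ A1 | k (x.1.1 + rk x.1.2 x.2) = k x.1.1} : ℝ) ≤
      (q : ℝ) ^ n * q ^ (m - 1) * (S * ((q : ℝ)⁻¹ + (1 - (q : ℝ)⁻¹) * (1 / 2))) := by
    have hDS : (#D : ℝ) ≤ S := by exact_mod_cast Finset.card_filter_le _ _
    have hinv : (q : ℝ)⁻¹ ≤ 1 := inv_le_one_of_one_le₀ (by
      exact_mod_cast (Fintype.card_pos : 0 < Fintype.card F))
    have hnn : 0 ≤ (q : ℝ)⁻¹ + (1 - (q : ℝ)⁻¹) * (1 / 2) := by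
      have : 0 < (q : ℝ)⁻¹ := by positivity
      nlinarith
    refine le_trans ?_ (hcls.trans (by gcongr))
    norm_cast
    refine le_trans ?_ (card_filter_fst_mem D _).le
    refine Finset.card_le_card_of_injOn (fun x => (x.1.1, (x.1.2, x.2))) ?_ ?_
    · rintro ⟨⟨T, w⟩, α⟩ hx
      simp only [hA1, hGood, hD, Finset.coe_filter, Finset.mem_filter, Finset.mem_univ, true_and,
        Set.mem_ofPred_eq] at hx ⊢
      obtain ⟨⟨⟨hT, hgd⟩, hα⟩, heq⟩ := hx
      refine ⟨⟨hT, hgd.1.1⟩, hα, ⟨mem_rset.1 (hgd.2.1 α hα), ?_⟩, ?_⟩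
      · rw [heq]; exact hgd.1.1
      · rw [heq, app_add_rk, mem_perp.1 hα, zero_smul, add_zero]
    · rintro ⟨⟨T, w⟩, α⟩ _ ⟨⟨T', w'⟩, α'⟩ _ he
      simp only [Prod.mk.injEq] at he
      obtain ⟨rfl, rfl, rfl⟩ := he
      rfl
  have hsplit : (#Good * h : ℝ) ≤ (q : ℝ) ^ n * q ^ (m - 1) *
      (S * ((q : ℝ)⁻¹ + (1 - (q : ℝ)⁻¹) * (1 / 2))) + #Bad * h := by
    have h1 := Finset.card_filter_add_card_filter_not (s := A1)
      (fun x => k (x.1.1 + rk x.1.2 x.2) = k x.1.1)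
    rw [hcA1] at h1
    have h2 : (#Good * h : ℝ) = #{x ∈ A1 | k (x.1.1 + rk x.1.2 x.2) = k x.1.1} +
      #{x ∈ A1 | ¬ k (x.1.1 + rk x.1.2 x.2) = k x.1.1} := by exact_mod_cast h1.symm
    rw [h2]
    refine add_le_add hA2 ?_
    exact_mod_cast hA3
  have hGB' : (#Good : ℝ) + #Bad = S * (q : ℝ) ^ n := by exact_mod_cast hGB
  have hh' : (h : ℝ) = (q : ℝ) ^ (m - 1) := by simp [hh]
  rw [← hh'] at hsplit
  have hh0 : (0 : ℝ) < h := by rw [hh']; positivity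
  set X := (q : ℝ)⁻¹ + (1 - (q : ℝ)⁻¹) * (1 / 2) with hX
  have hXle : X ≤ 2 / 3 := by
    have h3 : (q : ℝ)⁻¹ ≤ 1 / 3 := by
      rw [inv_le_comm₀ hq0 (by norm_num)]
      norm_num
      exact_mod_cast hq
    rw [hX]; linarith
  have hqn : (0 : ℝ) < (q : ℝ) ^ n := by positivity
  have hfin : (#Good : ℝ) ≤ (q : ℝ) ^ n * (S * X) + #Bad := by
    refine le_of_mul_le_mul_right ?_ hh0
    linarith
  have hBadle : (#Bad : ℝ) * 6 < S * (q : ℝ) ^ n := by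
    have h5 : (q : ℝ) ^ 3 * (S : ℝ) ^ 2 / Fintype.card (Fin n → Fin m → F) * 6 < S := by
      rw [div_mul_eq_mul_div, div_lt_iff₀ hN0]
      nlinarith
    calc (#Bad : ℝ) * 6 ≤ (q : ℝ) ^ 3 * (S : ℝ) ^ 2 / Fintype.card (Fin n → Fin m → F) *
          (q : ℝ) ^ n * 6 := by gcongr
      _ = ((q : ℝ) ^ 3 * (S : ℝ) ^ 2 / Fintype.card (Fin n → Fin m → F) * 6) * (q : ℝ) ^ n := by ring
      _ < _ := by gcongr
  have : (q : ℝ) ^ n * (S * X) ≤ (q : ℝ) ^ n * (S * (2 / 3)) := by gcongr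
  linarith

end Localize

section Typical

variable {F : Type} [Field F] [Fintype F] {n m : ℕ} {ι : Type*}
open scoped Classical

/-- Along the direction `u` through `T`, each `Φ e` is constant on the `α` orthogonal to `a` and
vanishes elsewhere. -/
def ZoomLike (Φ : ι → (Fin n → Fin m → F) → F) (T : Fin n → Fin m → F) (u : Fin n → F)
    (a : Fin m → F) : Prop :=
  ∀ e α, Φ e (T + rk u α) = if α ⬝ᵥ a = 0 then Φ e T else 0

variable {Φ : ι → (Fin n → Fin m → F) → F}

theorem LineDeg.zoomLike (hΦ : LineDeg Φ) (hq : 3 ≤ Fintype.card F) {a : Fin m → F} (ha : a ≠ 0)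
    {T : Fin n → Fin m → F} {u : Fin n → F}
    (h : #{α ∈ rset Φ T u | α ⬝ᵥ a ≠ 0} * Fintype.card F ^ 2 < Fintype.card F ^ m) :
    ZoomLike Φ T u a := by
  intro e
  set G : (Fin m → F) → F := fun α => Φ e (T + rk u α) with hG
  change ∀ α, G α = _
  have hG0 : G 0 = Φ e T := by simp [hG, rk_zero]
  rw [← hG0]
  by_cases hz : ∀ α, G α = 0
  · intro α; simp [hz]
  push Not at hz
  obtain ⟨x₀, hx₀⟩ := hz
  have hcardG : #{α | G α ≠ 0} * Fintype.card F ^ 2 <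
      (Fintype.card F + 1) * Fintype.card F ^ m := by
    have h1 : #{α | G α ≠ 0} ≤ #{α ∈ rset Φ T u | α ⬝ᵥ a ≠ 0} +
        #({α | α ∈ perp a} : Finset (Fin m → F)) := by
      rw [add_comm]
      refine (Finset.card_le_card fun α hα => ?_).trans (Finset.card_union_le _ _)
      rw [Finset.mem_union, Finset.mem_filter, Finset.mem_filter, mem_perp]
      by_cases h0 : α ⬝ᵥ a = 0
      · exact Or.inl ⟨Finset.mem_univ _, h0⟩
      · exact Or.inr ⟨support_subset_rset e T u hα, h0⟩
    have h2 := card_perp_mul ha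
    rw [Fintype.card_subtype] at h2
    have h3 := Nat.mul_le_mul_right (Fintype.card F ^ 2) h1
    have h4 : #({α | α ∈ perp a} : Finset (Fin m → F)) * Fintype.card F ^ 2 =
        Fintype.card F * Fintype.card F ^ m := by
      rw [← h2]; ring
    nlinarith
  obtain ⟨a', ha', κ, c, hc, hind⟩ := (hΦ e T u).eq_indicator hq x₀ hx₀ hcardG
  change ∀ α, G α = _ at hind
  have hsupp : ∀ α, α ⬝ᵥ a' = κ → α ⬝ᵥ a = 0 := by
    intro α hα
    by_contra hαa
    have hdeg : fDegLE (fun α : Fin m → F => α ⬝ᵥ a) (Fintype.card F - 1) := by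
      have h1 := fDegLE_affine (m := m) (0 : F) ((dotProductBilin F F).flip a)
      refine fDegLE.mono (d := 1) ?_ (by omega)
      simpa using h1
    have h1 := hdeg.card_support_coset_ge (perp a') α α (by simp) hαa
    have h2 : #{x | x ⬝ᵥ a ≠ 0 ∧ x - α ∈ perp a'} ≤ #{α ∈ rset Φ T u | α ⬝ᵥ a ≠ 0} := by
      refine Finset.card_le_card fun x hx => ?_
      simp only [Finset.mem_filter, Finset.mem_univ, true_and] at hx ⊢
      refine ⟨support_subset_rset e T u ?_, hx.1⟩
      simp only [Finset.mem_filter, Finset.mem_univ, true_and]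
      have h3 : x ⬝ᵥ a' = κ := by
        have := mem_perp.1 hx.2
        rwa [sub_dotProduct, hα, sub_eq_zero] at this
      change G x ≠ 0
      rw [hind x, if_pos h3]
      exact hc
    rw [Nat.card_eq_fintype_card] at h1
    have h3 := card_perp_mul ha'
    have h4 := h1.trans (Nat.mul_le_mul_left _ h2)
    have h5 := Nat.mul_le_mul_right (Fintype.card F) h4
    rw [h3] at h5
    nlinarith
  have hx₀' : x₀ ⬝ᵥ a' = κ := by
    by_contra h0
    exact hx₀ (by rw [hind, if_neg h0])
  have hle : perp a' ≤ perp a := by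
    intro β hβ
    have h1 := hsupp (x₀ + β) (by rw [add_dotProduct, mem_perp.1 hβ, add_zero, hx₀'])
    rwa [add_dotProduct, hsupp x₀ hx₀', zero_add] at h1
  have heq : perp a' = perp a := by
    refine SetLike.coe_injective (Set.eq_of_subset_of_ncard_le hle ?_ (Set.toFinite _))
    refine le_of_eq ?_
    change Nat.card (perp a) = Nat.card (perp a')
    rw [Nat.card_eq_fintype_card, Nat.card_eq_fintype_card, card_perp ha, card_perp ha']
  have hκ : κ = 0 := by
    rw [← hx₀', ← mem_perp, heq, mem_perp]
    exact hsupp x₀ hx₀'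
  intro α
  rw [hind α, hind 0, hκ, zero_dotProduct, if_pos rfl]
  refine if_congr ?_ rfl rfl
  rw [← mem_perp, ← mem_perp, heq]

/-- At most zoom-in points and directions, the `Φ e` are `ZoomLike`. -/
theorem LineDeg.card_not_zoomLike (hΦ : LineDeg Φ) (hq : 3 ≤ Fintype.card F) {a : Fin m → F}
    (ha : a ≠ 0) (b : Fin n → F) :
    #{x : (Fin n → Fin m → F) × (Fin n → F) | x.1 ∈ zoom a b ∧ ¬ ZoomLike Φ x.1 x.2 a} ≤
      Fintype.card F ^ 2 * #(rej Φ) := by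
  set q := Fintype.card F with hqdef
  set B : Finset ((Fin n → Fin m → F) × (Fin n → F)) :=
    {x | x.1 ∈ zoom a b ∧ ¬ ZoomLike Φ x.1 x.2 a} with hB
  have hqm : 0 < q ^ m := pow_pos Fintype.card_pos _
  refine Nat.le_of_mul_le_mul_right ?_ hqm
  have h1 : ∀ x ∈ B, q ^ m ≤ #{α ∈ rset Φ x.1 x.2 | α ⬝ᵥ a ≠ 0} * q ^ 2 := by
    intro x hx
    by_contra hlt
    exact (Finset.mem_filter.1 hx).2.2 (hΦ.zoomLike hq ha (not_le.1 hlt))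
  have h2 : ∑ x ∈ B, #{α ∈ rset Φ x.1 x.2 | α ⬝ᵥ a ≠ 0} =
      ∑ α, #{x ∈ B | α ∈ rset Φ x.1 x.2 ∧ α ⬝ᵥ a ≠ 0} := by
    refine Eq.trans ?_ (Finset.sum_card_bipartiteAbove_eq_sum_card_bipartiteBelow
      (fun (x : (Fin n → Fin m → F) × (Fin n → F)) (α : Fin m → F) =>
        α ∈ rset Φ x.1 x.2 ∧ α ⬝ᵥ a ≠ 0))
    refine Finset.sum_congr rfl fun x _ => congrArg _ ?_
    ext α
    simp [Finset.bipartiteAbove]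
  have h3 : ∀ α : Fin m → F, #{x ∈ B | α ∈ rset Φ x.1 x.2 ∧ α ⬝ᵥ a ≠ 0} ≤ #(rej Φ) := by
    intro α
    refine Finset.card_le_card_of_injOn (fun x => x.1 + rk x.2 α) ?_ ?_
    · intro x hx
      exact mem_rset.1 (Finset.mem_filter.1 hx).2.1
    · rintro ⟨T, u⟩ hx ⟨T', u'⟩ hx' he
      obtain ⟨hB1, -, hα⟩ := Finset.mem_filter.1 hx
      obtain ⟨hB2, -, -⟩ := Finset.mem_filter.1 hx'
      have e1 := mem_zoom.1 (Finset.mem_filter.1 hB1).2.1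
      have e2 := mem_zoom.1 (Finset.mem_filter.1 hB2).2.1
      simp only at he e1 e2
      have e3 := congrArg (fun T => app T a) he
      simp only [app_add_rk, e1, e2, add_right_inj] at e3
      have hu : u = u' := smul_right_injective _ hα e3
      subst hu
      rw [add_left_inj] at he
      rw [he]
  calc #B * q ^ m = ∑ x ∈ B, q ^ m := by rw [Finset.sum_const, smul_eq_mul]
    _ ≤ ∑ x ∈ B, #{α ∈ rset Φ x.1 x.2 | α ⬝ᵥ a ≠ 0} * q ^ 2 := Finset.sum_le_sum h1
    _ = (∑ α, #{x ∈ B | α ∈ rset Φ x.1 x.2 ∧ α ⬝ᵥ a ≠ 0}) * q ^ 2 := by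
        rw [← Finset.sum_mul, h2]
    _ ≤ (∑ α : Fin m → F, #(rej Φ)) * q ^ 2 :=
        Nat.mul_le_mul_right _ (Finset.sum_le_sum fun α _ => h3 α)
    _ = q ^ 2 * #(rej Φ) * q ^ m := by
        rw [Finset.sum_const, Finset.card_univ, Fintype.card_fun, Fintype.card_fin, smul_eq_mul]
        ring

/-- Along the direction `u` through `T`, each `Φ e` is `c e` on the `α` orthogonal to `a` and
vanishes elsewhere. -/
def Typ (Φ : ι → (Fin n → Fin m → F) → F) (c : ι → F) (T : Fin n → Fin m → F) (u : Fin n → F)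
    (a : Fin m → F) : Prop :=
  ∀ e α, Φ e (T + rk u α) = if α ⬝ᵥ a = 0 then c e else 0

theorem Typ.apply {F : Type} [Field F] {n m : ℕ} {ι : Type*}
    {Φ : ι → (Fin n → Fin m → F) → F} {c : ι → F} {T : Fin n → Fin m → F} {u : Fin n → F} {a : Fin m → F}
    (h : Typ Φ c T u a) (e : ι) : Φ e T = c e := by
  have := h e 0
  rwa [rk_zero, add_zero, zero_dotProduct, if_pos rfl] at this

/-- The functions `Φ e` are almost constant on every zoom-in. -/
theorem LineDeg.exists_typ (hΦ : LineDeg Φ) (hq : 3 ≤ Fintype.card F) {a : Fin m → F}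
    (ha : a ≠ 0) (b : Fin n → F) :
    ∃ c : ι → F, #{x : (Fin n → Fin m → F) × (Fin n → F) | x.1 ∈ zoom a b ∧
      ¬ Typ Φ c x.1 x.2 a} ≤ 3 * Fintype.card F ^ 2 * #(rej Φ) := by
  set q := Fintype.card F with hqdef
  have hq0 : (0 : ℝ) < q := by exact_mod_cast Fintype.card_pos
  have hzl := hΦ.card_not_zoomLike hq ha b
  rw [← hqdef] at hzl
  set B : Finset ((Fin n → Fin m → F) × (Fin n → F)) :=
    {x | x.1 ∈ zoom a b ∧ ¬ ZoomLike Φ x.1 x.2 a} with hB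
  let idx : (Fin n → Fin m → F) → (ι → F) := fun T e => Φ e T
  obtain ⟨T₁, hT₁⟩ := exists_app_eq ha b
  obtain ⟨T₀, hT₀, hmax⟩ := Finset.exists_max_image (zoom a b)
    (fun T => #{T' ∈ zoom a b | idx T' = idx T}) ⟨T₁, mem_zoom.2 hT₁⟩
  set Z := #(zoom a b) with hZ
  have hZ0 : (0 : ℝ) < Z := by exact_mod_cast Finset.card_pos.2 ⟨T₀, hT₀⟩
  set K := #{T' ∈ zoom a b | idx T' = idx T₀} with hK
  have hcls := card_class_step_le (F := F) (zoom a b) idx (fun _ => a) (fun _ => b)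
    (fun _ _ => ha) (fun T hT => mem_zoom.1 hT) (K / Z) (by
      intro T hT
      rw [div_mul_cancel₀ _ hZ0.ne']
      exact_mod_cast hmax T hT)
  have hN : Z * q ^ n = Fintype.card (Fin n → Fin m → F) := card_zoom_mul ha b
  have hcardperp : #({α | α ∈ perp a} : Finset (Fin m → F)) = q ^ (m - 1) := by
    rw [← Fintype.card_subtype, hqdef, ← card_perp ha]
  set Gd : Finset ((Fin n → Fin m → F) × (Fin n → F)) :=
    {x | x.1 ∈ zoom a b ∧ ZoomLike Φ x.1 x.2 a} with hGd
  have hGB : #Gd + #B = Z * q ^ n := by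
    have h1 := card_filter_fst_mem (β := Fin n → F) (zoom a b) (fun T w => ZoomLike Φ T w a)
      (hr := inferInstance)
    have h2 := card_filter_fst_mem (β := Fin n → F) (zoom a b) (fun T w => ¬ ZoomLike Φ T w a)
      (hr := inferInstance)
    rw [hGd, hB, h1, h2, ← Finset.sum_add_distrib]
    simp_rw [Finset.card_filter_add_card_filter_not]
    rw [Finset.sum_const, Finset.card_univ, Fintype.card_fun, Fintype.card_fin, smul_eq_mul]
  have hlow : (#Gd : ℝ) * (q : ℝ) ^ (m - 1) ≤ ∑ T ∈ zoom a b,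
      (#{ω : (Fin n → F) × (Fin m → F) | ω.2 ∈ perp a ∧
        T + rk ω.1 ω.2 ∈ zoom a b ∧ idx (T + rk ω.1 ω.2) = idx T} : ℝ) := by
    norm_cast
    refine le_trans ?_ (card_filter_fst_mem (zoom a b) _).le
    rw [← hcardperp, ← Finset.card_product]
    refine Finset.card_le_card_of_injOn (fun x => (x.1.1, (x.1.2, x.2))) ?_ ?_
    · rintro ⟨⟨T, u⟩, α⟩ hx
      simp only [hGd, Finset.coe_product, Finset.coe_filter, Finset.mem_univ, true_and,
        Set.mem_prod, Set.mem_ofPred_eq] at hx ⊢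
      obtain ⟨⟨hT, hzl⟩, hα⟩ := hx
      refine ⟨hT, hα, ?_, ?_⟩
      · rw [mem_zoom] at hT ⊢
        rw [app_add_rk, mem_perp.1 hα, zero_smul, add_zero, hT]
      · funext e
        exact (hzl e α).trans (if_pos hα)
    · rintro ⟨⟨T, w⟩, α⟩ _ ⟨⟨T', w'⟩, α'⟩ _ he
      simp only [Prod.mk.injEq] at he
      obtain ⟨rfl, rfl, rfl⟩ := he
      rfl
  have hmain := hlow.trans hcls
  have hKZ : (K : ℝ) ≤ Z := by exact_mod_cast Finset.card_filter_le _ _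
  have hstep : (Z - K : ℝ) * (q : ℝ) ^ n ≤ 2 * (q : ℝ) ^ 2 * #(rej Φ) := by
    have hGB' : (#Gd : ℝ) + #B = Z * (q : ℝ) ^ n := by exact_mod_cast hGB
    have hzl' : (#B : ℝ) ≤ (q : ℝ) ^ 2 * #(rej Φ) := by exact_mod_cast hzl
    have hqm : (0 : ℝ) < (q : ℝ) ^ (m - 1) := by positivity
    have h1 : (#Gd : ℝ) ≤ (q : ℝ) ^ n * (Z * ((q : ℝ)⁻¹ + (1 - (q : ℝ)⁻¹) * (K / Z))) := by
      refine le_of_mul_le_mul_right ?_ hqm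
      refine hmain.trans (le_of_eq ?_)
      ring
    have h2 : (q : ℝ) ^ n * (Z * ((q : ℝ)⁻¹ + (1 - (q : ℝ)⁻¹) * (K / Z))) =
        (q : ℝ) ^ n * (Z * (q : ℝ)⁻¹ + (1 - (q : ℝ)⁻¹) * K) := by
      field_simp
    rw [h2] at h1
    have h3 : (Z - K : ℝ) * (q : ℝ) ^ n * (1 - (q : ℝ)⁻¹) ≤ (q : ℝ) ^ 2 * #(rej Φ) := by
      linarith
    have h4 : (q : ℝ)⁻¹ ≤ 1 / 2 := by
      rw [inv_le_comm₀ hq0 (by norm_num)]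
      norm_num
      exact_mod_cast (by omega : 2 ≤ q)
    have h5 : 0 ≤ (Z - K : ℝ) * (q : ℝ) ^ n := mul_nonneg (by linarith) (by positivity)
    nlinarith
  refine ⟨idx T₀, ?_⟩
  have hsub : #{x : (Fin n → Fin m → F) × (Fin n → F) | x.1 ∈ zoom a b ∧
      ¬ Typ Φ (idx T₀) x.1 x.2 a} ≤ #B + (Z - K) * q ^ n := by
    have hsd : Z - K = #{T' ∈ zoom a b | ¬ idx T' = idx T₀} := by
      have := Finset.card_filter_add_card_filter_not (s := zoom a b) (fun T' => idx T' = idx T₀)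
      omega
    have hprod : (Z - K) * q ^ n =
        #({T' ∈ zoom a b | ¬ idx T' = idx T₀} ×ˢ (univ : Finset (Fin n → F))) := by
      rw [Finset.card_product, hsd, Finset.card_univ, Fintype.card_fun, Fintype.card_fin]
    rw [hprod]
    refine (Finset.card_le_card ?_).trans (Finset.card_union_le _ _)
    rintro ⟨T, u⟩ hx
    simp only [hB, Finset.mem_filter, Finset.mem_univ, true_and, Finset.mem_union,
      Finset.mem_product, and_true] at hx ⊢
    by_cases hz : ZoomLike Φ T u a
    · refine Or.inr ⟨hx.1, fun hi => hx.2 fun e α => ?_⟩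
      rw [← hi]
      exact hz e α
    · exact Or.inl ⟨hx.1, hz⟩
  have hKZ' : K ≤ Z := Finset.card_filter_le _ _
  have hstep' : (Z - K) * q ^ n ≤ 2 * q ^ 2 * #(rej Φ) := by
    rw [← Nat.cast_le (α := ℝ)]
    push_cast [hKZ']
    exact hstep
  calc _ ≤ _ := hsub
    _ ≤ q ^ 2 * #(rej Φ) + 2 * q ^ 2 * #(rej Φ) := add_le_add hzl hstep'
    _ = _ := by ring

end Typical

section Pull

variable {F : Type} [Field F] {n m : ℕ}

/-- The matrix of `x ↦ T (g x)`. -/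
def pull (T : Fin n → Fin m → F) (g : (Fin m → F) ≃ₗ[F] (Fin m → F)) : Fin n → Fin m → F :=
  fun i j => T i ⬝ᵥ g (Pi.single j 1)

theorem app_pull (T : Fin n → Fin m → F) (g : (Fin m → F) ≃ₗ[F] (Fin m → F)) (x : Fin m → F) :
    app (pull T g) x = app T (g x) := by
  ext i
  have h1 : g x = ∑ j, x j • g (Pi.single j 1) := by
    conv_lhs => rw [pi_eq_sum_univ' x]
    rw [map_sum]
    refine Finset.sum_congr rfl fun j _ => ?_
    rw [map_smul]
  simp only [app, h1, dotProduct_sum, dotProduct_smul, smul_eq_mul]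
  rw [dotProduct]
  exact Finset.sum_congr rfl fun j _ => mul_comm _ _

theorem app_injective {T T' : Fin n → Fin m → F} (h : ∀ x, app T x = app T' x) : T = T' := by
  ext i j
  have := congrFun (h (Pi.single j 1)) i
  simpa [app] using this

theorem pull_injective (g : (Fin m → F) ≃ₗ[F] (Fin m → F)) :
    Function.Injective fun T : Fin n → Fin m → F => pull T g := by
  intro T T' h
  refine app_injective fun x => ?_
  have := congrArg (fun S => app S (g.symm x)) h
  simpa only [app_pull, LinearEquiv.apply_symm_apply] using this

variable [Fintype F] {ι : Type*} {Φ : ι → (Fin n → Fin m → F) → F}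
open scoped Classical

/-- A map in a zoom-in that is typical after several linear changes of variables. -/
theorem exists_generic {c : (Fin m → F) → (Fin n → F) → ι → F} {N : ℕ}
    (hc : ∀ a, a ≠ 0 → ∀ b, #{x : (Fin n → Fin m → F) × (Fin n → F) | x.1 ∈ zoom a b ∧
      ¬ Typ Φ (c a b) x.1 x.2 a} ≤ N)
    {J : Type*} [Fintype J] (g : J → (Fin m → F) ≃ₗ[F] (Fin m → F)) {a : Fin m → F} (ha : a ≠ 0)
    (b : Fin n → F) (hN : Fintype.card J * N < Fintype.card (Fin n → Fin m → F)) :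
    ∃ (T : Fin n → Fin m → F) (u : Fin n → F), ∀ j,
      Typ Φ (c ((g j).symm a) b) (pull T (g j)) u ((g j).symm a) := by
  by_contra! hcon
  have h1 : zoom a b ×ˢ (univ : Finset (Fin n → F)) ⊆ univ.biUnion fun j =>
      {x | x.1 ∈ zoom a b ∧ ¬ Typ Φ (c ((g j).symm a) b) (pull x.1 (g j)) x.2 ((g j).symm a)} := by
    rintro ⟨T, u⟩ hx
    obtain ⟨j, hj⟩ := hcon T u
    simp only [Finset.mem_biUnion, Finset.mem_univ, true_and, Finset.mem_filter]
    exact ⟨j, (Finset.mem_product.1 hx).1, hj⟩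
  have h2 := (Finset.card_le_card h1).trans Finset.card_biUnion_le
  rw [Finset.card_product, Finset.card_univ, Fintype.card_fun, Fintype.card_fin,
    card_zoom_mul ha] at h2
  refine absurd h2 (not_le.2 (lt_of_le_of_lt ?_ hN))
  rw [← Finset.card_univ (α := J), ← smul_eq_mul, ← Finset.sum_const]
  refine Finset.sum_le_sum fun j _ => le_trans ?_
    (hc ((g j).symm a) (by simpa using ha) b)
  refine Finset.card_le_card_of_injOn (fun x => (pull x.1 (g j), x.2)) ?_ ?_
  · intro x hx
    simp only [Finset.coe_filter, Finset.mem_univ, true_and, Set.mem_ofPred_eq] at hx ⊢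
    refine ⟨?_, hx.2⟩
    rw [mem_zoom, app_pull, LinearEquiv.apply_symm_apply, ← mem_zoom]
    exact hx.1
  · rintro ⟨T, u⟩ _ ⟨T', u'⟩ _ he
    simp only [Prod.mk.injEq] at he
    rw [pull_injective _ he.1, he.2]

theorem exists_mem_zoom_rej_of_dense {c : ι → F} {N : ℕ} {a : Fin m → F} (ha : a ≠ 0)
    {b : Fin n → F}
    (hc : #{x : (Fin n → Fin m → F) × (Fin n → F) | x.1 ∈ zoom a b ∧ ¬ Typ Φ c x.1 x.2 a} ≤ N)
    (hN : 2 * N < Fintype.card (Fin n → Fin m → F)) (hd : #(zoom a b) ≤ 2 * #(rej Φ ∩ zoom a b)) :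
    ∃ e, c e ≠ 0 := by
  by_contra! hcon
  have h1 : #((rej Φ ∩ zoom a b) ×ˢ (univ : Finset (Fin n → F))) ≤ N := by
    refine (Finset.card_le_card ?_).trans hc
    rintro ⟨T, u⟩ hx
    simp only [Finset.mem_product, Finset.mem_inter, Finset.mem_filter, Finset.mem_univ, true_and,
      and_true] at hx ⊢
    refine ⟨hx.2, fun ht => ?_⟩
    obtain ⟨e, he⟩ := mem_rej.1 hx.1
    exact he ((ht.apply e).trans (hcon e))
  rw [Finset.card_product, Finset.card_univ, Fintype.card_fun, Fintype.card_fin] at h1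
  have h2 := card_zoom_mul ha b
  have h3 := Nat.mul_le_mul_right (Fintype.card F ^ n) hd
  rw [h2] at h3
  nlinarith

theorem card_zoom_sdiff_rej_le {c : ι → F} {N : ℕ} {a : Fin m → F} {b : Fin n → F}
    (hc : #{x : (Fin n → Fin m → F) × (Fin n → F) | x.1 ∈ zoom a b ∧ ¬ Typ Φ c x.1 x.2 a} ≤ N)
    {e : ι} (he : c e ≠ 0) : #(zoom a b \ rej Φ) * Fintype.card F ^ n ≤ N := by
  refine le_trans ?_ hc
  have h1 : #(zoom a b \ rej Φ) * Fintype.card F ^ n =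
      #((zoom a b \ rej Φ) ×ˢ (univ : Finset (Fin n → F))) := by
    rw [Finset.card_product, Finset.card_univ, Fintype.card_fun, Fintype.card_fin]
  rw [h1]
  refine Finset.card_le_card ?_
  rintro ⟨T, u⟩ hx
  simp only [Finset.mem_product, Finset.mem_sdiff, Finset.mem_filter, Finset.mem_univ, true_and,
    and_true] at hx ⊢
  exact ⟨hx.1, fun ht => hx.2 (mem_rej.2 ⟨e, by rwa [ht.apply e]⟩)⟩

end Pull

section Degree

variable {F : Type} [Field F] {m : ℕ}
open MvPolynomial

theorem fDegLE_sum {ι : Type*} (s : Finset ι) {g : ι → (Fin m → F) → F} {d : ℕ}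
    (h : ∀ i ∈ s, fDegLE (g i) d) : fDegLE (fun x => ∑ i ∈ s, g i x) d := by
  classical
  induction s using Finset.induction_on with
  | empty => exact ⟨0, by simp, by simp⟩
  | insert a s ha ih =>
    obtain ⟨Q, hQ, hQ'⟩ := ih fun i hi => h i (Finset.mem_insert_of_mem hi)
    obtain ⟨R, hR, hR'⟩ := h a (Finset.mem_insert_self _ _)
    refine ⟨R + Q, (totalDegree_add _ _).trans (max_le hR hQ), fun x => ?_⟩
    simp only [map_add, hR', hQ', Finset.sum_insert ha]

theorem fDegLE.const_mul {g : (Fin m → F) → F} {d : ℕ} (h : fDegLE g d) (c : F) :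
    fDegLE (fun x => c * g x) d := by
  obtain ⟨Q, hQ, hQ'⟩ := h
  refine ⟨C c * Q, (totalDegree_mul _ _).trans (by simpa using hQ), fun x => ?_⟩
  rw [map_mul, eval_C, hQ']

theorem fDegLE.one_sub_pow {g : (Fin m → F) → F} (h : fDegLE g 1) (k : ℕ) :
    fDegLE (fun x => 1 - g x ^ k) k := by
  obtain ⟨Q, hQ, hQ'⟩ := h
  refine ⟨1 - Q ^ k, (totalDegree_sub _ _).trans (max_le (by simp) ?_), fun x => ?_⟩
  · refine (totalDegree_pow _ _).trans ?_
    simpa using Nat.mul_le_mul_left k hQ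
  · simp [hQ']

end Degree

section Test

variable {F : Type} [Field F] [Fintype F] {n ℓ : ℕ} {ι : Type*}

theorem one_sub_pow_card_sub_one [DecidableEq F] (x : F) :
    1 - x ^ (Fintype.card F - 1) = if x = 0 then 1 else 0 := by
  have : Fintype.card F - 1 ≠ 0 := by
    have := Fintype.one_lt_card (α := F)
    omega
  split_ifs with h
  · simp [h, this]
  · rw [FiniteField.pow_card_sub_one_eq_one x h, sub_self]

theorem pow_card_sub_one_eq_ite [DecidableEq F] (x : F) :
    x ^ (Fintype.card F - 1) = if x = 0 then 0 else 1 := by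
  have := one_sub_pow_card_sub_one x
  split_ifs at this ⊢ with h <;> linear_combination - this

/-- The inner product of `x ↦ f (T (1, x))` with `H e`. -/
def tst (f : (Fin n → F) → F) (H : ι → (Fin ℓ → F) → F) (e : ι) (T : Fin n → Fin (ℓ + 1) → F) : F :=
  ∑ x : Fin ℓ → F, f (app T (Fin.cons 1 x)) * H e x

/-- The sum of `f` along the line in direction `u` through `T (1, x)`. -/
def lineSum (f : (Fin n → F) → F) (T : Fin n → Fin (ℓ + 1) → F) (u : Fin n → F) (x : Fin ℓ → F) : F :=
  ∑ z : F, f (app T (Fin.cons 1 x) + z • u)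

variable {f : (Fin n → F) → F} {H : ι → (Fin ℓ → F) → F}

theorem lineDeg_tst : LineDeg (tst f H) := by
  classical
  intro e T u
  have h : ∀ α : Fin (ℓ + 1) → F, tst f H e (T + rk u α) =
      ∑ x : Fin ℓ → F, ∑ z : F, (f (app T (Fin.cons 1 x) + z • u) * H e x) *
        (1 - (-z + α ⬝ᵥ Fin.cons 1 x) ^ (Fintype.card F - 1)) := by
    intro α
    refine Finset.sum_congr rfl fun x _ => ?_
    simp only [one_sub_pow_card_sub_one]
    rw [Finset.sum_eq_single (α ⬝ᵥ Fin.cons 1 x)]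
    · simp [app_add_rk]
    · intro z _ hz
      rw [if_neg, mul_zero]
      intro h0
      exact hz (neg_add_eq_zero.1 h0)
    · simp
  simp only [h]
  refine fDegLE_sum _ fun x _ => fDegLE_sum _ fun z _ => fDegLE.const_mul ?_ _
  refine fDegLE.one_sub_pow (g := fun α : Fin (ℓ + 1) → F => -z + α ⬝ᵥ Fin.cons 1 x) ?_ _
  exact fDegLE_affine (-z) ((dotProductBilin F F).flip (Fin.cons 1 x))

theorem Typ.lineSum {c : ι → F} {T : Fin n → Fin (ℓ + 1) → F} {u : Fin n → F}
    {a : Fin (ℓ + 1) → F} (h : Typ (tst f H) c T u a) (e : ι) (α : Fin (ℓ + 1) → F) :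
    ∑ x, lineSum f T u x * (H e x * (α ⬝ᵥ Fin.cons 1 x) ^ (Fintype.card F - 1)) =
      c e * (α ⬝ᵥ a) ^ (Fintype.card F - 1) := by
  classical
  have h1 : ∑ κ : F, tst f H e (T + rk u (κ • α)) =
      ∑ x, _root_.lineSum f T u x * (H e x * (α ⬝ᵥ Fin.cons 1 x) ^ (Fintype.card F - 1)) := by
    simp only [tst]
    rw [Finset.sum_comm]
    refine Finset.sum_congr rfl fun x _ => ?_
    simp only [app_add_rk, smul_dotProduct, smul_eq_mul]
    rw [pow_card_sub_one_eq_ite, ← Finset.sum_mul]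
    split_ifs with h0
    · simp [h0]
    · rw [mul_one]
      congr 1
      exact Fintype.sum_equiv (Equiv.mulRight₀ _ h0) _ _ fun z => rfl
  rw [← h1]
  simp only [h e, smul_dotProduct, smul_eq_mul]
  rw [pow_card_sub_one_eq_ite]
  by_cases h0 : α ⬝ᵥ a = 0
  · simp [h0]
  · simp [h0]

theorem cons_tail_of_fix {F : Type} [Field F] {ℓ : ℕ}
    {g : (Fin (ℓ + 1) → F) ≃ₗ[F] (Fin (ℓ + 1) → F)} (hg : ∀ y, g y 0 = y 0)
    (x : Fin ℓ → F) : (Fin.cons 1 (Fin.tail (g (Fin.cons 1 x))) : Fin (ℓ + 1) → F) =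
      g (Fin.cons 1 x) := by
  have h : g (Fin.cons 1 x) 0 = 1 := by rw [hg]; rfl
  conv_rhs => rw [← Fin.cons_self_tail (g (Fin.cons 1 x)), h]

theorem sum_comp_fix {g : (Fin (ℓ + 1) → F) ≃ₗ[F] (Fin (ℓ + 1) → F)} (hg : ∀ y, g y 0 = y 0)
    (K : (Fin (ℓ + 1) → F) → F) :
    ∑ x : Fin ℓ → F, K (g (Fin.cons 1 x)) = ∑ x : Fin ℓ → F, K (Fin.cons 1 x) := by
  have hb : Function.Bijective fun x : Fin ℓ → F => Fin.tail (g (Fin.cons 1 x)) := by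
    refine Finite.injective_iff_bijective.1 fun x x' h => ?_
    have h1 : g (Fin.cons 1 x) = g (Fin.cons 1 x') := by
      rw [← cons_tail_of_fix hg x, ← cons_tail_of_fix hg x']
      exact congrArg (Fin.cons 1) h
    exact Fin.cons_right_injective _ (g.injective h1)
  rw [← hb.sum_comp (fun x => K (Fin.cons 1 x))]
  simp only [cons_tail_of_fix hg]

theorem tst_pull {g : (Fin (ℓ + 1) → F) ≃ₗ[F] (Fin (ℓ + 1) → F)} (hg : ∀ y, g y 0 = y 0) (e : ι)
    (T : Fin n → Fin (ℓ + 1) → F) :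
    tst f H e (pull T g) = ∑ x : Fin ℓ → F, f (app T (Fin.cons 1 x)) *
      H e (Fin.tail (g.symm (Fin.cons 1 x))) := by
  rw [← sum_comp_fix hg (fun y => f (app T y) * H e (Fin.tail (g.symm y)))]
  simp only [tst, app_pull, LinearEquiv.symm_apply_apply, Fin.tail_cons]

theorem sum_lineSum_pull {g : (Fin (ℓ + 1) → F) ≃ₗ[F] (Fin (ℓ + 1) → F)} (hg : ∀ y, g y 0 = y 0)
    (T : Fin n → Fin (ℓ + 1) → F) (u : Fin n → F) (K : (Fin (ℓ + 1) → F) → F) :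
    ∑ x, lineSum f (pull T g) u x * K (Fin.cons 1 x) =
      ∑ x, lineSum f T u x * K (g.symm (Fin.cons 1 x)) := by
  unfold lineSum
  rw [← sum_comp_fix hg (fun y => (∑ z : F, f (app T y + z • u)) * K (g.symm y))]
  simp only [app_pull, LinearEquiv.symm_apply_apply]

open scoped Classical

variable {c : (Fin (ℓ + 1) → F) → (Fin n → F) → ι → F} {N : ℕ}

/-- Linear relations between transforms of the `H e` are inherited by the typical values. -/
theorem typical_relation
    (hc : ∀ a, a ≠ 0 → ∀ b, #{x : (Fin n → Fin (ℓ + 1) → F) × (Fin n → F) | x.1 ∈ zoom a b ∧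
      ¬ Typ (tst f H) (c a b) x.1 x.2 a} ≤ N)
    {G : Type*} [Fintype G] (g : G → (Fin (ℓ + 1) → F) ≃ₗ[F] (Fin (ℓ + 1) → F))
    (hg : ∀ i y, g i y 0 = y 0)
    (hN : Fintype.card G * N < Fintype.card (Fin n → Fin (ℓ + 1) → F))
    {J : Type*} [Fintype J] (π : J → G) (w : J → F) (e : J → ι)
    (hrel : ∀ x : Fin ℓ → F,
      ∑ j, w j * H (e j) (Fin.tail ((g (π j)).symm (Fin.cons 1 x))) = 0)
    {a : Fin (ℓ + 1) → F} (ha : a ≠ 0) (b : Fin n → F) :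
    ∑ j, w j * c ((g (π j)).symm a) b (e j) = 0 := by
  obtain ⟨T, u, hT⟩ := exists_generic hc g ha b hN
  simp only [← (hT _).apply, tst_pull (hg _), Finset.mul_sum]
  rw [Finset.sum_comm]
  refine Finset.sum_eq_zero fun x _ => ?_
  rw [← mul_zero (f (app T (Fin.cons 1 x))), ← hrel x, Finset.mul_sum]
  exact Finset.sum_congr rfl fun j _ => by ring

/-- Linear relations between transforms of products of the `H e` with indicator functions of
hyperplane complements are inherited by the typical values. -/
theorem typical_relation_pow
    (hc : ∀ a, a ≠ 0 → ∀ b, #{x : (Fin n → Fin (ℓ + 1) → F) × (Fin n → F) | x.1 ∈ zoom a b ∧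
      ¬ Typ (tst f H) (c a b) x.1 x.2 a} ≤ N)
    {G : Type*} [Fintype G] (g : G → (Fin (ℓ + 1) → F) ≃ₗ[F] (Fin (ℓ + 1) → F))
    (hg : ∀ i y, g i y 0 = y 0)
    (hN : Fintype.card G * N < Fintype.card (Fin n → Fin (ℓ + 1) → F))
    {J : Type*} [Fintype J] (π : J → G) (w : J → F) (e : J → ι) (α : J → Fin (ℓ + 1) → F)
    (hrel : ∀ x : Fin ℓ → F,
      ∑ j, w j * (H (e j) (Fin.tail ((g (π j)).symm (Fin.cons 1 x))) *
        (α j ⬝ᵥ (g (π j)).symm (Fin.cons 1 x)) ^ (Fintype.card F - 1)) = 0)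
    {a : Fin (ℓ + 1) → F} (ha : a ≠ 0) (b : Fin n → F) :
    ∑ j, w j * (c ((g (π j)).symm a) b (e j) *
      (α j ⬝ᵥ (g (π j)).symm a) ^ (Fintype.card F - 1)) = 0 := by
  obtain ⟨T, u, hT⟩ := exists_generic hc g ha b hN
  have h1 : ∀ j, c ((g (π j)).symm a) b (e j) *
      (α j ⬝ᵥ (g (π j)).symm a) ^ (Fintype.card F - 1) = ∑ x, lineSum f T u x *
        (H (e j) (Fin.tail ((g (π j)).symm (Fin.cons 1 x))) *
        (α j ⬝ᵥ (g (π j)).symm (Fin.cons 1 x)) ^ (Fintype.card F - 1)) := by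
    intro j
    rw [← (hT (π j)).lineSum (e j) (α j)]
    exact sum_lineSum_pull (hg _) T u (fun y => H (e j) (Fin.tail y) *
      (α j ⬝ᵥ y) ^ (Fintype.card F - 1))
  simp only [h1, Finset.mul_sum]
  rw [Finset.sum_comm]
  refine Finset.sum_eq_zero fun x _ => ?_
  rw [← mul_zero (lineSum f T u x), ← hrel x, Finset.mul_sum]
  exact Finset.sum_congr rfl fun j _ => by ring

end Test

section Equivs

variable {F : Type} [Field F] {m : ℕ}

/-- Coordinatewise scaling. -/
def diagEquiv (w : Fin m → Fˣ) : (Fin m → F) ≃ₗ[F] (Fin m → F) where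
  toFun y i := w i * y i
  invFun y i := ↑(w i)⁻¹ * y i
  map_add' y z := by ext i; simp [mul_add]
  map_smul' k y := by ext i; simp [mul_left_comm]
  left_inv y := by ext i; simp
  right_inv y := by ext i; simp

theorem diagEquiv_apply (w : Fin m → Fˣ) (y : Fin m → F) (i : Fin m) :
    diagEquiv w y i = w i * y i := rfl

/-- The shear adding `τ` times the coordinate `k` to the coordinate `j`. -/
def shearEquiv {j k : Fin m} (h : j ≠ k) (τ : F) : (Fin m → F) ≃ₗ[F] (Fin m → F) where
  toFun y := y + Pi.single j (τ * y k)
  invFun y := y - Pi.single j (τ * y k)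
  map_add' y z := by
    simp only [Pi.add_apply, mul_add, Pi.single_add]
    abel
  map_smul' c y := by
    ext i
    by_cases hi : i = j
    · subst hi
      simp [mul_add, mul_left_comm]
    · simp [hi]
  left_inv y := by simp [h.symm]
  right_inv y := by simp [h.symm]

theorem shearEquiv_apply {j k : Fin m} (h : j ≠ k) (τ : F) (y : Fin m → F) :
    shearEquiv h τ y = y + Pi.single j (τ * y k) := rfl

theorem shearEquiv_apply_same {j k : Fin m} (h : j ≠ k) (τ : F) (y : Fin m → F) :
    shearEquiv h τ y j = y j + τ * y k := by simp [shearEquiv_apply]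

theorem shearEquiv_apply_of_ne {j k : Fin m} (h : j ≠ k) (τ : F) (y : Fin m → F) {i : Fin m}
    (hi : i ≠ j) : shearEquiv h τ y i = y i := by simp [shearEquiv_apply, hi]

end Equivs

section Inherit

variable {F : Type} [Field F] [Fintype F] {n ℓ : ℕ} {ι : Type*}

/-- The values `c a e` satisfy at every point `a` the linear relations that hold identically
between linear transforms of the `H e`, and between transforms of products of the `H e` with
powers of linear forms. -/
def Inherits (H : ι → (Fin ℓ → F) → F) (c : (Fin (ℓ + 1) → F) → ι → F) : Prop :=
  ∀ (G : Type) [Fintype G] (g : G → (Fin (ℓ + 1) → F) ≃ₗ[F] (Fin (ℓ + 1) → F)),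
    (∀ i y, g i y 0 = y 0) → Fintype.card G ≤ Fintype.card F →
    ∀ (J : Type) [Fintype J] (π : J → G) (w : J → F) (e : J → ι) (a : Fin (ℓ + 1) → F), a ≠ 0 →
      ((∀ y, y 0 = 1 → ∑ j, w j * H (e j) (Fin.tail (g (π j) y)) = 0) →
        ∑ j, w j * c (g (π j) a) (e j) = 0) ∧
      ∀ α : J → Fin (ℓ + 1) → F,
        (∀ y, y 0 = 1 → ∑ j, w j * (H (e j) (Fin.tail (g (π j) y)) *
          (α j ⬝ᵥ g (π j) y) ^ (Fintype.card F - 1)) = 0) →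
        ∑ j, w j * (c (g (π j) a) (e j) * (α j ⬝ᵥ g (π j) a) ^ (Fintype.card F - 1)) = 0

open scoped Classical in
theorem inherits_of_typ {f : (Fin n → F) → F} {H : ι → (Fin ℓ → F) → F}
    {c : (Fin (ℓ + 1) → F) → (Fin n → F) → ι → F} {N : ℕ}
    (hc : ∀ a, a ≠ 0 → ∀ b, #{x : (Fin n → Fin (ℓ + 1) → F) × (Fin n → F) | x.1 ∈ zoom a b ∧
      ¬ Typ (tst f H) (c a b) x.1 x.2 a} ≤ N)
    (hN : Fintype.card F * N < Fintype.card (Fin n → Fin (ℓ + 1) → F)) (b : Fin n → F) :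
    Inherits H fun a => c a b := by
  intro G _ g hg hG J _ π w e a ha
  have hg' : ∀ i y, (g i).symm y 0 = y 0 := fun i y => by
    conv_rhs => rw [← (g i).apply_symm_apply y, hg]
  have hN' : Fintype.card G * N < Fintype.card (Fin n → Fin (ℓ + 1) → F) :=
    lt_of_le_of_lt (Nat.mul_le_mul_right N hG) hN
  refine ⟨fun h => ?_, fun α h => ?_⟩
  · exact typical_relation hc (fun i => (g i).symm) hg' hN' π w e
      (fun x => h _ rfl) ha b
  · exact typical_relation_pow hc (fun i => (g i).symm) hg' hN' π w e α
      (fun x => h _ rfl) ha b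

variable {H : ι → (Fin ℓ → F) → F} {c : (Fin (ℓ + 1) → F) → ι → F}

theorem Inherits.equiv (h : Inherits H c) {g : (Fin (ℓ + 1) → F) ≃ₗ[F] (Fin (ℓ + 1) → F)}
    (hg : ∀ y, g y 0 = y 0) (w : F) (e : ι)
    (hH : ∀ y, y 0 = 1 → H e (Fin.tail (g y)) = w * H e (Fin.tail y)) {a : Fin (ℓ + 1) → F}
    (ha : a ≠ 0) : c (g a) e = w * c a e := by
  have hcard : Fintype.card Bool ≤ Fintype.card F := by
    rw [Fintype.card_bool]
    exact Fintype.one_lt_card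
  have := (h Bool (fun i => bif i then g else LinearEquiv.refl F _)
    (by rintro (_ | _) y <;> simp [hg]) hcard Bool id (fun i => bif i then 1 else -w) (fun _ => e)
    a ha).1 fun y hy => by simp [hH y hy]
  simpa [add_neg_eq_zero] using this

theorem Inherits.sum_pow (h : Inherits H c) {J : Type} [Fintype J] (w : J → F) (e : J → ι)
    (α : J → Fin (ℓ + 1) → F)
    (hH : ∀ y, y 0 = 1 → ∑ j, w j * (H (e j) (Fin.tail y) *
      (α j ⬝ᵥ y) ^ (Fintype.card F - 1)) = 0) {a : Fin (ℓ + 1) → F} (ha : a ≠ 0) :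
    ∑ j, w j * (c a (e j) * (α j ⬝ᵥ a) ^ (Fintype.card F - 1)) = 0 :=
  (h Unit (fun _ => LinearEquiv.refl F _) (fun _ _ => rfl) (Fintype.card_pos) J (fun _ => ()) w e
    a ha).2 α hH

theorem Inherits.pow_coord (h : Inherits H c) (e e' : ι) (i i' : Fin (ℓ + 1))
    (hH : ∀ y : Fin (ℓ + 1) → F, y 0 = 1 → H e (Fin.tail y) * y i ^ (Fintype.card F - 1) =
      H e' (Fin.tail y) * y i' ^ (Fintype.card F - 1)) {a : Fin (ℓ + 1) → F} (ha : a ≠ 0) :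
    c a e * a i ^ (Fintype.card F - 1) = c a e' * a i' ^ (Fintype.card F - 1) := by
  have := h.sum_pow (J := Bool) (fun j => bif j then 1 else -1) (fun j => bif j then e else e')
    (fun j => Pi.single (bif j then i else i') 1) (fun y hy => by simp [hH y hy]) ha
  simpa [add_neg_eq_zero] using this

end Inherit

section TestPolynomials

variable {F : Type} [Field F] {p : ℕ} (P : MvPolynomial (Fin p) F) (s t : ℕ)

/-- The product of the values of `P` over the blocks. -/
def blockProd (x : Fin (s + t) → F) : F :=
  ∏ i ∈ Finset.range (s / p), MvPolynomial.eval (fun l : Fin p =>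
    if h : p * i + (l : ℕ) < s + t then x ⟨p * i + (l : ℕ), h⟩ else 0) P

variable {s t}

theorem block_index_lt (hps : p ∣ s) {i l : ℕ} (hi : i < s / p) (hl : l < p) : p * i + l < s := by
  obtain ⟨w, rfl⟩ := hps
  rw [Nat.mul_div_cancel_left _ (by omega)] at hi
  nlinarith

theorem blockProd_congr (hps : p ∣ s) {x x' : Fin (s + t) → F}
    (h : ∀ i : Fin s, x (Fin.castAdd t i) = x' (Fin.castAdd t i)) :
    blockProd P s t x = blockProd P s t x' := by
  refine Finset.prod_congr rfl fun i hi => ?_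
  congr 2
  ext l
  have := block_index_lt hps (Finset.mem_range.1 hi) l.2
  rw [dif_pos (by omega), dif_pos (by omega)]
  exact h ⟨_, this⟩

/-- The test polynomials with valid exponents. -/
def testFun (q r : ℕ) (e : {e : Fin t → ℕ // validE q r t e}) (x : Fin (s + t) → F) : F :=
  Hfun P s t e.1 x

/-- The index of the free coordinate `j` in homogeneous coordinates. -/
def yc (s : ℕ) (j : Fin t) : Fin (s + t + 1) := (Fin.natAdd s j).succ

theorem yc_ne_zero (j : Fin t) : yc s j ≠ 0 := Fin.succ_ne_zero _

theorem yc_injective : Function.Injective (yc s : Fin t → Fin (s + t + 1)) := fun _ _ h =>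
  (Fin.natAdd_injective _ _) (Fin.succ_injective _ h)

theorem castAdd_succ_ne_yc (i : Fin s) (j : Fin t) : (Fin.castAdd t i).succ ≠ yc s j := by
  intro h
  have := congrArg Fin.val (Fin.succ_injective _ h)
  simp at this
  omega

theorem eq_zero_or_castAdd_or_yc (i : Fin (s + t + 1)) :
    i = 0 ∨ (∃ j : Fin s, i = (Fin.castAdd t j).succ) ∨ ∃ j, i = yc s j := by
  refine Fin.cases (Or.inl rfl) (fun i => Or.inr ?_) i
  refine Fin.addCases (fun j => Or.inl ⟨j, rfl⟩) (fun j => Or.inr ⟨j, rfl⟩) i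

/-- The monomial in the free coordinates. -/
def mon (e : Fin t → ℕ) (y : Fin (s + t + 1) → F) : F := ∏ j, y (yc s j) ^ e j

theorem testFun_tail {q r : ℕ} (e : {e : Fin t → ℕ // validE q r t e}) (y : Fin (s + t + 1) → F) :
    testFun P q r e (Fin.tail y) = blockProd P s t (Fin.tail y) * mon e.1 y := rfl

theorem mon_add_single (e : Fin t → ℕ) (i : Fin t) (k : ℕ) (y : Fin (s + t + 1) → F) :
    mon (e + Pi.single i k) y = mon e y * y (yc s i) ^ k := by
  simp only [mon, Pi.add_apply, pow_add, Finset.prod_mul_distrib]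
  congr 1
  rw [Finset.prod_eq_single i]
  · simp
  · intro j _ hj
    simp [hj]
  · simp

theorem update_zero_add_single (e : Fin t → ℕ) (i : Fin t) :
    Function.update e i 0 + Pi.single i (e i) = e := by
  ext j
  by_cases h : j = i
  · subst h
    simp
  · simp [h]

theorem sum_add_single (e : Fin t → ℕ) (i : Fin t) (k : ℕ) :
    ∑ j, (e + Pi.single i k : Fin t → ℕ) j = ∑ j, e j + k := by
  simp [Finset.sum_add_distrib]

theorem mon_eq_of_zero {e : Fin t → ℕ} {y y' : Fin (s + t + 1) → F}
    (h : ∀ j, e j = 0 ∨ y (yc s j) = y' (yc s j)) : mon e y = mon e y' := by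
  refine Finset.prod_congr rfl fun j _ => ?_
  rcases h j with h | h <;> simp [h]

theorem validE.mono {q r : ℕ} {e e' : Fin t → ℕ} (h : validE q r t e) (h' : ∀ j, e' j ≤ e j) :
    validE q r t e' :=
  ⟨fun j => (h' j).trans (h.1 j), (Finset.sum_le_sum fun j _ => h' j).trans h.2⟩

end TestPolynomials

section Typical

variable {F : Type} [Field F] [Fintype F] {p s t r : ℕ} {P : MvPolynomial (Fin p) F}
  {c : (Fin (s + t + 1) → F) → {e : Fin t → ℕ // validE (Fintype.card F) r t e} → F}

theorem Inherits.eq_zero_of_coord_eq_zero (hI : Inherits (testFun P (Fintype.card F) r) c)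
    (hps : p ∣ s) {a : Fin (s + t + 1) → F} (ha : a ≠ 0) {j : Fin t} (haj : a (yc s j) = 0)
    {e : {e : Fin t → ℕ // validE (Fintype.card F) r t e}} (he : e.1 j ≠ 0)
    (he' : e.1 j ≠ Fintype.card F - 1) : c a e = 0 := by
  classical
  have hlt : e.1 j < Nat.card Fˣ := by
    rw [Nat.card_units, Nat.card_eq_fintype_card]
    exact lt_of_le_of_ne (e.2.1 j) he'
  obtain ⟨w, hw⟩ := exists_pow_ne_one_of_isCyclic he hlt
  have hga : diagEquiv (Pi.mulSingle (yc s j) w) a = a := by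
    ext i
    rw [diagEquiv_apply]
    by_cases hi : i = yc s j
    · subst hi
      simp [haj]
    · simp [hi]
  have h0 : ∀ y : Fin (s + t + 1) → F, diagEquiv (Pi.mulSingle (yc s j) w) y 0 = y 0 := by
    intro y
    rw [diagEquiv_apply, Pi.mulSingle_eq_of_ne (yc_ne_zero j).symm]
    simp
  have h := hI.equiv h0 ((w : F) ^ e.1 j) e (fun y _ => ?_) ha
  · rw [hga] at h
    have hw' : (1 - (w : F) ^ e.1 j) ≠ 0 := by
      rw [sub_ne_zero]
      intro h1
      exact hw (Units.ext (by push_cast; exact h1.symm))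
    refine (mul_eq_zero.1 (?_ : (1 - (w : F) ^ e.1 j) * c a e = 0)).resolve_left hw'
    linear_combination h
  · rw [testFun_tail, testFun_tail, mul_left_comm]
    congr 1
    · refine blockProd_congr P hps fun i => ?_
      simp [Fin.tail, diagEquiv_apply, Pi.mulSingle_eq_of_ne (castAdd_succ_ne_yc i j)]
    · simp only [mon, diagEquiv_apply, mul_pow, Finset.prod_mul_distrib]
      congr 1
      rw [Finset.prod_eq_single j]
      · simp
      · intro i _ hi
        rw [Pi.mulSingle_eq_of_ne (fun h => hi (yc_injective h))]
        simp
      · simp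

theorem Inherits.eq_zero_of_infinite_of_free (hI : Inherits (testFun P (Fintype.card F) r) c)
    (hps : p ∣ s) (hr : r + (Fintype.card F - 1) ≤ t * (Fintype.card F - 1))
    {a : Fin (s + t + 1) → F} (ha0 : a 0 = 0) {i : Fin t} (hai : a (yc s i) ≠ 0)
    (e : {e : Fin t → ℕ // validE (Fintype.card F) r t e}) : c a e = 0 := by
  have hq : Fintype.card F - 1 ≠ 0 := by
    have := Fintype.one_lt_card (α := F)
    omega
  have ha : a ≠ 0 := fun h => hai (by rw [h]; rfl)
  have key : ∀ (i : Fin t) (e e' : {e : Fin t → ℕ // validE (Fintype.card F) r t e})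
      (k : Fin (s + t + 1)), a (yc s i) ≠ 0 → a k = 0 → (∀ y : Fin (s + t + 1) → F, y 0 = 1 →
        mon e.1 y * y (yc s i) ^ (Fintype.card F - 1) = mon e'.1 y * y k ^ (Fintype.card F - 1)) →
      c a e = 0 := by
    intro i e e' k hi hk h
    have := hI.pow_coord e e' (yc s i) k (fun y hy => by
      rw [testFun_tail, testFun_tail, mul_assoc, mul_assoc, h y hy]) ha
    rw [hk, zero_pow hq, mul_zero] at this
    exact (mul_eq_zero.1 this).resolve_right (pow_ne_zero _ hi)
  by_contra hce
  have h1 : ∀ i, a (yc s i) ≠ 0 → e.1 i = 0 := by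
    intro i hi
    by_contra hei
    refine hce (key i e e 0 hi ha0 fun y hy => ?_)
    rw [hy, one_pow, mul_one]
    conv_lhs => rw [← update_zero_add_single e.1 i, mon_add_single, mul_assoc]
    conv_rhs => rw [← update_zero_add_single e.1 i, mon_add_single]
    congr 1
    by_cases hy : y (yc s i) = 0
    · simp [hy, hei]
    · rw [FiniteField.pow_card_sub_one_eq_one _ hy, mul_one]
  have hle : ∀ e' : Fin t → ℕ, (∀ j, e' j ≤ e.1 j) → ∀ j,
      (e' + Pi.single i (Fintype.card F - 1) : Fin t → ℕ) j ≤ Fintype.card F - 1 := by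
    intro e' he' j
    by_cases hj : j = i
    · subst hj
      have := he' j
      rw [h1 j hai] at this
      simp only [Pi.add_apply, Pi.single_eq_same]
      omega
    · simpa [hj] using (he' j).trans (e.2.1 j)
  have h2 : t * (Fintype.card F - 1) - r < ∑ j, e.1 j + (Fintype.card F - 1) := by
    by_contra! hlt
    refine hce (key i e ⟨e.1 + Pi.single i (Fintype.card F - 1),
      hle _ fun _ => le_rfl, by rw [sum_add_single]; exact hlt⟩ 0 hai ha0 fun y hy => ?_)
    rw [hy, one_pow, mul_one, mon_add_single]
  have h3 : ∀ j, a (yc s j) = 0 → e.1 j ≠ Fintype.card F - 1 := by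
    intro j hj hej
    refine hce (key i e ⟨Function.update e.1 j 0 + Pi.single i (Fintype.card F - 1),
      hle _ fun l => ?_, ?_⟩ (yc s j) hai hj fun y hy => ?_)
    · by_cases hl : l = j
      · subst hl
        simp
      · simp [hl]
    · have := sum_add_single (Function.update e.1 j 0) j (e.1 j)
      rw [update_zero_add_single] at this
      rw [sum_add_single]
      refine le_trans (le_of_eq ?_) e.2.2
      omega
    · rw [mon_add_single]
      conv_lhs => rw [← update_zero_add_single e.1 j, mon_add_single, hej]
      ring
  have h4 : ∀ j, e.1 j = 0 := by
    intro j
    by_cases hj : a (yc s j) = 0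
    · by_contra hej
      exact hce (hI.eq_zero_of_coord_eq_zero hps ha hj hej (h3 j hj))
    · exact h1 j hj
  simp only [h4, Finset.sum_const_zero] at h2
  omega

/-- The typical values vanish at points at infinity. -/
theorem Inherits.eq_zero_of_infinite (hI : Inherits (testFun P (Fintype.card F) r) c)
    (hps : p ∣ s) (hr0 : 0 < r) (hr : r + (Fintype.card F - 1) ≤ t * (Fintype.card F - 1))
    {a : Fin (s + t + 1) → F} (ha : a ≠ 0) (ha0 : a 0 = 0)
    (e : {e : Fin t → ℕ // validE (Fintype.card F) r t e}) : c a e = 0 := by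
  by_cases hy : ∃ i, a (yc s i) ≠ 0
  · obtain ⟨i, hi⟩ := hy
    exact hI.eq_zero_of_infinite_of_free hps hr ha0 hi e
  push Not at hy
  by_contra hce
  obtain ⟨i, hi⟩ : ∃ i : Fin s, a (Fin.castAdd t i).succ ≠ 0 := by
    by_contra! hx
    refine ha (funext fun i => ?_)
    rcases eq_zero_or_castAdd_or_yc i with rfl | ⟨j, rfl⟩ | ⟨j, rfl⟩
    exacts [ha0, hx j, hy j]
  obtain ⟨j, hj⟩ : ∃ j, e.1 j = 0 := by
    by_contra! hj
    have h1 : ∀ j, e.1 j = Fintype.card F - 1 := fun j => by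
      by_contra h
      exact hce (hI.eq_zero_of_coord_eq_zero hps ha (hy j) (hj j) h)
    have h2 := e.2.2
    simp only [h1, Finset.sum_const, Finset.card_univ, Fintype.card_fin, smul_eq_mul] at h2
    omega
  have hne : yc s j ≠ (Fin.castAdd t i).succ := (castAdd_succ_ne_yc i j).symm
  have h0 : ∀ y : Fin (s + t + 1) → F, shearEquiv hne 1 y 0 = y 0 := fun y =>
    shearEquiv_apply_of_ne hne 1 y (yc_ne_zero j).symm
  have h := hI.equiv h0 1 e (fun y _ => ?_) ha
  · rw [one_mul] at h
    refine hce (h.symm.trans (hI.eq_zero_of_infinite_of_free hps hr (i := j)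
      ((h0 a).trans ha0) ?_ e))
    rw [shearEquiv_apply_same, hy j, one_mul, zero_add]
    exact hi
  · rw [one_mul, testFun_tail, testFun_tail]
    congr 1
    · refine blockProd_congr P hps fun l => ?_
      exact shearEquiv_apply_of_ne hne 1 y (castAdd_succ_ne_yc l j)
    · refine mon_eq_of_zero fun l => ?_
      by_cases hl : l = j
      · exact Or.inl (hl ▸ hj)
      · exact Or.inr (shearEquiv_apply_of_ne hne 1 y fun h => hl (yc_injective h))

theorem mul_pow_eq_sum (A z : F) (k : ℕ) : A * z ^ k =
    (∑ κ : F, κ ^ k) * A + ∑ κ : F, -κ ^ k * (A * (z - κ) ^ (Fintype.card F - 1)) := by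
  classical
  have h : z ^ k = ∑ κ : F, κ ^ k * (1 - (z - κ) ^ (Fintype.card F - 1)) := by
    simp [one_sub_pow_card_sub_one, sub_eq_zero]
  rw [h, Finset.mul_sum, Finset.sum_mul, ← Finset.sum_add_distrib]
  exact Finset.sum_congr rfl fun κ _ => by ring

theorem Inherits.eq_mul_pow (hI : Inherits (testFun P (Fintype.card F) r) c)
    {a : Fin (s + t + 1) → F} (ha0 : a 0 = 1)
    (e e' : {e : Fin t → ℕ // validE (Fintype.card F) r t e}) {i : Fin t} {k : ℕ}
    (h : e.1 = e'.1 + Pi.single i k) : c a e = c a e' * a (yc s i) ^ k := by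
  have ha : a ≠ 0 := fun h => by simp [h] at ha0
  have hs : ∀ (y : Fin (s + t + 1) → F) (κ : F), y 0 = 1 →
      (Pi.single (yc s i) 1 - Pi.single 0 κ : Fin (s + t + 1) → F) ⬝ᵥ y = y (yc s i) - κ := by
    intro y κ hy
    rw [sub_dotProduct, single_dotProduct, single_dotProduct, hy, one_mul, mul_one]
  have hs0 : ∀ y : Fin (s + t + 1) → F, y 0 = 1 → (Pi.single 0 1 : Fin (s + t + 1) → F) ⬝ᵥ y = 1 := by
    intro y hy
    rw [single_dotProduct, hy, one_mul]
  have key := hI.sum_pow (J := Option (Option F))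
    (fun j => j.elim (-1) fun j => j.elim (∑ κ : F, κ ^ k) fun κ => -κ ^ k)
    (fun j => j.elim e fun _ => e')
    (fun j => j.elim (Pi.single 0 1) fun j => j.elim (Pi.single 0 1)
      fun κ => Pi.single (yc s i) 1 - Pi.single 0 κ) (fun y hy => ?_) ha
  · simp only [Fintype.sum_option, Option.elim, hs _ _ ha0, hs0 _ ha0, one_pow, mul_one] at key
    rw [mul_pow_eq_sum]
    linear_combination -key
  · simp only [Fintype.sum_option, Option.elim, hs _ _ hy, hs0 _ hy, one_pow, mul_one]
    rw [testFun_tail, testFun_tail, h, mon_add_single]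
    have := mul_pow_eq_sum (blockProd P s t (Fin.tail y) * mon e'.1 y) (y (yc s i)) k
    linear_combination -this

theorem Inherits.ne_zero_of_ne_zero (hI : Inherits (testFun P (Fintype.card F) r) c)
    {a : Fin (s + t + 1) → F} (ha0 : a 0 = 1)
    {e : {e : Fin t → ℕ // validE (Fintype.card F) r t e}} (he : c a e ≠ 0)
    {e₀ : {e : Fin t → ℕ // validE (Fintype.card F) r t e}} (he₀ : e₀.1 = 0) : c a e₀ ≠ 0 := by
  classical
  have key : ∀ S : Finset (Fin t), c a ⟨fun j => if j ∈ S then 0 else e.1 j,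
      e.2.mono fun j => by split_ifs <;> omega⟩ ≠ 0 := by
    intro S
    induction S using Finset.induction_on with
    | empty => simpa using he
    | insert i S hi ih =>
      intro h0
      refine ih ?_
      rw [hI.eq_mul_pow ha0 _ _ (i := i) (k := e.1 i) ?_, h0, zero_mul]
      ext j
      by_cases hj : j = i
      · subst hj
        simp [hi]
      · simp [hj]
  have := key univ
  simp only [Finset.mem_univ, if_true] at this
  have h2 : e₀ = ⟨fun j => 0, e.2.mono fun j => Nat.zero_le _⟩ := Subtype.ext he₀
  rwa [h2]

end Typical

section Differences

open Polynomial

variable {F : Type} [Field F]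

theorem natDegree_taylor_sub_le {f : F[X]} {k : ℕ} (hf : f.natDegree ≤ k + 1) (a : F) :
    (taylor a f - f).natDegree ≤ k ∧
      (taylor a f - f).coeff k = (k + 1 : ℕ) * a * f.coeff (k + 1) := by
  have hd : (hasseDeriv k f).natDegree < 2 :=
    lt_of_le_of_lt (natDegree_hasseDeriv_le f k) (by omega)
  have hd' : (hasseDeriv (k + 1) f).natDegree < 1 :=
    lt_of_le_of_lt (natDegree_hasseDeriv_le f (k + 1)) (by omega)
  refine ⟨?_, ?_⟩
  · refine natDegree_le_iff_coeff_eq_zero.2 fun N hN => ?_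
    rcases eq_or_lt_of_le (Nat.succ_le_of_lt hN) with rfl | hN'
    · rw [coeff_sub, taylor_coeff, eval_eq_sum_range' hd', Finset.sum_range_one, hasseDeriv_coeff]
      simp
    · rw [coeff_sub, coeff_eq_zero_of_natDegree_lt (by rw [natDegree_taylor]; omega),
        coeff_eq_zero_of_natDegree_lt (by omega), sub_zero]
  · rw [coeff_sub, taylor_coeff, eval_eq_sum_range' hd, Finset.sum_range_succ,
      Finset.sum_range_one, hasseDeriv_coeff, hasseDeriv_coeff, zero_add, add_comm 1 k,
      Nat.choose_self, Nat.choose_symm_add, Nat.choose_one_right]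
    push_cast
    ring

/-- The iterated difference of `X ^ m` in the directions `z i`, `i ∈ S`. -/
def iterDiff {ι : Type*} (z : ι → F) (m : ℕ) (S : Finset ι) : F[X] :=
  ∑ I ∈ S.powerset, C ((-1 : F) ^ #I) * (X + C (∑ i ∈ I, z i)) ^ m

theorem iterDiff_insert {ι : Type*} [DecidableEq ι] (z : ι → F) (m : ℕ) {S : Finset ι} {i : ι}
    (hi : i ∉ S) : iterDiff z m (insert i S) =
      -(taylor (z i) (iterDiff z m S) - iterDiff z m S) := by
  rw [iterDiff, Finset.sum_powerset_insert hi, neg_sub, iterDiff, sub_eq_add_neg, map_sum,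
    ← Finset.sum_neg_distrib]
  congr 1
  refine Finset.sum_congr rfl fun I hI => ?_
  have hiI : i ∉ I := fun h => hi (Finset.mem_powerset.1 hI h)
  rw [Finset.card_insert_of_notMem hiI, Finset.sum_insert hiI, taylor_apply]
  simp only [mul_comp, C_comp, pow_comp, add_comp, X_comp, pow_succ, map_add, map_mul, map_neg,
    map_one]
  ring

theorem iterDiff_degree {ι : Type*} (z : ι → F) (hz : ∀ i, z i ≠ 0) (m : ℕ)
    (S : Finset ι) (k : ℕ) (hS : #S + k = m) (hm : ∀ j, k < j → j ≤ m → (j : F) ≠ 0) :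
    (iterDiff z m S).natDegree ≤ k ∧ (iterDiff z m S).coeff k ≠ 0 := by
  classical
  induction S using Finset.induction_on generalizing k with
  | empty =>
    simp only [Finset.card_empty, zero_add] at hS
    subst hS
    simp [iterDiff]
  | insert i S hi ih =>
    rw [Finset.card_insert_of_notMem hi] at hS
    obtain ⟨h1, h2⟩ := ih (k + 1) (by omega) fun j hj => hm j (by omega)
    obtain ⟨h3, h4⟩ := natDegree_taylor_sub_le h1 (z i)
    rw [iterDiff_insert z m hi, natDegree_neg, coeff_neg, h4, neg_ne_zero]
    exact ⟨h3, mul_ne_zero (mul_ne_zero (hm (k + 1) (by omega) (by omega)) (hz i)) h2⟩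

theorem exists_iterDiff_ne_zero [Fintype F] {ι : Type*} (z : ι → F) (hz : ∀ i, z i ≠ 0) {m : ℕ}
    (hmF : m < Fintype.card F) (S : Finset ι) (hS : #S ≤ m)
    (hm : ∀ j, m - #S < j → j ≤ m → (j : F) ≠ 0) :
    ∃ w : F, ∑ I ∈ S.powerset, (-1 : F) ^ #I * (w + ∑ i ∈ I, z i) ^ m ≠ 0 := by
  by_contra! hcon
  obtain ⟨h1, h2⟩ := iterDiff_degree z hz m S (m - #S) (by omega) hm
  refine h2 ?_
  rw [eq_zero_of_natDegree_lt_card_of_eval_eq_zero (iterDiff z m S) Function.injective_id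
    (fun w => ?_) (by omega), coeff_zero]
  simpa [iterDiff, eval_finsetSum] using hcon w

end Differences

section BlockPolynomial

variable {F : Type} [Field F] [Fintype F]
open MvPolynomial

theorem sum_eval_line_eq_zero {σ : Type*} [DecidableEq σ] {Q : MvPolynomial σ F}
    (hQ : Q.totalDegree < Fintype.card F - 1) (z : σ → F) (l : σ) :
    ∑ τ : F, eval (z + Pi.single l τ) Q = 0 := by
  set g : σ → MvPolynomial Unit F := fun i => C (z i) + if i = l then X () else 0 with hg
  have h1 : ∀ i, (g i).totalDegree ≤ 1 := by
    intro i
    refine (totalDegree_add _ _).trans ?_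
    rw [totalDegree_C]
    split_ifs <;> simp
  have h2 := sum_eval_eq_zero (bind₁ g Q) (lt_of_le_of_lt (totalDegree_bind₁_le g h1 Q) (by simpa))
  rw [← h2]
  refine Fintype.sum_equiv (Equiv.funUnique Unit F).symm _ _ fun τ => ?_
  rw [← aeval_eq_eval, ← aeval_eq_eval, aeval_bind₁]
  congr 2
  ext i
  by_cases hi : i = l
  · subst hi
    simp [hg]
  · simp [hg, hi]

variable {p k : ℕ}

/-- The inclusion of the indices of the first `p - 1` variables. -/
abbrev lowIdx (i : Fin (p - 1)) : Fin p := Fin.castLE (Nat.sub_le p 1) i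

/-- The index of the last variable. -/
abbrev lastIdx (hp : p.Prime) : Fin p := ⟨p - 1, Nat.sub_lt hp.pos one_pos⟩

theorem lowIdx_ne_lastIdx (hp : p.Prime) (i : Fin (p - 1)) : lowIdx i ≠ lastIdx hp := by
  intro h
  have := congrArg Fin.val h
  have := i.2
  simp at *
  omega

theorem Pdef.totalDegree_lt (hp : p.Prime) (hk : 1 ≤ k) (hF : Fintype.card F = p ^ k)
    {P : MvPolynomial (Fin p) F} (hP : Pdef p (Fintype.card F) hp.pos P) :
    P.totalDegree < Fintype.card F - 1 := by
  have hpF : p ≤ Fintype.card F := hF ▸ Nat.le_self_pow (by omega) p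
  have hp2 := hp.two_le
  rcases eq_or_ne P 0 with rfl | hP0
  · rw [totalDegree_zero]
    omega
  have hX : (∏ i : Fin (p - 1), (X (lowIdx i) : MvPolynomial (Fin p) F)) ≠ 0 :=
    Finset.prod_ne_zero_iff.2 fun i _ => X_ne_zero _
  have h1 : (∏ i : Fin (p - 1), (X (lowIdx i) : MvPolynomial (Fin p) F)).totalDegree = p - 1 := by
    have := IsHomogeneous.prod univ (fun i : Fin (p - 1) => (X (lowIdx i) : MvPolynomial (Fin p) F))
      (fun _ => 1) fun i _ => isHomogeneous_X F _
    rw [this.totalDegree hX]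
    simp
  have h2 := totalDegree_mul_of_isDomain hX hP0
  have h3 : ((∏ i : Fin (p - 1), (X (lowIdx i) : MvPolynomial (Fin p) F)) * P).totalDegree ≤
      Fintype.card F - 1 := by
    rw [hP]
    refine totalDegree_finsetSum_le fun I _ => (totalDegree_mul _ _).trans ?_
    rw [totalDegree_C, zero_add]
    refine (totalDegree_pow _ _).trans ((Nat.mul_le_mul_left _ ?_).trans (mul_one _).le)
    refine (totalDegree_add _ _).trans (max_le (totalDegree_finsetSum_le fun i _ => ?_) ?_) <;>
    exact (totalDegree_X _).le
  omega

/-- The right-hand side of the equation defining `P`. -/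
def blockSum (hp : p.Prime) (z : Fin p → F) : F :=
  ∑ I : Finset (Fin (p - 1)), (-1 : F) ^ (#I + 1) *
    (∑ i ∈ I, z (lowIdx i) + z (lastIdx hp)) ^ (Fintype.card F - 1)

theorem Pdef.eval_mul (hp : p.Prime) {P : MvPolynomial (Fin p) F}
    (hP : Pdef p (Fintype.card F) hp.pos P) (z : Fin p → F) :
    (∏ i : Fin (p - 1), z (lowIdx i)) * eval z P = blockSum hp z := by
  have := congrArg (eval z) hP
  simpa [blockSum, map_sum, map_prod] using this

theorem exists_blockSum_ne_zero (hp : p.Prime) (hk : 1 ≤ k) (hF : Fintype.card F = p ^ k)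
    (z : Fin p → F) (hz : ∀ i : Fin (p - 1), z (lowIdx i) ≠ 0) :
    ∃ τ : F, blockSum hp (z + Pi.single (lastIdx hp) τ) ≠ 0 := by
  have hpF : p ≤ Fintype.card F := hF ▸ Nat.le_self_pow (by omega) p
  have hp2 := hp.two_le
  have : Fact p.Prime := ⟨hp⟩
  have := charP_of_card_eq_prime_pow hF
  obtain ⟨w, hw⟩ := exists_iterDiff_ne_zero (fun i => z (lowIdx i)) hz
    (m := Fintype.card F - 1) (by omega) univ (by simp; omega) (by
      intro j hj hj' h0
      rw [CharP.cast_eq_zero_iff F p] at h0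
      have h1 : p ∣ Fintype.card F := hF ▸ dvd_pow_self p (by omega)
      have h2 := (Nat.dvd_sub h1 h0)
      have h3 := Nat.le_of_dvd (by omega) h2
      simp at hj
      omega)
  refine ⟨w - z (lastIdx hp), fun h0 => hw ?_⟩
  rw [← neg_eq_zero, ← h0, blockSum, Finset.powerset_univ, ← Finset.sum_neg_distrib]
  refine Finset.sum_congr rfl fun I _ => ?_
  have h1 : ∀ i ∈ I, (z + Pi.single (lastIdx hp) (w - z (lastIdx hp)) : Fin p → F) (lowIdx i) =
      z (lowIdx i) := fun i _ => by
    rw [Pi.add_apply, Pi.single_eq_of_ne (lowIdx_ne_lastIdx hp i), add_zero]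
  rw [Finset.sum_congr rfl h1, Pi.add_apply, Pi.single_eq_same, pow_succ]
  ring

end BlockPolynomial

section Blocks

variable {F : Type} [Field F] {p s t r : ℕ}

/-- The index of the variable `l` of block `i` in homogeneous coordinates. -/
def blockIdx (hps : p ∣ s) (i : Fin (s / p)) (l : Fin p) : Fin (s + t + 1) :=
  Fin.succ ⟨p * i + l, (block_index_lt hps i.2 l.2).trans_le (Nat.le_add_right s t)⟩

theorem blockIdx_inj {hps : p ∣ s} {i i' : Fin (s / p)} {l l' : Fin p} :
    (blockIdx hps i l : Fin (s + t + 1)) = blockIdx hps i' l' ↔ i = i' ∧ l = l' := by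
  refine ⟨fun h => ?_, by rintro ⟨rfl, rfl⟩; rfl⟩
  have h1 : p * i + l = p * i' + l' := congrArg Fin.val (Fin.succ_injective _ h)
  have hp : 0 < p := l.pos
  have h2 := congrArg (· / p) h1
  have h3 := congrArg (· % p) h1
  simp only [Nat.mul_add_div hp, Nat.div_eq_of_lt l.2, Nat.div_eq_of_lt l'.2, Nat.mul_add_mod,
    Nat.mod_eq_of_lt l.2, Nat.mod_eq_of_lt l'.2, add_zero] at h2 h3
  exact ⟨Fin.ext h2, Fin.ext h3⟩

theorem blockIdx_ne_zero {hps : p ∣ s} {i : Fin (s / p)} {l : Fin p} :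
    (blockIdx hps i l : Fin (s + t + 1)) ≠ 0 := Fin.succ_ne_zero _

/-- The coordinates of `y` in block `i`. -/
def block (hps : p ∣ s) (y : Fin (s + t + 1) → F) (i : Fin (s / p)) (l : Fin p) : F :=
  y (blockIdx hps i l)

theorem blockProd_tail (hps : p ∣ s) (P : MvPolynomial (Fin p) F) (y : Fin (s + t + 1) → F) :
    blockProd P s t (Fin.tail y) = ∏ i, MvPolynomial.eval (block hps y i) P := by
  rw [blockProd, Finset.prod_range]
  refine Finset.prod_congr rfl fun i _ => ?_
  congr 2
  ext l
  rw [dif_pos ((block_index_lt hps i.2 l.2).trans_le (Nat.le_add_right s t))]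
  rfl

theorem testFun_tail_of_zero (hps : p ∣ s) (P : MvPolynomial (Fin p) F) {q : ℕ}
    {e : {e : Fin t → ℕ // validE q r t e}} (he : e.1 = 0) (y : Fin (s + t + 1) → F) :
    testFun P q r e (Fin.tail y) = ∏ i, MvPolynomial.eval (block hps y i) P := by
  rw [testFun_tail, blockProd_tail hps, he]
  simp [mon]

theorem block_shear (hps : p ∣ s) (i : Fin (s / p)) (l : Fin p) (τ : F)
    (y : Fin (s + t + 1) → F) :
    block hps (shearEquiv (blockIdx_ne_zero (hps := hps) (i := i) (l := l)) τ y) i =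
      block hps y i + Pi.single l (τ * y 0) := by
  ext l'
  by_cases h : l' = l
  · subst h
    rw [block, shearEquiv_apply_same, Pi.add_apply, Pi.single_eq_same]
    rfl
  · rw [block, shearEquiv_apply_of_ne _ _ _ (fun h' => h (blockIdx_inj.1 h').2), Pi.add_apply,
      Pi.single_eq_of_ne h, add_zero]
    rfl

theorem block_shear_of_ne (hps : p ∣ s) {i i' : Fin (s / p)} (h : i' ≠ i) (l : Fin p) (τ : F)
    (y : Fin (s + t + 1) → F) :
    block hps (shearEquiv (blockIdx_ne_zero (hps := hps) (i := i) (l := l)) τ y) i' =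
      block hps y i' := by
  ext l'
  exact shearEquiv_apply_of_ne _ _ _ fun h' => h (blockIdx_inj.1 h').1

theorem shear_blockIdx_zero (hps : p ∣ s) (i : Fin (s / p)) (l : Fin p) (τ : F)
    (y : Fin (s + t + 1) → F) :
    shearEquiv (blockIdx_ne_zero (hps := hps) (i := i) (l := l)) τ y 0 = y 0 :=
  shearEquiv_apply_of_ne _ _ _ blockIdx_ne_zero.symm

theorem prod_eval_block_shear (hps : p ∣ s) (P : MvPolynomial (Fin p) F) (i : Fin (s / p))
    (l : Fin p) (τ : F) (y : Fin (s + t + 1) → F) :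
    ∏ i', MvPolynomial.eval
      (block hps (shearEquiv (blockIdx_ne_zero (hps := hps) (i := i) (l := l)) τ y) i') P =
    MvPolynomial.eval (block hps y i + Pi.single l (τ * y 0)) P *
      ∏ i' ∈ univ.erase i, MvPolynomial.eval (block hps y i') P := by
  rw [← Finset.mul_prod_erase univ _ (Finset.mem_univ i), block_shear]
  congr 1
  refine Finset.prod_congr rfl fun i' hi' => ?_
  rw [block_shear_of_ne hps (Finset.ne_of_mem_erase hi')]

variable [Fintype F] {P : MvPolynomial (Fin p) F}
  {c : (Fin (s + t + 1) → F) → {e : Fin t → ℕ // validE (Fintype.card F) r t e} → F}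
  {e : {e : Fin t → ℕ // validE (Fintype.card F) r t e}}

theorem Inherits.exists_shear_ne_zero (hI : Inherits (testFun P (Fintype.card F) r) c)
    (hps : p ∣ s) (hP : P.totalDegree < Fintype.card F - 1) (he : e.1 = 0)
    {a : Fin (s + t + 1) → F} (ha : a ≠ 0) (hc : c a e ≠ 0) (i : Fin (s / p)) (l : Fin p) :
    ∃ τ : F, τ ≠ 0 ∧
      c (shearEquiv (blockIdx_ne_zero (hps := hps) (i := i) (l := l)) τ a) e ≠ 0 := by
  classical
  have h := (hI F (fun τ => shearEquiv (blockIdx_ne_zero (hps := hps) (i := i) (l := l)) τ)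
    (fun τ y => shear_blockIdx_zero hps i l τ y) le_rfl F id (fun _ => 1) (fun _ => e) a ha).1
    fun y hy => by
      simp only [testFun_tail_of_zero hps P he, id, one_mul, prod_eval_block_shear, hy, mul_one]
      rw [← Finset.sum_mul, sum_eval_line_eq_zero hP, zero_mul]
  by_contra! hcon
  refine hc ?_
  simp only [one_mul, id] at h
  rw [Finset.sum_eq_single 0 (fun τ _ hτ => hcon τ hτ) (by simp), shearEquiv_apply, zero_mul,
    Pi.single_zero, add_zero] at h
  exact h

theorem Inherits.exists_blocks_ne_zero (hI : Inherits (testFun P (Fintype.card F) r) c)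
    (hps : p ∣ s) (hP : P.totalDegree < Fintype.card F - 1) (he : e.1 = 0)
    {a : Fin (s + t + 1) → F} (ha0 : a 0 = 1) (hc : c a e ≠ 0) :
    ∃ a' : Fin (s + t + 1) → F, a' 0 = 1 ∧ c a' e ≠ 0 ∧ ∀ i l, block hps a' i l ≠ 0 := by
  classical
  have key : ∀ S : Finset (Fin (s / p) × Fin p), ∃ a' : Fin (s + t + 1) → F, a' 0 = 1 ∧
      c a' e ≠ 0 ∧ ∀ x ∈ S, block hps a' x.1 x.2 ≠ 0 := by
    intro S
    induction S using Finset.induction_on with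
    | empty => exact ⟨a, ha0, hc, by simp⟩
    | insert x S hx ih =>
      obtain ⟨a', h0, h1, h2⟩ := ih
      by_cases hx' : block hps a' x.1 x.2 = 0
      · obtain ⟨τ, hτ, h3⟩ := hI.exists_shear_ne_zero hps hP he
          (fun h => by simp [h] at h0) h1 x.1 x.2
        refine ⟨_, (shear_blockIdx_zero hps x.1 x.2 τ a').trans h0, h3, fun z hz => ?_⟩
        rcases Finset.mem_insert.1 hz with rfl | hz
        · rw [block_shear, Pi.add_apply, hx', Pi.single_eq_same, h0, mul_one, zero_add]
          exact hτ
        · have hzx : z ≠ x := fun h => hx (h ▸ hz)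
          have : block hps (shearEquiv (blockIdx_ne_zero (hps := hps) (i := x.1) (l := x.2)) τ a')
              z.1 z.2 = block hps a' z.1 z.2 :=
            shearEquiv_apply_of_ne _ _ _ fun h' =>
              hzx (Prod.ext (blockIdx_inj.1 h').1 (blockIdx_inj.1 h').2)
          rw [this]
          exact h2 z hz
      · refine ⟨a', h0, h1, fun z hz => ?_⟩
        rcases Finset.mem_insert.1 hz with rfl | hz
        exacts [hx', h2 z hz]
  obtain ⟨a', h0, h1, h2⟩ := key univ
  exact ⟨a', h0, h1, fun i l => h2 (i, l) (Finset.mem_univ _)⟩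

/-- The linear form `y ↦ ∑ l ∈ I, y_l + y_last + τ y_0`, with variables from block `i`. -/
def blockForm (hp : p.Prime) (hps : p ∣ s) (i : Fin (s / p)) (I : Finset (Fin (p - 1))) (τ : F) :
    Fin (s + t + 1) → F :=
  ∑ l ∈ I, Pi.single (blockIdx hps i (lowIdx l)) 1 + Pi.single (blockIdx hps i (lastIdx hp)) 1 +
    Pi.single 0 τ

theorem blockSum_add_single (hp : p.Prime) (hps : p ∣ s) (i : Fin (s / p)) (τ : F)
    {y : Fin (s + t + 1) → F} (hy : y 0 = 1) :
    blockSum hp (block hps y i + Pi.single (lastIdx hp) τ) =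
      ∑ I, (-1 : F) ^ (#I + 1) * (blockForm hp hps i I τ ⬝ᵥ y) ^ (Fintype.card F - 1) := by
  refine Finset.sum_congr rfl fun I _ => ?_
  have h1 : ∀ l ∈ I, (block hps y i + Pi.single (lastIdx hp) τ : Fin p → F) (lowIdx l) =
      y (blockIdx hps i (lowIdx l)) := fun l _ => by
    rw [Pi.add_apply, Pi.single_eq_of_ne (lowIdx_ne_lastIdx hp l), add_zero]
    rfl
  rw [Finset.sum_congr rfl h1, Pi.add_apply, Pi.single_eq_same, blockForm, add_dotProduct,
    add_dotProduct, sum_dotProduct]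
  simp only [single_dotProduct, one_mul, hy, mul_one, add_assoc]
  rfl

theorem Inherits.eval_block_ne_zero (hI : Inherits (testFun P (Fintype.card F) r) c)
    (hp : p.Prime) (hps : p ∣ s) {k : ℕ} (hk : 1 ≤ k) (hF : Fintype.card F = p ^ k)
    (hP : Pdef p (Fintype.card F) hp.pos P) (he : e.1 = 0) {a : Fin (s + t + 1) → F}
    (ha0 : a 0 = 1) (hc : c a e ≠ 0) (hb : ∀ i l, block hps a i l ≠ 0) (i : Fin (s / p)) :
    MvPolynomial.eval (block hps a i) P ≠ 0 := by
  intro h0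
  obtain ⟨τ, hτ⟩ := exists_blockSum_ne_zero hp hk hF (block hps a i) fun l => hb i _
  have ha : a ≠ 0 := fun h => by simp [h] at ha0
  have hcard : Fintype.card Bool ≤ Fintype.card F := by
    rw [Fintype.card_bool]
    exact Fintype.one_lt_card
  set g := shearEquiv (blockIdx_ne_zero (t := t) (hps := hps) (i := i) (l := lastIdx hp)) τ with hg
  have hg0 : ∀ y, g y 0 = y 0 := fun y => shear_blockIdx_zero hps i (lastIdx hp) τ y
  have hback : ∀ y, y 0 = 1 →
      block hps (g y) i + Pi.single (lastIdx hp) (-τ) = block hps y i := fun y hy => by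
    rw [hg, block_shear, hy, mul_one, add_assoc, ← Pi.single_add, add_neg_cancel, Pi.single_zero,
      add_zero]
  have expand : ∀ (v v' : F) (y : Fin (s + t + 1) → F), y 0 = 1 →
      ∑ j : Bool × Finset (Fin (p - 1)), ((bif j.1 then -1 else 1) * (-1 : F) ^ (#j.2 + 1)) *
        ((bif j.1 then v' else v) * (blockForm hp hps i j.2 (bif j.1 then -τ else τ) ⬝ᵥ
          (bif j.1 then g else LinearEquiv.refl F _) y) ^ (Fintype.card F - 1)) =
      v * blockSum hp (block hps y i + Pi.single (lastIdx hp) τ) -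
        v' * blockSum hp (block hps y i) := by
    intro v v' y hy
    rw [← hback y hy, blockSum_add_single hp hps i (-τ) ((hg0 y).trans hy), hback y hy,
      blockSum_add_single hp hps i τ hy, Fintype.sum_prod_type, Fintype.sum_bool,
      Finset.mul_sum, Finset.mul_sum, ← Finset.sum_sub_distrib, ← Finset.sum_add_distrib]
    refine Finset.sum_congr rfl fun I _ => ?_
    simp only [cond_true, cond_false, LinearEquiv.refl_apply]
    ring
  have h := (hI Bool (fun i => bif i then g else LinearEquiv.refl F _)
    (by rintro (_ | _) y <;> simp [hg0]) hcard (Bool × Finset (Fin (p - 1))) Prod.fst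
    (fun j => (bif j.1 then -1 else 1) * (-1 : F) ^ (#j.2 + 1)) (fun _ => e) a ha).2
    (fun j => blockForm hp hps i j.2 (bif j.1 then -τ else τ)) fun y hy => ?_
  · have h1 := expand (c a e) (c (g a) e) a ha0
    have h2 : blockSum hp (block hps a i) = 0 := by rw [← hP.eval_mul hp, h0, mul_zero]
    rw [h2, mul_zero, sub_zero] at h1
    refine mul_ne_zero hc hτ (h1.symm.trans (Eq.trans ?_ h))
    refine Finset.sum_congr rfl ?_
    rintro ⟨_ | _, I⟩ _ <;> rfl
  · have h1 := expand (testFun P (Fintype.card F) r e (Fin.tail y))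
      (testFun P (Fintype.card F) r e (Fin.tail (g y))) y hy
    have h2 : testFun P (Fintype.card F) r e (Fin.tail y) *
        blockSum hp (block hps y i + Pi.single (lastIdx hp) τ) -
        testFun P (Fintype.card F) r e (Fin.tail (g y)) * blockSum hp (block hps y i) = 0 := by
      rw [testFun_tail_of_zero hps P he, testFun_tail_of_zero hps P he, hg, prod_eval_block_shear,
        ← hP.eval_mul hp, ← hP.eval_mul hp, hy, mul_one,
        ← Finset.mul_prod_erase univ _ (Finset.mem_univ i)]
      have h3 : ∀ l : Fin (p - 1), (block hps y i + Pi.single (lastIdx hp) τ : Fin p → F)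
          (lowIdx l) = block hps y i (lowIdx l) := fun l => by
        rw [Pi.add_apply, Pi.single_eq_of_ne (lowIdx_ne_lastIdx hp l), add_zero]
      simp only [h3]
      ring
    refine Eq.trans ?_ (h1.trans h2)
    refine Finset.sum_congr rfl ?_
    rintro ⟨_ | _, I⟩ _ <;> rfl

end Blocks

section Main

variable {F : Type} [Field F] [Fintype F] {p k s t r n : ℕ}
open scoped Classical

theorem zoom_smul {m : ℕ} {κ : F} (hκ : κ ≠ 0) (a : Fin m → F) (b : Fin n → F) :
    zoom (κ • a) (κ • b) = zoom a b := by
  ext T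
  have h : app T (κ • a) = κ • app T a := by
    ext i
    simp [app]
  rw [mem_zoom, mem_zoom, h]
  exact (smul_right_injective _ hκ).eq_iff

theorem exists_nearly_full_zoom (hp : p.Prime) (hk : 1 ≤ k) (hF : Fintype.card F = p ^ k)
    (hq : 3 ≤ Fintype.card F) (hps : p ∣ s) (hr0 : 0 < r)
    (hr : r + (Fintype.card F - 1) ≤ t * (Fintype.card F - 1)) {P : MvPolynomial (Fin p) F}
    (hP : Pdef p (Fintype.card F) hp.pos P) (f : (Fin n → F) → F)
    (hne : (rej (tst f (testFun (s := s) (t := t) P (Fintype.card F) r))).Nonempty)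
    (hsmall : #(rej (tst f (testFun (s := s) (t := t) P (Fintype.card F) r))) *
      Fintype.card F ^ 20 ≤ Fintype.card (Fin n → Fin (s + t + 1) → F)) :
    ∃ (a : Fin (s + t) → F) (b : Fin n → F), Hfun P s t 0 a ≠ 0 ∧
      #(zoom (Fin.cons 1 a) b \ rej (tst f (testFun P (Fintype.card F) r))) *
        Fintype.card F ^ n ≤
      3 * Fintype.card F ^ 2 * #(rej (tst f (testFun (s := s) (t := t) P (Fintype.card F) r))) := by
  set q := Fintype.card F with hqdef
  set Φ := tst f (testFun (s := s) (t := t) P q r) with hΦ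
  have hL : LineDeg Φ := lineDeg_tst
  have hpos : 0 < #(rej Φ) := hne.card_pos
  have hlt : ∀ j, j < 20 → #(rej Φ) * q ^ j < Fintype.card (Fin n → Fin (s + t + 1) → F) :=
    fun j hj => lt_of_lt_of_le
      (Nat.mul_lt_mul_of_pos_left (Nat.pow_lt_pow_right (by omega) hj) hpos) hsmall
  have h5 := hlt 5 (by omega)
  have hq2 : 9 ≤ q ^ 2 := by nlinarith
  have h6 : 6 * q ^ 3 * #(rej Φ) ≤ #(rej Φ) * q ^ 5 := by
    have : 6 * q ^ 3 ≤ q ^ 5 := by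
      rw [show q ^ 5 = q ^ 2 * q ^ 3 by ring]
      exact Nat.mul_le_mul_right _ (by omega)
    nlinarith
  have hc' : ∀ (a : Fin (s + t + 1) → F) (b : Fin n → F), ∃ c, a ≠ 0 →
      #{x : (Fin n → Fin (s + t + 1) → F) × (Fin n → F) | x.1 ∈ zoom a b ∧
        ¬ Typ Φ c x.1 x.2 a} ≤ 3 * q ^ 2 * #(rej Φ) := by
    intro a b
    by_cases ha : a = 0
    · exact ⟨fun _ => 0, fun h => absurd ha h⟩
    · obtain ⟨c, hc⟩ := hL.exists_typ hq ha b
      exact ⟨c, fun _ => hc⟩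
  choose c hc using hc'
  have hc'' : ∀ a, a ≠ 0 → ∀ b, #{x : (Fin n → Fin (s + t + 1) → F) × (Fin n → F) |
      x.1 ∈ zoom a b ∧ ¬ Typ Φ (c a b) x.1 x.2 a} ≤ 3 * q ^ 2 * #(rej Φ) := fun a ha b => hc a b ha
  have hN : q * (3 * q ^ 2 * #(rej Φ)) < Fintype.card (Fin n → Fin (s + t + 1) → F) := by
    refine lt_of_le_of_lt ?_ (lt_of_le_of_lt h6 h5)
    nlinarith [Nat.zero_le (q ^ 3 * #(rej Φ))]
  have hN2 : 2 * (3 * q ^ 2 * #(rej Φ)) < Fintype.card (Fin n → Fin (s + t + 1) → F) :=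
    lt_of_le_of_lt (Nat.mul_le_mul_right _ (by omega)) hN
  obtain ⟨a, b, ha, hd⟩ := hL.exists_dense_zoom hq hne (by exact_mod_cast lt_of_le_of_lt h6 h5)
  have hI : ∀ b, Inherits (testFun P q r) fun a => c a b := fun b => inherits_of_typ hc'' hN b
  obtain ⟨e, he⟩ := exists_mem_zoom_rej_of_dense ha (hc a b ha) hN2 hd
  have ha0 : a 0 ≠ 0 := fun h0 => he ((hI b).eq_zero_of_infinite hps hr0 hr ha h0 e)
  have hκ := inv_ne_zero ha0
  have ha' : (a 0)⁻¹ • a ≠ 0 := smul_ne_zero hκ ha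
  obtain ⟨e, he⟩ := exists_mem_zoom_rej_of_dense ha' (hc _ ((a 0)⁻¹ • b) ha') hN2
    (by rwa [zoom_smul hκ])
  have h1 : ((a 0)⁻¹ • a) 0 = 1 := by simp [ha0]
  set b' := (a 0)⁻¹ • b
  have he₀ : validE q r t (0 : Fin t → ℕ) := ⟨fun _ => Nat.zero_le _, by simp⟩
  have h2 := (hI b').ne_zero_of_ne_zero h1 he (e₀ := ⟨0, he₀⟩) rfl
  obtain ⟨a', h3, h4, h7⟩ := (hI b').exists_blocks_ne_zero hps (hP.totalDegree_lt hp hk hF) rfl h1 h2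
  have h8 := (hI b').eval_block_ne_zero hp hps hk hF hP rfl h3 h4 h7
  have haa : a' ≠ 0 := fun h => by simp [h] at h3
  have h9 : (Fin.cons 1 (Fin.tail a') : Fin (s + t + 1) → F) = a' := by
    rw [← h3, Fin.cons_self_tail]
  refine ⟨Fin.tail a', b', ?_, ?_⟩
  · have := testFun_tail_of_zero hps P (e := ⟨0, he₀⟩) rfl a'
    rw [testFun] at this
    rw [this]
    exact Finset.prod_ne_zero_iff.2 fun i _ => h8 i
  · rw [h9]
    exact card_zoom_sdiff_rej_le (hc a' b' haa) h4

/-- Affine maps as matrices in homogeneous coordinates. -/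
def affEquiv (F : Type) (n ℓ : ℕ) : Aff F n ℓ ≃ (Fin n → Fin (ℓ + 1) → F) where
  toFun T i := Fin.cons (T.2 i) (T.1 i)
  invFun M := (fun i => Fin.tail (M i), fun i => M i 0)
  left_inv T := by simp [Fin.tail_cons]
  right_inv M := by ext i j; simp [Fin.cons_self_tail]

theorem app_affEquiv {F : Type} [Field F] {n ℓ : ℕ} (T : Aff F n ℓ) (x : Fin ℓ → F) :
    app (affEquiv F n ℓ T) (Fin.cons 1 x) = affApp T x := by
  ext i
  simp [app, affEquiv, affApp, dotProduct, Fin.sum_univ_succ, Matrix.mulVec, add_comm]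

theorem rejects_iff {P : MvPolynomial (Fin p) F} {q : ℕ} {f : (Fin n → F) → F}
    {T : Aff F n (s + t)} : rejects P q s r t n f T ↔
      affEquiv F n (s + t) T ∈ rej (tst f (testFun P q r)) := by
  rw [mem_rej]
  simp only [rejects, ip, tst, testFun, app_affEquiv, Subtype.exists, exists_prop]

theorem card_setOf_affEquiv_mem {F : Type} {n ℓ : ℕ} (S : Finset (Fin n → Fin (ℓ + 1) → F)) :
    Nat.card ↥{T : Aff F n ℓ | affEquiv F n ℓ T ∈ S} = #S :=
  (Nat.card_congr ((affEquiv F n ℓ).subtypeEquiv (q := (· ∈ S)) fun _ => Iff.rfl)).trans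
    (by simp)

theorem mu_rejects {P : MvPolynomial (Fin p) F} {q : ℕ} {f : (Fin n → F) → F} :
    mu {T : Aff F n (s + t) | rejects P q s r t n f T} =
      (#(rej (tst f (testFun (s := s) (t := t) P q r))) : ℝ) /
        Fintype.card (Fin n → Fin (s + t + 1) → F) := by
  simp only [mu, rejects_iff]
  rw [card_setOf_affEquiv_mem, Nat.card_congr (affEquiv F n (s + t)), Nat.card_eq_fintype_card]

theorem dens_rejects {P : MvPolynomial (Fin p) F} {q : ℕ} {f : (Fin n → F) → F}
    (a : Fin (s + t) → F) (b : Fin n → F) :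
    dens {T : Aff F n (s + t) | rejects P q s r t n f T} {T | affApp T a = b} =
      1 - (#(zoom (Fin.cons 1 a) b \ rej (tst f (testFun P q r))) * Fintype.card F ^ n : ℝ) /
        Fintype.card (Fin n → Fin (s + t + 1) → F) := by
  have h1 : {T : Aff F n (s + t) | affApp T a = b} =
      {T | affEquiv F n (s + t) T ∈ zoom (Fin.cons 1 a) b} := by
    ext T
    simp only [Set.mem_ofPred_eq, mem_zoom, app_affEquiv]
  have h2 : {T : Aff F n (s + t) | rejects P q s r t n f T} ∩ {T | affApp T a = b} =
      {T | affEquiv F n (s + t) T ∈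
        zoom (Fin.cons 1 a) b ∩ rej (tst f (testFun P q r))} := by
    rw [h1]
    ext T
    simp only [Set.mem_inter_iff, Set.mem_ofPred_eq, rejects_iff, Finset.mem_inter]
    exact and_comm
  have h3 : (Fin.cons 1 a : Fin (s + t + 1) → F) ≠ 0 := fun h => by
    have := congrFun h 0
    simp at this
  have h4 := card_zoom_mul h3 b
  have h5 := Finset.card_inter_add_card_sdiff (zoom (Fin.cons 1 a) b)
    (rej (tst f (testFun (s := s) (t := t) P q r)))
  have hq : (0 : ℝ) < (Fintype.card F : ℝ) ^ n := by
    have := Fintype.card_pos (α := F)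
    positivity
  have hV : 0 < Fintype.card (Fin n → Fin (s + t + 1) → F) := Fintype.card_pos
  have hz : (0 : ℝ) < #(zoom (Fin.cons 1 a : Fin (s + t + 1) → F) b) := by
    rw [← h4] at hV
    exact_mod_cast Nat.pos_of_mul_pos_right hV
  rw [_root_.dens.eq_1, h2, h1, card_setOf_affEquiv_mem, card_setOf_affEquiv_mem, ← h4]
  have h5' : (#(zoom (Fin.cons 1 a) b ∩ rej (tst f (testFun (s := s) (t := t) P q r))) : ℝ) =
    #(zoom (Fin.cons 1 a : Fin (s + t + 1) → F) b) -
      #(zoom (Fin.cons 1 a) b \ rej (tst f (testFun P q r))) := by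
    rw [← h5]
    push_cast
    ring
  rw [h5']
  push_cast
  field_simp

end Main

/-- There is an absolute constant `M₀` such that for all `M ≥ M₀`: if
`0 < μ(S_t) ≤ q^{-M}` then there are `a ∈ supp(H)` and `b ∈ F_q^n` such that the density of
`S_t` in the zoom-in `C_{a,b}` is at least `1 - 1/(q-1)² - 1/q⁶ - 2000·t·q^{200}·q^{-M/4}`. -/
theorem error_located_in_support :
    ∃ M₀ : ℝ, ∀ M : ℝ, M₀ ≤ M →
    ∀ (p k : ℕ) (hp : p.Prime), 1 ≤ k →
    ∀ (F : Type) [Field F] [Fintype F],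
    ∀ q : ℕ, q = p ^ k → Fintype.card F = q →
    ∀ d s r : ℕ, p ∣ s → 0 < r → r ≤ p * (q - q / p) → d + 1 = s * (q - q / p) + r →
    ∀ t : ℕ, t = max (p + 2) 10 →
    ∀ P : MvPolynomial (Fin p) F, Pdef p q hp.pos P →
    ∀ n : ℕ, s + t + 110 ≤ n →
    ∀ f : (Fin n → F) → F,
      0 < mu {T : Aff F n (s + t) | rejects P q s r t n f T} →
      mu {T : Aff F n (s + t) | rejects P q s r t n f T} ≤ (q : ℝ) ^ (-M) →
    ∃ a ∈ suppH P q s t, ∃ b : Fin n → F,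
      1 - 1 / ((q : ℝ) - 1) ^ 2 - 1 / (q : ℝ) ^ 6 -
          2000 * (t : ℝ) * (q : ℝ) ^ 200 * (q : ℝ) ^ (-(M / 4)) ≤
        dens {T : Aff F n (s + t) | rejects P q s r t n f T}
          {T : Aff F n (s + t) | affApp T a = b} := by
  classical
  refine ⟨20, fun M hM p k hp hk F _ _ q hqp hFq d s r hps hr0 hr _ t ht P hP n _ f hpos hmu => ?_⟩
  subst hFq
  set q := Fintype.card F with hqdef
  have hpq : p ≤ q := hqp ▸ Nat.le_self_pow (by omega) p
  have hp2 := hp.two_le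
  have herr : 0 ≤ 1 / (q : ℝ) ^ 6 + 2000 * (t : ℝ) * (q : ℝ) ^ 200 * (q : ℝ) ^ (-(M / 4)) := by
    positivity
  rw [mu_rejects] at hpos hmu
  have hV : (0 : ℝ) < Fintype.card (Fin n → Fin (s + t + 1) → F) :=
    Nat.cast_pos.2 Fintype.card_pos
  have hne : (rej (tst f (testFun (s := s) (t := t) P q r))).Nonempty := by
    rw [← Finset.card_pos]
    exact_mod_cast (div_pos_iff_of_pos_right hV).1 hpos
  rcases Nat.lt_or_ge q 3 with hq | hq
  · have hq2 : q = 2 := by omega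
    obtain ⟨T, hT⟩ := hne
    obtain ⟨e, he⟩ := mem_rej.1 hT
    obtain ⟨x, -, hx⟩ := Finset.exists_ne_zero_of_sum_ne_zero he
    refine ⟨x, ⟨e.1, e.2.1, right_ne_zero_of_mul hx⟩, 0, ?_⟩
    have h0 : 0 ≤ dens {T : Aff F n (s + t) | rejects P q s r t n f T}
        {T : Aff F n (s + t) | affApp T x = 0} := by
      unfold _root_.dens
      positivity
    refine le_trans ?_ h0
    have h1 : 1 / ((q : ℝ) - 1) ^ 2 = 1 := by
      rw [hq2]
      norm_num
    linarith
  · have hq3 : (3 : ℝ) ≤ q := by exact_mod_cast hq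
    have hq0 : (0 : ℝ) < q := by linarith
    have hμ : (#(rej (tst f (testFun (s := s) (t := t) P q r))) : ℝ) * q ^ 20 ≤
        Fintype.card (Fin n → Fin (s + t + 1) → F) := by
      have h1 : (q : ℝ) ^ (-M) ≤ ((q : ℝ) ^ 20)⁻¹ := by
        rw [← Real.rpow_natCast, ← Real.rpow_neg hq0.le]
        exact Real.rpow_le_rpow_of_exponent_le (by linarith) (by push_cast; linarith)
      have h2 := hmu.trans h1
      rw [div_le_iff₀ hV, inv_mul_eq_div, le_div_iff₀ (by positivity)] at h2
      exact h2
    have hr' : r + (q - 1) ≤ t * (q - 1) := by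
      have h1 : p * (q / p) = q := Nat.mul_div_cancel' (hqp ▸ dvd_pow_self p (by omega))
      have h2 : (p + 2) * (q - 1) ≤ t * (q - 1) := Nat.mul_le_mul_right _ (ht ▸ le_max_left _ _)
      rw [Nat.mul_sub, h1] at hr
      refine le_trans ?_ h2
      obtain ⟨w, hw⟩ : ∃ w, q = w + 1 := ⟨q - 1, by omega⟩
      rw [hw] at hr hpq ⊢
      rw [Nat.add_sub_cancel]
      have : p * (w + 1) - (w + 1) + (w + 1) = p * (w + 1) :=
        Nat.sub_add_cancel (Nat.le_mul_of_pos_left _ hp.pos)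
      nlinarith
    obtain ⟨a, b, ha, hab⟩ := exists_nearly_full_zoom hp hk hqp hq hps hr0 hr' hP f hne
      (by exact_mod_cast hμ)
    refine ⟨a, ⟨0, fun _ => Nat.zero_le _, ha⟩, b, ?_⟩
    rw [dens_rejects]
    have h1 : (#(zoom (Fin.cons 1 a) b \ rej (tst f (testFun P q r))) * q ^ n : ℝ) ≤
        3 * q ^ 2 * #(rej (tst f (testFun (s := s) (t := t) P q r))) := by exact_mod_cast hab
    have h2 : (#(zoom (Fin.cons 1 a) b \ rej (tst f (testFun P q r))) * q ^ n : ℝ) /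
        Fintype.card (Fin n → Fin (s + t + 1) → F) ≤ 1 / ((q : ℝ) - 1) ^ 2 := by
      rw [div_le_div_iff₀ hV (by nlinarith), one_mul]
      refine le_trans ?_ hμ
      have h3 : 3 * (q : ℝ) ^ 2 * ((q : ℝ) - 1) ^ 2 ≤ (q : ℝ) ^ 20 := by
        have h4 : ((q : ℝ) - 1) ^ 2 ≤ (q : ℝ) ^ 2 := by nlinarith
        have h5 : (3 : ℝ) ≤ (q : ℝ) ^ 16 :=
          hq3.trans (le_self_pow₀ (by linarith) (by norm_num))
        calc 3 * (q : ℝ) ^ 2 * ((q : ℝ) - 1) ^ 2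
            ≤ (q : ℝ) ^ 16 * (q : ℝ) ^ 2 * (q : ℝ) ^ 2 := by gcongr
          _ = (q : ℝ) ^ 20 := by ring
      calc _ ≤ 3 * (q : ℝ) ^ 2 * #(rej (tst f (testFun (s := s) (t := t) P q r))) *
              ((q : ℝ) - 1) ^ 2 := mul_le_mul_of_nonneg_right h1 (sq_nonneg _)
        _ = #(rej (tst f (testFun (s := s) (t := t) P q r))) *
              (3 * (q : ℝ) ^ 2 * ((q : ℝ) - 1) ^ 2) := by ring
        _ ≤ _ := mul_le_mul_of_nonneg_left h3 (Nat.cast_nonneg _)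
    linarith

end
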